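/- There exist constants c > 0 and C > 0 such that for all integers m ≥ 1, δ ≥ 1 and all real y ≥ δ, |∑_{d ≤ y/δ} μ(dδ)/ψ_m(d)| ≤ C · ψ(m)^{1/4} · r(δ) · 𝓛(2y/δ)^{−c}, where 𝓛 is evaluated at max(3, 2y/δ). -/

import Mathlib

open Finset MeasureTheory Filter

/-- `M(n, z) := ∑_{d ∣ n, d ≤ z} μ(d)`. -/
noncomputable def mobM (n : ℕ) (z : ℝ) : ℤ :=
  ∑ d ∈ n.divisors.filter (fun d : ℕ => (d : ℝ) ≤ z), ArithmeticFunction.moebius d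

/-- `S(x, z) := ∑_{n ≤ x} M(n, z)²`. -/
noncomputable def Ssum (x z : ℝ) : ℝ :=
  ∑ n ∈ Finset.Icc 1 ⌊x⌋₊, ((mobM n z : ℝ)) ^ 2

/-- `S(z) := ∑_{m, n ≤ z} μ(m) μ(n) / [m, n]`. -/
noncomputable def Sz (z : ℝ) : ℝ :=
  ∑ m ∈ Finset.Icc 1 ⌊z⌋₊, ∑ n ∈ Finset.Icc 1 ⌊z⌋₊,
    ((ArithmeticFunction.moebius m : ℝ) * (ArithmeticFunction.moebius n : ℝ)) / (Nat.lcm m n : ℝ)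

/-- `f(n; iτ) := ∏_{p ∣ n} |1 - p^{-iτ}|²`. -/
noncomputable def fI (n : ℕ) (τ : ℝ) : ℝ :=
  ∏ p ∈ n.primeFactors, ‖(1 : ℂ) - (p : ℂ) ^ (-(τ * Complex.I))‖ ^ 2

/-- `f(n; s) := ∏_{p ∣ n} |1 - p^{-s}|²` for complex `s`. -/
noncomputable def fC (n : ℕ) (s : ℂ) : ℝ :=
  ∏ p ∈ n.primeFactors, ‖(1 : ℂ) - (p : ℂ) ^ (-s)‖ ^ 2

/-- The constant `L`. -/
noncomputable def Lconst : ℝ :=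
  (1 / (2 * Real.pi)) *
    ∫ τ : ℝ,
      (∏' p : Nat.Primes,
        (1 - 1 / ((p : ℕ) : ℝ)) * (1 + (fI (p : ℕ) τ - 1) / ((p : ℕ) : ℝ))) / τ ^ 2

/-- `𝓛(y) := exp{(log y)^{3/5} / (log log y)^{1/5}}`. -/
noncomputable def curlyL (y : ℝ) : ℝ :=
  Real.exp ((Real.log y) ^ ((3 : ℝ) / 5) / (Real.log (Real.log y)) ^ ((1 : ℝ) / 5))

/-- `ψ(n) := ∏_{p ∣ n} (p + 1)`. -/
def psi (n : ℕ) : ℕ := ∏ p ∈ n.primeFactors, (p + 1)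

/-- `ψ_m(n) := ∏_{p ∣ n, p ∤ m} (p + 1)`. -/
def psiM (m n : ℕ) : ℕ := ∏ p ∈ n.primeFactors.filter (fun p : ℕ => ¬ p ∣ m), (p + 1)

/-- `r(n) := ∏_{p ∣ n} (1 + 2/√p)`. -/
noncomputable def rfun (n : ℕ) : ℝ := ∏ p ∈ n.primeFactors, (1 + 2 / Real.sqrt p)

/-- `k(n)`, the squarefree kernel of `n`. -/
def ker (n : ℕ) : ℕ := ∏ p ∈ n.primeFactors, p

/-- `T(y; m) := (6/π²) ∑_{d, t ≤ y} μ(d) μ(t) / ψ([d, t, m])`. -/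
noncomputable def T (y : ℝ) (m : ℕ) : ℝ :=
  (6 / Real.pi ^ 2) *
    ∑ d ∈ Finset.Icc 1 ⌊y⌋₊, ∑ t ∈ Finset.Icc 1 ⌊y⌋₊,
      ((ArithmeticFunction.moebius d : ℝ) * (ArithmeticFunction.moebius t : ℝ)) /
        (psi (Nat.lcm (Nat.lcm d t) m) : ℝ)

/-- The constant `L(m)`. -/
noncomputable def Lm (m : ℕ) : ℝ :=
  ((Nat.totient m : ℝ) ^ 2 / (2 * Real.pi * (m : ℝ) ^ 2 * (ker m : ℝ))) *
    ∫ τ : ℝ,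
      (fI m τ *
        ∏' p : {p : Nat.Primes // ¬ ((p : ℕ) ∣ m)},
          (1 - 1 / ((p.1 : ℕ) : ℝ)) ^ 2 * (1 + fI (p.1 : ℕ) τ / ((p.1 : ℕ) : ℝ))) / τ ^ 2

/-- `B := ∏_p (1 - (3p + 1)/(p (p + 1)²))`. -/
noncomputable def Bconst : ℝ :=
  ∏' p : Nat.Primes,
    (1 - (3 * ((p : ℕ) : ℝ) + 1) / (((p : ℕ) : ℝ) * (((p : ℕ) : ℝ) + 1) ^ 2))

/-- `α(n) := ∏_{p ∣ n} (1 - p/(p² + 3p + 1))`. -/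
noncomputable def alpha (n : ℕ) : ℝ :=
  ∏ p ∈ n.primeFactors, (1 - (p : ℝ) / ((p : ℝ) ^ 2 + 3 * (p : ℝ) + 1))

namespace MoebiusSum

/-- If the first `k` power sums of two `k`-tuples agree and `1, …, k` are invertible, then the
monic polynomials with these roots agree. -/
theorem prod_sub_eq_of_psum_eq {R : Type*} [CommRing R] {k : ℕ} (x y : Fin k → R)
    (hu : ∀ j ∈ Icc 1 k, IsUnit ((j : ℕ) : R))
    (h : ∀ j ∈ Icc 1 k, ∑ i, x i ^ j = ∑ i, y i ^ j) (t : R) :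
    ∏ i, (t - x i) = ∏ i, (t - y i) := by
  have key : ∀ z : Fin k → R, ∀ j : ℕ, (j : R) * (MvPolynomial.aeval z) (MvPolynomial.esymm (Fin k) R j) =
      (-1) ^ (j + 1) * ∑ a ∈ antidiagonal j with a.1 < j,
        (-1) ^ a.1 * (MvPolynomial.aeval z) (MvPolynomial.esymm (Fin k) R a.1) * ∑ i, z i ^ a.2 := by
    intro z j
    have := congrArg (MvPolynomial.aeval z) (MvPolynomial.mul_esymm_eq_sum (Fin k) R j)
    simpa [MvPolynomial.psum, map_sum, map_mul, map_pow] using this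
  have hes : ∀ j ≤ k, (MvPolynomial.aeval x) (MvPolynomial.esymm (Fin k) R j) =
      (MvPolynomial.aeval y) (MvPolynomial.esymm (Fin k) R j) := by
    intro j
    induction j using Nat.strong_induction_on with
    | _ j ih =>
      intro hj
      rcases Nat.eq_zero_or_pos j with rfl | hpos
      · simp
      · refine (hu j (mem_Icc.2 ⟨hpos, hj⟩)).mul_left_cancel ?_
        rw [key x j, key y j]
        congr 1
        refine sum_congr rfl fun a ha => ?_
        simp only [mem_filter, HasAntidiagonal.mem_antidiagonal] at ha
        rw [ih a.1 ha.2 (by omega), h a.2 (mem_Icc.2 ⟨by omega, by omega⟩)]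
  have hp : ∀ z : Fin k → R, ∏ i, (t - z i) = ∑ j ∈ Finset.range (k + 1),
      (-1) ^ j * (MvPolynomial.aeval z (MvPolynomial.esymm (Fin k) R j)) * t ^ (k - j) := by
    intro z
    have h1 := Multiset.prod_X_sub_X_eq_sum_esymm ((univ : Finset (Fin k)).val.map z)
    have h2 := congrArg (Polynomial.eval t) h1
    simp only [Multiset.map_map, Multiset.card_map, card_val, card_univ, Fintype.card_fin,
      Polynomial.eval_finsetSum, Polynomial.eval_mul, Polynomial.eval_pow, Polynomial.eval_C,
      Polynomial.eval_X, Polynomial.eval_neg, Polynomial.eval_one] at h2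
    rw [show (Multiset.map ((fun t => Polynomial.X - Polynomial.C t) ∘ z) univ.val).prod =
      ∏ i, (Polynomial.X - Polynomial.C (z i)) from rfl, Polynomial.eval_prod] at h2
    simp only [Polynomial.eval_sub, Polynomial.eval_X, Polynomial.eval_C] at h2
    rw [h2]
    refine sum_congr rfl fun j _ => ?_
    rw [MvPolynomial.aeval_esymm_eq_multiset_esymm]
    ring
  rw [hp x, hp y]
  refine sum_congr rfl fun j hj => ?_
  rw [hes j (by simpa [Nat.lt_succ_iff] using hj)]

/-- Tuples that are distinct modulo `p` and have the same power sums modulo `p ^ m` agree up to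
permutation modulo `p ^ m`. -/
theorem exists_modEq_of_psum_modEq {p k m : ℕ} (hp : p.Prime) (hkp : k < p) (x y : Fin k → ℤ)
    (hx : ∀ i j, (x i : ℤ) ≡ x j [ZMOD p] → i = j)
    (h : ∀ j ∈ Icc 1 k, ∑ i, x i ^ j ≡ ∑ i, y i ^ j [ZMOD (p ^ m : ℕ)]) (i : Fin k) :
    ∃ l, y i ≡ x l [ZMOD (p ^ m : ℕ)] := by
  have hu : ∀ j ∈ Icc 1 k, IsUnit ((j : ℕ) : ZMod (p ^ m)) := by
    intro j hj
    rw [mem_Icc] at hj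
    rw [ZMod.isUnit_iff_coprime]
    exact Nat.Coprime.pow_right _ (Nat.coprime_of_lt_prime (by omega) (by omega) hp).symm
  have h' : ∀ j ∈ Icc 1 k, ∑ i, ((x i : ℤ) : ZMod (p ^ m)) ^ j = ∑ i, ((y i : ℤ) : ZMod (p ^ m)) ^ j := by
    intro j hj
    have := (ZMod.intCast_eq_intCast_iff _ _ _).2 (h j hj)
    push_cast at this
    exact this
  have hprod := prod_sub_eq_of_psum_eq (fun i => ((x i : ℤ) : ZMod (p ^ m)))
    (fun i => ((y i : ℤ) : ZMod (p ^ m))) hu h' (y i : ZMod (p ^ m))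
  rw [prod_eq_zero (f := fun l => (y i : ZMod (p ^ m)) - (y l : ZMod (p ^ m))) (mem_univ i)
    (sub_self _)] at hprod
  have hdvd : ((p ^ m : ℕ) : ℤ) ∣ ∏ l, (y i - x l) := by
    rw [← ZMod.intCast_zmod_eq_zero_iff_dvd]
    push_cast
    exact hprod
  by_cases hm : m = 0
  · subst hm
    exact ⟨i, by simp [Int.modEq_one]⟩
  have hpi : Prime (p : ℤ) := Nat.prime_iff_prime_int.mp hp
  have hp1 : (p : ℤ) ∣ ∏ l, (y i - x l) := (dvd_trans (by push_cast; exact dvd_pow_self _ hm) hdvd)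
  obtain ⟨l, -, hl⟩ := (hpi.dvd_finsetProd_iff _).1 hp1
  refine ⟨l, (Int.modEq_iff_dvd.2 ?_).symm⟩
  rw [← mul_prod_erase univ _ (mem_univ l)] at hdvd
  have hcop : IsCoprime ((p ^ m : ℕ) : ℤ) (∏ l' ∈ univ.erase l, (y i - x l')) := by
    push_cast
    refine IsCoprime.pow_left (IsCoprime.prod_right fun l' hl' => ?_)
    rw [Prime.coprime_iff_not_dvd hpi]
    intro hd
    refine (ne_of_mem_erase hl') (hx _ _ ?_)
    refine Int.modEq_iff_dvd.2 ?_
    have := dvd_sub hd hl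
    simpa using this
  exact hcop.dvd_of_dvd_mul_right hdvd

/-- Linnik's lemma: the number of tuples distinct modulo `p` with prescribed `j`-th power sums
modulo `p ^ j`. -/
theorem linnik_card_le {p k : ℕ} (hp : p.Prime) (hkp : k < p) (A : Finset ℤ)
    (hA : ∀ u ∈ A, ∀ v ∈ A, u ≡ v [ZMOD (p ^ k : ℕ)] → u = v) (a : ℤ) (h : ℕ → ℤ) :
    #{x ∈ Fintype.piFinset (fun _ : Fin k => A) | (∀ i j, x i ≡ x j [ZMOD p] → i = j) ∧
      ∀ j ∈ Icc 1 k, ∑ i, (x i - a) ^ j ≡ h j [ZMOD (p ^ j : ℕ)]} ≤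
      k ^ k * ∏ j ∈ Icc 1 k, p ^ (k - j) := by
  classical
  have hp0 : 0 < p := hp.pos
  set S := {x ∈ Fintype.piFinset (fun _ : Fin k => A) | (∀ i j, x i ≡ x j [ZMOD p] → i = j) ∧
      ∀ j ∈ Icc 1 k, ∑ i, (x i - a) ^ j ≡ h j [ZMOD (p ^ j : ℕ)]} with hS
  set Tj : ℕ → Finset ℤ := fun j => {c ∈ Ico (0 : ℤ) (p ^ k : ℕ) | c ≡ h j [ZMOD (p ^ j : ℕ)]} with hTj
  have hTcard : ∀ j ∈ Icc 1 k, #(Tj j) = p ^ (k - j) := by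
    intro j hj
    rw [mem_Icc] at hj
    rw [hTj]
    have h1 := Int.Ico_filter_modEq_card (0 : ℤ) ((p ^ k : ℕ) : ℤ) (r := ((p ^ j : ℕ) : ℤ)) (by positivity) (h j)
    simp only at h1 ⊢
    have h2 : (((p ^ k : ℕ) : ℤ) - h j : ℚ) / ((p ^ j : ℕ) : ℤ) = (0 - h j : ℚ) / ((p ^ j : ℕ) : ℤ) + ((p ^ (k - j) : ℕ) : ℤ) := by
      have : (p : ℚ) ^ k = (p : ℚ) ^ j * (p : ℚ) ^ (k - j) := by rw [← pow_add]; congr 1; omega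
      have hpq : (p : ℚ) ≠ 0 := by exact_mod_cast hp0.ne'
      push_cast
      rw [this]
      field_simp
      ring
    rw [h2, Int.ceil_add_intCast] at h1
    simp at h1
    exact_mod_cast h1
  set φ : (Fin k → ℤ) → (j : ℕ) → j ∈ Icc 1 k → ℤ := fun x j _ => (∑ i, (x i - a) ^ j) % ((p ^ k : ℕ) : ℤ)
  have himg : ∀ x ∈ S, φ x ∈ (Icc 1 k).pi (fun j => Tj j) := by
    intro x hx
    rw [hS, mem_filter] at hx
    rw [Finset.mem_pi]
    intro j hj
    simp only [φ, hTj, mem_filter, mem_Ico]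
    refine ⟨⟨Int.emod_nonneg _ (by positivity), Int.emod_lt_of_pos _ (by positivity)⟩, ?_⟩
    refine Int.ModEq.trans ?_ (hx.2.2 j hj)
    refine (Int.mod_modEq _ _).of_dvd ?_
    rw [mem_Icc] at hj
    push_cast
    exact pow_dvd_pow _ hj.2
  have hfib : ∀ b ∈ (Icc 1 k).pi (fun j => Tj j), #{x ∈ S | φ x = b} ≤ k ^ k := by
    intro b _
    rcases ({x ∈ S | φ x = b}).eq_empty_or_nonempty with he | ⟨x0, hx0⟩
    · rw [he]; simp
    · have hsub : {x ∈ S | φ x = b} ⊆ Fintype.piFinset (fun _ : Fin k => univ.image x0) := by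
        intro x hx
        rw [Fintype.mem_piFinset]
        intro i
        rw [mem_filter] at hx hx0
        have hxS := hx.1
        have hx0S := hx0.1
        rw [hS, mem_filter, Fintype.mem_piFinset] at hxS hx0S
        obtain ⟨l, hl⟩ := exists_modEq_of_psum_modEq (m := k) hp hkp (fun i => x0 i - a) (fun i => x i - a)
          (fun i j hij => hx0S.2.1 i j (by simpa using hij.add_right a)) (by
            intro j hj
            have := congrFun (congrFun (hx0.2.trans hx.2.symm) j) hj
            exact this) i
        rw [mem_image]
        refine ⟨l, mem_univ _, ?_⟩
        refine (hA _ (hxS.1 i) _ (hx0S.1 l) ?_).symm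
        simpa using hl.add_right a
      refine (card_le_card hsub).trans ?_
      rw [Fintype.card_piFinset]
      simp only [prod_const, card_univ, Fintype.card_fin]
      exact Nat.pow_le_pow_left (card_image_le.trans (by simp)) _
  refine (card_le_mul_card_image_of_maps_to himg _ hfib).trans ?_
  rw [card_pi, prod_congr rfl hTcard]

/-- Number of pairs `(b, b')` from `B` with `Φ b = Φ b' + h`. -/
noncomputable def pairCount {β : Type*} {k : ℕ} (B : Finset β) (Φ : β → Fin k → ℤ) (h : Fin k → ℤ) : ℕ :=
  #{b ∈ B ×ˢ B | Φ b.1 = Φ b.2 + h}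

/-- The value of an additive character at an integer vector. -/
noncomputable def charAt {k q : ℕ} (ψ : AddChar (Fin k → ZMod (q + 1)) ℂ) (v : Fin k → ℤ) : ℂ :=
  ψ (fun j => (v j : ZMod (q + 1)))

section
variable {k q : ℕ} (ψ : AddChar (Fin k → ZMod (q + 1)) ℂ)

theorem charAt_add (u v : Fin k → ℤ) : charAt ψ (u + v) = charAt ψ u * charAt ψ v := by
  rw [charAt, charAt, charAt, ← AddChar.map_add_eq_mul]
  congr 1
  ext j
  simp

theorem charAt_sum {ι : Type*} (s : Finset ι) (u : ι → Fin k → ℤ) :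
    charAt ψ (∑ i ∈ s, u i) = ∏ i ∈ s, charAt ψ (u i) := by
  classical
  induction s using Finset.induction_on with
  | empty =>
    simp only [sum_empty, prod_empty, charAt, Pi.zero_apply, Int.cast_zero]
    exact AddChar.map_zero_eq_one ψ
  | insert a s ha ih => rw [sum_insert ha, prod_insert ha, charAt_add, ih]

theorem charAt_neg (u : Fin k → ℤ) : charAt ψ (-u) = (starRingEnd ℂ) (charAt ψ u) := by
  rw [charAt, charAt, ← AddChar.map_neg_eq_conj]
  congr 1
  ext j
  simp

end

theorem sum_charAt_eq {k q : ℕ} (v : Fin k → ℤ) (hv : ∀ j, |v j| ≤ q) :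
    ∑ ψ : AddChar (Fin k → ZMod (q + 1)) ℂ, charAt ψ v =
      if v = 0 then (Fintype.card (Fin k → ZMod (q + 1)) : ℂ) else 0 := by
  classical
  simp only [charAt]
  rw [AddChar.sum_apply_eq_ite]
  congr 1
  rw [eq_iff_iff]
  constructor
  · intro h
    ext j
    have h1 := congrFun h j
    simp only [Pi.zero_apply] at h1 ⊢
    rw [ZMod.intCast_zmod_eq_zero_iff_dvd] at h1
    refine Int.eq_zero_of_abs_lt_dvd h1 ?_
    have := hv j
    push_cast
    omega
  · rintro rfl
    ext j
    simp

/-- The exponential sum attached to a finite family of integer vectors. -/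
noncomputable def charSum {β : Type*} {k q : ℕ} (B : Finset β) (Φ : β → Fin k → ℤ)
    (ψ : AddChar (Fin k → ZMod (q + 1)) ℂ) : ℂ := ∑ b ∈ B, charAt ψ (Φ b)

theorem eventually_sum_norm_sq {β : Type*} {k : ℕ} (B : Finset β) (Φ : β → Fin k → ℤ) :
    ∀ᶠ q : ℕ in atTop, ∑ ψ : AddChar (Fin k → ZMod (q + 1)) ℂ, ‖charSum B Φ ψ‖ ^ 2 =
      (Fintype.card (Fin k → ZMod (q + 1)) : ℝ) * pairCount B Φ 0 := by
  classical
  have hbd : ∀ᶠ q : ℕ in atTop, ∀ b ∈ B ×ˢ B, ∀ j ∈ (univ : Finset (Fin k)), |(Φ b.1 - Φ b.2) j| ≤ q := by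
    rw [eventually_all_finset]
    intro b _
    rw [eventually_all_finset]
    intro j _
    filter_upwards [eventually_ge_atTop (|(Φ b.1 - Φ b.2) j|).toNat] with q hq
    omega
  filter_upwards [hbd] with q hq
  have h1 : ∀ ψ : AddChar (Fin k → ZMod (q + 1)) ℂ, ((‖charSum B Φ ψ‖ ^ 2 : ℝ) : ℂ) =
      ∑ b ∈ B ×ˢ B, charAt ψ (Φ b.1 - Φ b.2) := by
    intro ψ
    rw [Complex.ofReal_pow, ← Complex.mul_conj', charSum, map_sum, sum_mul_sum, sum_product]
    refine sum_congr rfl fun b _ => sum_congr rfl fun b' _ => ?_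
    rw [← charAt_neg, ← charAt_add, sub_eq_add_neg]
  have h2 : ((∑ ψ : AddChar (Fin k → ZMod (q + 1)) ℂ, ‖charSum B Φ ψ‖ ^ 2 : ℝ) : ℂ) =
      ((Fintype.card (Fin k → ZMod (q + 1)) : ℝ) * pairCount B Φ 0 : ℝ) := by
    rw [Complex.ofReal_sum, sum_congr rfl fun ψ _ => h1 ψ, sum_comm,
      sum_congr rfl fun b hb => sum_charAt_eq _ fun j => hq b hb j (mem_univ j), ← sum_filter,
      sum_const, pairCount]
    simp [sub_eq_zero, mul_comm]
  exact_mod_cast h2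

/-- The number of representations of a vector. -/
theorem pairCount_eq_sum {β : Type*} {k : ℕ} (B : Finset β) (Φ : β → Fin k → ℤ) (h : Fin k → ℤ) :
    pairCount B Φ h = ∑ v ∈ B.image Φ, #{b ∈ B | Φ b = v} * #{b ∈ B | Φ b + h = v} := by
  classical
  rw [pairCount, card_eq_sum_card_fiberwise (f := fun b => Φ b.1) (t := B.image Φ)
    (fun b hb => by simp at hb; simpa using ⟨b.1, hb.1.1, rfl⟩)]
  refine sum_congr rfl fun v hv => ?_
  rw [← card_product]
  congr 1
  ext b
  simp only [mem_filter, mem_product]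
  constructor
  · rintro ⟨⟨⟨h1, h2⟩, h3⟩, h4⟩
    exact ⟨⟨h1, h4⟩, h2, h3.symm.trans h4⟩
  · rintro ⟨⟨h1, h4⟩, h2, h3⟩
    exact ⟨⟨⟨h1, h2⟩, h4.trans h3.symm⟩, h4⟩

theorem pairCount_le {β : Type*} {k : ℕ} (B : Finset β) (Φ : β → Fin k → ℤ) (h : Fin k → ℤ) :
    pairCount B Φ h ≤ pairCount B Φ 0 := by
  classical
  have h0 : ∀ Ψ : β → Fin k → ℤ, pairCount B Ψ 0 = ∑ v ∈ B.image Ψ, #{b ∈ B | Ψ b = v} ^ 2 := by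
    intro Ψ
    rw [pairCount_eq_sum]
    simp [sq]
  have h2 : ∑ v ∈ B.image Φ, #{b ∈ B | Φ b + h = v} ^ 2 ≤ pairCount B Φ 0 := by
    have : pairCount B Φ 0 = pairCount B (fun b => Φ b + h) 0 := by simp [pairCount]
    rw [this, h0]
    refine sum_le_sum_of_ne_zero fun v _ hv => ?_
    obtain ⟨b, hb⟩ := card_ne_zero.1 (fun h => hv (by rw [h]; simp))
    rw [mem_filter] at hb
    exact mem_image.2 ⟨b, hb⟩
  have h3 : 2 * pairCount B Φ h ≤ 2 * pairCount B Φ 0 := by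
    calc 2 * pairCount B Φ h = ∑ v ∈ B.image Φ, 2 * #{b ∈ B | Φ b = v} * #{b ∈ B | Φ b + h = v} := by
          rw [pairCount_eq_sum, mul_sum]
          exact sum_congr rfl fun v _ => by ring
      _ ≤ ∑ v ∈ B.image Φ, (#{b ∈ B | Φ b = v} ^ 2 + #{b ∈ B | Φ b + h = v} ^ 2) :=
          sum_le_sum fun v _ => two_mul_le_add_sq _ _
      _ ≤ _ := by
          rw [sum_add_distrib, ← h0]
          omega
  omega

theorem pairCount_le_card_mul_sum {β ι : Type*} {k : ℕ} (B : Finset β) (Φ : β → Fin k → ℤ)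
    (I : Finset ι) (C : ι → Finset β) (hB : ∀ b ∈ B, ∃ i ∈ I, b ∈ C i) :
    pairCount B Φ 0 ≤ #I * ∑ i ∈ I, pairCount (C i) Φ 0 := by
  classical
  have h0 : ∀ D : Finset β, pairCount D Φ 0 = ∑ v ∈ D.image Φ, #{b ∈ D | Φ b = v} ^ 2 := by
    intro D
    rw [pairCount_eq_sum]
    simp [sq]
  calc pairCount B Φ 0 = ∑ v ∈ B.image Φ, #{b ∈ B | Φ b = v} ^ 2 := h0 B
    _ ≤ ∑ v ∈ B.image Φ, #I * ∑ i ∈ I, #{b ∈ C i | Φ b = v} ^ 2 := by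
        refine sum_le_sum fun v _ => ?_
        refine le_trans (Nat.pow_le_pow_left ?_ 2) sq_sum_le_card_mul_sum_sq
        refine le_trans (card_le_card ?_) card_biUnion_le
        intro b hb
        rw [mem_filter] at hb
        obtain ⟨i, hi, hbi⟩ := hB b hb.1
        exact mem_biUnion.2 ⟨i, hi, mem_filter.2 ⟨hbi, hb.2⟩⟩
    _ = #I * ∑ i ∈ I, ∑ v ∈ B.image Φ, #{b ∈ C i | Φ b = v} ^ 2 := by rw [← mul_sum, sum_comm]
    _ ≤ _ := by
        refine Nat.mul_le_mul_left _ (sum_le_sum fun i _ => ?_)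
        rw [h0]
        refine sum_le_sum_of_ne_zero fun v _ hv => ?_
        obtain ⟨b, hb⟩ := card_ne_zero.1 (fun h => hv (by rw [h]; simp))
        rw [mem_filter] at hb
        exact mem_image.2 ⟨b, hb⟩

/-- The vector `(x, x², …, xᵏ)`. -/
def powVec (k : ℕ) (x : ℤ) : Fin k → ℤ := fun j => x ^ (j.val + 1)

/-- The vector of power sums of a tuple. -/
def psumVec (k n : ℕ) (x : Fin n → ℤ) : Fin k → ℤ := ∑ i, powVec k (x i)

/-- The number of solutions of Vinogradov's system of degree `k` in `2 n` variables from `A`. -/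
noncomputable def vinoCount (k n : ℕ) (A : Finset ℤ) : ℕ :=
  pairCount (Fintype.piFinset fun _ : Fin n => A) (psumVec k n) 0

theorem psumVec_apply (k n : ℕ) (x : Fin n → ℤ) (j : Fin k) :
    psumVec k n x j = ∑ i, x i ^ (j.val + 1) := by
  simp [psumVec, powVec]

theorem charSum_piFinset {k n q : ℕ} (A : Fin n → Finset ℤ) (ψ : AddChar (Fin k → ZMod (q + 1)) ℂ) :
    charSum (Fintype.piFinset A) (psumVec k n) ψ = ∏ i, charSum (A i) (powVec k) ψ := by
  simp only [charSum]
  rw [prod_univ_sum]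
  exact sum_congr rfl fun x _ => charAt_sum ψ _ _

theorem charSum_product {β γ : Type*} {k q : ℕ} (B : Finset β) (C : Finset γ) (Φ : β → Fin k → ℤ)
    (Ψ : γ → Fin k → ℤ) (ψ : AddChar (Fin k → ZMod (q + 1)) ℂ) :
    charSum (B ×ˢ C) (fun b => Φ b.1 + Ψ b.2) ψ = charSum B Φ ψ * charSum C Ψ ψ := by
  simp only [charSum]
  rw [sum_mul_sum, sum_product]
  exact sum_congr rfl fun x _ => sum_congr rfl fun y _ => charAt_add ψ _ _

theorem eventually_sum_norm_pow (k n : ℕ) (A : Finset ℤ) :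
    ∀ᶠ q : ℕ in atTop, ∑ ψ : AddChar (Fin k → ZMod (q + 1)) ℂ, (‖charSum A (powVec k) ψ‖ ^ 2) ^ n =
      (Fintype.card (Fin k → ZMod (q + 1)) : ℝ) * vinoCount k n A := by
  filter_upwards [eventually_sum_norm_sq (Fintype.piFinset fun _ : Fin n => A) (psumVec k n)] with q hq
  rw [vinoCount, ← hq]
  refine sum_congr rfl fun ψ _ => ?_
  rw [charSum_piFinset, norm_prod]
  simp [← pow_mul, mul_comm]

theorem psum_sub_const {ι κ : Type*} [Fintype ι] [Fintype κ] {k : ℕ} (x : ι → ℤ) (y : κ → ℤ)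
    (hcard : Fintype.card ι = Fintype.card κ)
    (h : ∀ j ∈ Icc 1 k, ∑ i, x i ^ j = ∑ i, y i ^ j) (a : ℤ) (j : ℕ) (hj : j ≤ k) :
    ∑ i, (x i - a) ^ j = ∑ i, (y i - a) ^ j := by
  have h' : ∀ l ≤ k, ∑ i, x i ^ l = ∑ i, y i ^ l := by
    intro l hl
    rcases Nat.eq_zero_or_pos l with rfl | hpos
    · simp [hcard]
    · exact h l (mem_Icc.2 ⟨hpos, hl⟩)
  simp only [sub_eq_add_neg, add_pow]
  rw [sum_comm, sum_comm (s := (univ : Finset κ))]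
  refine sum_congr rfl fun l hl => ?_
  rw [← sum_mul, ← sum_mul, ← sum_mul, ← sum_mul, h' l]
  rw [Finset.mem_range] at hl
  omega

theorem psumVec_eq_iff {k n : ℕ} (x y : Fin n → ℤ) :
    psumVec k n x = psumVec k n y ↔ ∀ j ∈ Icc 1 k, ∑ i, x i ^ j = ∑ i, y i ^ j := by
  constructor
  · intro h j hj
    rw [mem_Icc] at hj
    have := congrFun h ⟨j - 1, by omega⟩
    rw [psumVec_apply, psumVec_apply] at this
    simpa [Nat.sub_add_cancel hj.1] using this
  · intro h
    ext j
    rw [psumVec_apply, psumVec_apply]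
    exact h _ (mem_Icc.2 ⟨by omega, by omega⟩)

theorem vinoCount_le_of_affine {k n : ℕ} (A C : Finset ℤ) (a p : ℤ) (hp : p ≠ 0)
    (hA : ∀ x ∈ A, ∃ z ∈ C, x = a + p * z) : vinoCount k n A ≤ vinoCount k n C := by
  classical
  choose! g hgC hg using hA
  refine card_le_card_of_injOn (fun b => (fun i => g (b.1 i), fun i => g (b.2 i))) ?_ ?_
  · intro b hb
    simp only [coe_filter, mem_product, Fintype.mem_piFinset, Set.mem_ofPred_eq, add_zero] at hb ⊢
    refine ⟨⟨fun i => hgC _ (hb.1.1 i), fun i => hgC _ (hb.1.2 i)⟩, ?_⟩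
    rw [psumVec_eq_iff] at hb ⊢
    intro j hj
    have h1 := psum_sub_const b.1 b.2 rfl hb.2 a j (mem_Icc.1 hj).2
    have h2 : ∀ x : Fin n → ℤ, (∀ i, x i ∈ A) → ∑ i, (x i - a) ^ j = p ^ j * ∑ i, g (x i) ^ j := by
      intro x hx
      rw [mul_sum]
      refine sum_congr rfl fun i _ => ?_
      rw [← mul_pow]
      congr 1
      linarith [hg _ (hx i)]
    rw [h2 _ hb.1.1, h2 _ hb.1.2] at h1
    exact mul_left_cancel₀ (pow_ne_zero _ hp) h1
  · intro b hb c hc hbc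
    simp only [coe_filter, mem_product, Fintype.mem_piFinset, Set.mem_ofPred_eq, add_zero] at hb hc
    simp only [Prod.mk.injEq] at hbc
    refine Prod.ext (funext fun i => ?_) (funext fun i => ?_)
    · rw [hg _ (hb.1.1 i), hg _ (hc.1.1 i), congrFun hbc.1 i]
    · rw [hg _ (hb.1.2 i), hg _ (hc.1.2 i), congrFun hbc.2 i]

section
variable {k s p : ℕ}

/-- The elements of `A` congruent to `a` modulo `p`. -/
def residuePart (p : ℕ) (A : Finset ℤ) (a : ℕ) : Finset ℤ := {x ∈ A | x % (p : ℤ) = a}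

theorem charSum_residuePart (hp : 0 < p) (A : Finset ℤ) {q : ℕ} (ψ : AddChar (Fin k → ZMod (q + 1)) ℂ) :
    charSum A (powVec k) ψ = ∑ a ∈ Finset.range p, charSum (residuePart p A a) (powVec k) ψ := by
  simp only [charSum, residuePart]
  have : ∀ x ∈ A, (x % (p : ℤ)).toNat ∈ Finset.range p := fun x _ => by
    have h1 := Int.emod_nonneg x (b := p) (by omega)
    have h2 := Int.emod_lt_of_pos x (b := p) (by omega)
    simp only [Finset.mem_range]
    omega
  rw [← sum_fiberwise_of_maps_to this]
  refine sum_congr rfl fun a _ => sum_congr ?_ fun _ _ => rfl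
  ext x
  simp only [mem_filter, and_congr_right_iff]
  intro _
  have h1 := Int.emod_nonneg x (b := p) (by omega)
  omega

theorem vinoCount_residuePart_le (hp : 0 < p) (P a n : ℕ) :
    vinoCount k n (residuePart p (Ico 0 (P : ℤ)) a) ≤ vinoCount k n (Ico 0 ((P / p + 1 : ℕ) : ℤ)) := by
  refine vinoCount_le_of_affine _ _ a p (by omega) fun x hx => ⟨x / p, ?_, ?_⟩
  · simp only [residuePart, mem_filter, mem_Ico] at hx ⊢
    refine ⟨Int.ediv_nonneg hx.1.1 (by omega), ?_⟩
    have : x / p ≤ P / p := Int.ediv_le_ediv (by omega) hx.1.2.le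
    push_cast
    omega
  · simp only [residuePart, mem_filter] at hx
    rw [← hx.2]
    exact (Int.emod_add_mul_ediv x p).symm

/-- Solutions in which two of the first `k` variables are congruent modulo `p`. -/
theorem pairCount_congruent_le (hp : 0 < p) (P : ℕ) (A : Finset ℤ) (hA : A = Ico 0 (P : ℤ)) (i j : Fin k)
    (hij : i ≠ j) (a : ℕ) (M : ℝ) (hM : 0 ≤ M) :
    M ^ 2 * pairCount (Fintype.piFinset (fun l : Fin k => if l = i ∨ l = j then residuePart p A a else A) ×ˢ
        Fintype.piFinset (fun _ : Fin s => A)) (fun b => psumVec k k b.1 + psumVec k s b.2) 0 ≤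
      vinoCount k (k + s) A + M ^ (k + s) * vinoCount k (k + s) (Ico 0 ((P / p + 1 : ℕ) : ℤ)) := by
  obtain ⟨q, h1, h2, h3⟩ := ((eventually_sum_norm_sq (Fintype.piFinset (fun l : Fin k => if l = i ∨ l = j then residuePart p A a else A) ×ˢ
        Fintype.piFinset (fun _ : Fin s => A)) (fun b => psumVec k k b.1 + psumVec k s b.2)).and
    ((eventually_sum_norm_pow k (k + s) A).and (eventually_sum_norm_pow k (k + s) (residuePart p A a)))).exists
  have hW : (0 : ℝ) < Fintype.card (Fin k → ZMod (q + 1)) := by exact_mod_cast Fintype.card_pos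
  have hQ : (vinoCount k (k + s) (residuePart p A a) : ℝ) ≤ vinoCount k (k + s) (Ico 0 ((P / p + 1 : ℕ) : ℤ)) := by
    rw [hA]
    exact_mod_cast vinoCount_residuePart_le hp P a (k + s)
  refine le_trans ?_ (add_le_add_right (mul_le_mul_of_nonneg_left hQ (pow_nonneg hM _)) _)
  refine le_of_mul_le_mul_left ?_ hW
  calc (Fintype.card (Fin k → ZMod (q + 1)) : ℝ) * (M ^ 2 * pairCount (Fintype.piFinset (fun l : Fin k => if l = i ∨ l = j then residuePart p A a else A) ×ˢ
        Fintype.piFinset (fun _ : Fin s => A)) (fun b => psumVec k k b.1 + psumVec k s b.2) 0)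
      = ∑ ψ : AddChar (Fin k → ZMod (q + 1)) ℂ, M ^ 2 * ‖charSum (Fintype.piFinset (fun l : Fin k => if l = i ∨ l = j then residuePart p A a else A) ×ˢ
        Fintype.piFinset (fun _ : Fin s => A)) (fun b => psumVec k k b.1 + psumVec k s b.2) ψ‖ ^ 2 := by
        rw [← mul_sum, h1]; ring
    _ ≤ ∑ ψ : AddChar (Fin k → ZMod (q + 1)) ℂ, ((‖charSum A (powVec k) ψ‖ ^ 2) ^ (k + s) +
          M ^ (k + s) * (‖charSum (residuePart p A a) (powVec k) ψ‖ ^ 2) ^ (k + s)) := by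
        refine sum_le_sum fun ψ _ => ?_
        rw [charSum_product (Φ := psumVec k k) (Ψ := psumVec k s), charSum_piFinset, charSum_piFinset,
          norm_mul, norm_prod, norm_prod, mul_pow, ← prod_pow, ← prod_pow]
        set u := ‖charSum (residuePart p A a) (powVec k) ψ‖ ^ 2 with hu
        set v := ‖charSum A (powVec k) ψ‖ ^ 2 with hv
        have hu0 : 0 ≤ u := by positivity
        have hv0 : 0 ≤ v := by positivity
        have e1 : M ^ 2 * ∏ l : Fin k, ‖charSum (if l = i ∨ l = j then residuePart p A a else A) (powVec k) ψ‖ ^ 2 =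
            ∏ l : Fin k, (if l = i ∨ l = j then M * u else v) := by
          have e2 : M ^ 2 = ∏ l : Fin k, (if l = i ∨ l = j then M else 1) := by
            rw [prod_ite]
            simp only [prod_const, one_pow, mul_one]
            congr 1
            rw [filter_or, filter_eq', filter_eq']
            simp [card_pair hij]
          rw [e2, ← prod_mul_distrib]
          refine prod_congr rfl fun l _ => ?_
          split_ifs
          · rfl
          · rw [one_mul]
        rw [← mul_assoc, e1, prod_const, card_univ, Fintype.card_fin]
        have hm : ∏ l : Fin k, (if l = i ∨ l = j then M * u else v) ≤ ∏ l : Fin k, max (M * u) v := by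
          refine prod_le_prod (fun l _ => ?_) (fun l _ => ?_)
          · split_ifs <;> positivity
          · split_ifs
            · exact le_max_left _ _
            · exact le_max_right _ _
        rw [prod_const, card_univ, Fintype.card_fin] at hm
        calc _ ≤ max (M * u) v ^ k * max (M * u) v ^ s := by
              refine mul_le_mul hm (pow_le_pow_left₀ hv0 (le_max_right _ _) _) (by positivity) (by positivity)
          _ = max (M * u) v ^ (k + s) := by rw [pow_add]
          _ ≤ _ := by
              rw [← mul_pow]
              rcases max_cases (M * u) v with h | h <;> rw [h.1]
              · have : 0 ≤ v ^ (k + s) := by positivity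
                linarith
              · have : 0 ≤ (M * u) ^ (k + s) := by positivity
                linarith
    _ = _ := by rw [sum_add_distrib, ← mul_sum, h2, h3]; ring

/-- Solutions whose first `k` variables on either side are distinct modulo `p`. -/
theorem pairCount_distinct_le (hp : p.Prime) (hkp : k < p) (P : ℕ) (hP : P ≤ p ^ k) (D : Finset (Fin k → ℤ))
    (hD : D = {x ∈ Fintype.piFinset (fun _ : Fin k => Ico 0 (P : ℤ)) | ∀ i j, x i ≡ x j [ZMOD p] → i = j})
    (a : ℕ) :
    pairCount (D ×ˢ Fintype.piFinset (fun _ : Fin s => residuePart p (Ico 0 (P : ℤ)) a))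
      (fun b => psumVec k k b.1 + psumVec k s b.2) 0 ≤
      P ^ k * (k ^ k * ∏ j ∈ Icc 1 k, p ^ (k - j)) * vinoCount k s (Ico 0 ((P / p + 1 : ℕ) : ℤ)) := by
  classical
  set E := {z ∈ D ×ˢ D | ∀ j ∈ Icc 1 k, ∑ i, (z.1 i - a) ^ j ≡ ∑ i, (z.2 i - a) ^ j [ZMOD (p ^ j : ℕ)]} with hE
  set B := Fintype.piFinset (fun _ : Fin s => residuePart p (Ico 0 (P : ℤ)) a) with hB
  have hEcard : #E ≤ P ^ k * (k ^ k * ∏ j ∈ Icc 1 k, p ^ (k - j)) := by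
    have hDP : #D ≤ P ^ k := by
      rw [hD]
      refine (card_filter_le _ _).trans ?_
      rw [Fintype.card_piFinset]
      simp
    refine le_trans ?_ (Nat.mul_le_mul_right _ hDP)
    rw [mul_comm]
    refine card_le_mul_card_image_of_maps_to (f := Prod.snd) (fun z hz => (mem_product.1 (mem_filter.1 hz).1).2) _ ?_
    intro y hy
    refine le_trans ?_ (linnik_card_le hp hkp (Ico 0 (P : ℤ)) ?_ a (fun j => ∑ i, (y i - a) ^ j))
    · refine card_le_card_of_injOn Prod.fst ?_ ?_
      · intro z hz
        simp only [hD, coe_filter, mem_filter, mem_product, Set.mem_ofPred_eq] at hz ⊢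
        obtain ⟨⟨⟨⟨h1, h2⟩, h3⟩, h4⟩, rfl⟩ := hz
        exact ⟨h1, h2, h4⟩
      · intro z hz w hw h
        simp only [coe_filter, Set.mem_ofPred_eq] at hz hw
        exact Prod.ext h (hz.2.trans hw.2.symm)
    · intro u hu v hv huv
      rw [mem_Ico] at hu hv
      have hP' : (P : ℤ) ≤ (p ^ k : ℕ) := by exact_mod_cast hP
      rwa [Int.ModEq, Int.emod_eq_of_lt hu.1 (by omega), Int.emod_eq_of_lt hv.1 (by omega)] at huv
  have hfib : pairCount (D ×ˢ B) (fun b => psumVec k k b.1 + psumVec k s b.2) 0 ≤ #E * vinoCount k s (residuePart p (Ico 0 (P : ℤ)) a) := by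
    rw [pairCount, mul_comm]
    refine card_le_mul_card_image_of_maps_to (f := fun b => (b.1.1, b.2.1)) ?_ _ ?_
    · intro b hb
      simp only [mem_filter, mem_product, add_zero] at hb
      simp only [hE, mem_filter, mem_product]
      refine ⟨⟨hb.1.1.1, hb.1.2.1⟩, fun j hj => ?_⟩
      have hps := psum_sub_const (k := k) (Sum.elim b.1.1 b.1.2) (Sum.elim b.2.1 b.2.2) rfl (by
        intro j hj
        rw [mem_Icc] at hj
        have := congrFun hb.2 ⟨j - 1, by omega⟩
        simp only [Pi.add_apply, psumVec_apply, Nat.sub_add_cancel hj.1] at this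
        simpa using this) a j (mem_Icc.1 hj).2
      simp only [Fintype.sum_sum_type, Sum.elim_inl, Sum.elim_inr] at hps
      have hdv : ∀ u ∈ B, ((p ^ j : ℕ) : ℤ) ∣ ∑ i, (u i - a) ^ j := by
        intro u hu
        refine dvd_sum fun i _ => ?_
        push_cast
        refine pow_dvd_pow_of_dvd ?_ _
        rw [hB, Fintype.mem_piFinset] at hu
        have := (mem_filter.1 (hu i)).2
        rw [← this]
        exact Int.dvd_self_sub_emod
      refine Int.modEq_iff_dvd.2 ?_
      have := dvd_sub (hdv _ hb.1.1.2) (hdv _ hb.1.2.2)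
      have e : ∑ i, (b.2.1 i - (a : ℤ)) ^ j - ∑ i, (b.1.1 i - (a : ℤ)) ^ j =
          ∑ i, (b.1.2 i - (a : ℤ)) ^ j - ∑ i, (b.2.2 i - (a : ℤ)) ^ j := by linarith
      rw [← e] at this
      exact this
    · intro z hz
      refine le_trans ?_ (pairCount_le B (psumVec k s) (psumVec k k z.2 - psumVec k k z.1))
      refine card_le_card_of_injOn (fun b => (b.1.2, b.2.2)) ?_ ?_
      · intro b hb
        simp only [coe_filter, mem_filter, mem_product, Set.mem_ofPred_eq, add_zero] at hb ⊢
        obtain ⟨⟨⟨⟨h1, h2⟩, h3, h4⟩, h5⟩, rfl⟩ := hb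
        refine ⟨⟨h2, h4⟩, ?_⟩
        simp only
        linear_combination h5
      · intro b hb c hc hbc
        simp only [coe_filter, mem_filter, Set.mem_ofPred_eq] at hb hc
        have h1 := hb.2.trans hc.2.symm
        simp only [Prod.mk.injEq] at h1 hbc
        exact Prod.ext (Prod.ext h1.1 hbc.1) (Prod.ext h1.2 hbc.2)
  exact hfib.trans (Nat.mul_le_mul hEcard (vinoCount_residuePart_le hp.pos P a s))

end

/-- The contribution of the tuples with a repeated residue. -/
theorem pairCount_not_distinct_le {k s p : ℕ} (hk : 0 < k) (hp : 0 < p) (P : ℕ) (G : Finset (Fin k → ℤ))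
    (hG : G = {x ∈ Fintype.piFinset (fun _ : Fin k => Ico 0 (P : ℤ)) | ¬ ∀ i j, x i ≡ x j [ZMOD p] → i = j}) :
    4 * (pairCount (G ×ˢ Fintype.piFinset (fun _ : Fin s => Ico 0 (P : ℤ)))
      (fun b => psumVec k k b.1 + psumVec k s b.2) 0 : ℝ) ≤
      vinoCount k (k + s) (Ico 0 (P : ℤ)) +
        (2 * k ^ 2 * p : ℝ) ^ (k + s) * vinoCount k (k + s) (Ico 0 ((P / p + 1 : ℕ) : ℤ)) := by
  classical
  set A := Ico 0 (P : ℤ) with hA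
  set I : Finset ((Fin k × Fin k) × ℕ) := (univ.filter fun z : Fin k × Fin k => z.1 ≠ z.2) ×ˢ Finset.range p with hI
  have hIc : #I ≤ k ^ 2 * p := by
    rw [hI, card_product, card_range]
    refine Nat.mul_le_mul_right _ ((card_le_univ _).trans ?_)
    simp [sq]
  set C : (Fin k × Fin k) × ℕ → Finset ((Fin k → ℤ) × (Fin s → ℤ)) := fun z =>
    Fintype.piFinset (fun l : Fin k => if l = z.1.1 ∨ l = z.1.2 then residuePart p A z.2 else A) ×ˢ
        Fintype.piFinset (fun _ : Fin s => A) with hC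
  have h1 := pairCount_le_card_mul_sum (G ×ˢ Fintype.piFinset (fun _ : Fin s => A))
    (fun b => psumVec k k b.1 + psumVec k s b.2) I C (by
      intro b hb
      rw [hG, mem_product, mem_filter] at hb
      obtain ⟨⟨hb1, hb2⟩, hb3⟩ := hb
      push Not at hb2
      obtain ⟨i, j, hij, hne⟩ := hb2
      have e1 := Int.emod_nonneg (b.1 i) (b := p) (by omega)
      have e2 := Int.emod_lt_of_pos (b.1 i) (b := p) (by omega)
      refine ⟨((i, j), (b.1 i % (p : ℤ)).toNat), ?_, ?_⟩
      · simp only [hI, mem_product, mem_filter, mem_univ, true_and, Finset.mem_range]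
        exact ⟨hne, by omega⟩
      · simp only [hC, mem_product]
        refine ⟨?_, hb3⟩
        rw [Fintype.mem_piFinset] at hb1 ⊢
        intro l
        split_ifs with h
        · simp only [residuePart, mem_filter]
          refine ⟨hb1 l, ?_⟩
          rcases h with rfl | rfl
          · omega
          · rw [← hij]; omega
        · exact hb1 l)
  set M : ℝ := 2 * k ^ 2 * p with hM
  have hM0 : 0 < M := by
    have : (0 : ℝ) < k := by exact_mod_cast hk
    have : (0 : ℝ) < p := by exact_mod_cast hp
    positivity
  set R : ℝ := vinoCount k (k + s) A + M ^ (k + s) * vinoCount k (k + s) (Ico 0 ((P / p + 1 : ℕ) : ℤ)) with hR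
  have hR0 : 0 ≤ R := by positivity
  have h2 : ∀ z ∈ I, M ^ 2 * pairCount (C z) (fun b => psumVec k k b.1 + psumVec k s b.2) 0 ≤ R := by
    intro z hz
    simp only [hI, mem_product, mem_filter, mem_univ, true_and] at hz
    exact pairCount_congruent_le hp P A hA z.1.1 z.1.2 hz.1 z.2 M hM0.le
  have hIr : (#I : ℝ) ≤ M / 2 := by
    rw [hM]
    have : (#I : ℝ) ≤ k ^ 2 * p := by exact_mod_cast hIc
    linarith
  have h3 : M ^ 2 * ∑ z ∈ I, (pairCount (C z) (fun b => psumVec k k b.1 + psumVec k s b.2) 0 : ℝ) ≤ #I * R := by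
    rw [mul_sum, ← nsmul_eq_mul, ← sum_const]
    exact sum_le_sum h2
  have h1' : (pairCount (G ×ˢ Fintype.piFinset (fun _ : Fin s => A)) (fun b => psumVec k k b.1 + psumVec k s b.2) 0 : ℝ) ≤
      #I * ∑ z ∈ I, (pairCount (C z) (fun b => psumVec k k b.1 + psumVec k s b.2) 0 : ℝ) := by exact_mod_cast h1
  refine le_of_mul_le_mul_left ?_ (pow_pos hM0 2)
  calc _ = 4 * (M ^ 2 * (pairCount (G ×ˢ Fintype.piFinset (fun _ : Fin s => A)) (fun b => psumVec k k b.1 + psumVec k s b.2) 0 : ℝ)) := by ring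
    _ ≤ 4 * (M ^ 2 * (#I * ∑ z ∈ I, (pairCount (C z) (fun b => psumVec k k b.1 + psumVec k s b.2) 0 : ℝ))) := by gcongr
    _ = 4 * (#I * (M ^ 2 * ∑ z ∈ I, (pairCount (C z) (fun b => psumVec k k b.1 + psumVec k s b.2) 0 : ℝ))) := by ring
    _ ≤ 4 * (M / 2 * (M / 2 * R)) := by
        have h5 := h3.trans (mul_le_mul_of_nonneg_right hIr hR0)
        refine mul_le_mul_of_nonneg_left ?_ (by norm_num)
        exact mul_le_mul hIr h5 (by positivity) (by positivity)
    _ = _ := by ring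

/-- The recursive inequality for Vinogradov's mean value. -/
theorem vinoCount_step {k s p : ℕ} (hk : 0 < k) (hs : 0 < s) (hp : p.Prime) (hkp : k < p) (P : ℕ) (hP : P ≤ p ^ k) :
    (vinoCount k (k + s) (Ico 0 (P : ℤ)) : ℝ) ≤
      4 * p ^ (2 * s) * (P ^ k * (k ^ k * ∏ j ∈ Icc 1 k, (p : ℝ) ^ (k - j))) *
        vinoCount k s (Ico 0 ((P / p + 1 : ℕ) : ℤ)) +
      (2 * k ^ 2 * p : ℝ) ^ (k + s) * vinoCount k (k + s) (Ico 0 ((P / p + 1 : ℕ) : ℤ)) := by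
  classical
  set A := Ico 0 (P : ℤ) with hA
  set B := Fintype.piFinset (fun _ : Fin k => A) with hB
  set S := Fintype.piFinset (fun _ : Fin s => A) with hS
  set D := {x ∈ B | ∀ i j, x i ≡ x j [ZMOD p] → i = j} with hD
  set G := {x ∈ B | ¬ ∀ i j, x i ≡ x j [ZMOD p] → i = j} with hG
  have hGle := pairCount_not_distinct_le (s := s) hk hp.pos P G hG
  have hDle := fun a => pairCount_distinct_le (s := s) hp hkp P hP D hD a
  set Φ : (Fin k → ℤ) × (Fin s → ℤ) → Fin k → ℤ := fun b => psumVec k k b.1 + psumVec k s b.2 with hΦ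
  set Sa : ℕ → Finset (Fin s → ℤ) := fun a => Fintype.piFinset (fun _ : Fin s => residuePart p A a) with hSa
  obtain ⟨q, h1, h2, h3⟩ := ((eventually_sum_norm_pow k (k + s) A).and ((eventually_sum_norm_sq (G ×ˢ S) Φ).and
    ((eventually_all_finset (Finset.range p)).2 fun a _ => eventually_sum_norm_sq (D ×ˢ Sa a) Φ))).exists
  have hW : (0 : ℝ) < Fintype.card (Fin k → ZMod (q + 1)) := by exact_mod_cast Fintype.card_pos
  set W : ℝ := (Fintype.card (Fin k → ZMod (q + 1)) : ℝ) with hWdef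
  have key : W * vinoCount k (k + s) A ≤ W * (2 * (p ^ (2 * s - 1) * ∑ a ∈ Finset.range p, (pairCount (D ×ˢ Sa a) Φ 0 : ℝ)) +
      2 * pairCount (G ×ˢ S) Φ 0) := by
    have e : W * (2 * (p ^ (2 * s - 1) * ∑ a ∈ Finset.range p, (pairCount (D ×ˢ Sa a) Φ 0 : ℝ)) +
      2 * pairCount (G ×ˢ S) Φ 0) = ∑ ψ : AddChar (Fin k → ZMod (q + 1)) ℂ,
        (2 * (p ^ (2 * s - 1) * ∑ a ∈ Finset.range p, ‖charSum (D ×ˢ Sa a) Φ ψ‖ ^ 2) + 2 * ‖charSum (G ×ˢ S) Φ ψ‖ ^ 2) := by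
      rw [sum_add_distrib, ← mul_sum, ← mul_sum, ← mul_sum, sum_comm, h2, sum_congr rfl h3, ← mul_sum]
      ring
    rw [e, ← h1]
    refine sum_le_sum fun ψ _ => ?_
    have hf : ∀ (X : Finset (Fin k → ℤ)) (Y : Finset (Fin s → ℤ)), charSum (X ×ˢ Y) Φ ψ =
        charSum X (psumVec k k) ψ * charSum Y (psumVec k s) ψ := fun X Y => charSum_product _ _ _ _ _
    have hsplit : charSum A (powVec k) ψ ^ k = charSum D (psumVec k k) ψ + charSum G (psumVec k k) ψ := by
      have := charSum_piFinset (fun _ : Fin k => A) ψ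
      rw [prod_const, card_univ, Fintype.card_fin] at this
      rw [← this]
      simp only [charSum]
      exact (sum_filter_add_sum_filter_not _ _ _).symm
    have hSs : charSum S (psumVec k s) ψ = charSum A (powVec k) ψ ^ s := by
      rw [hS, charSum_piFinset, prod_const, card_univ, Fintype.card_fin]
    have hSas : ∀ a, charSum (Sa a) (psumVec k s) ψ = charSum (residuePart p A a) (powVec k) ψ ^ s := fun a => by
      simp only [hSa]
      rw [charSum_piFinset, prod_const, card_univ, Fintype.card_fin]
    simp only [hf, hSs, hSas, norm_mul, norm_pow]
    set F := charSum D (psumVec k k) ψ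
    set H := charSum G (psumVec k k) ψ
    set c := charSum A (powVec k) ψ with hc
    have hcs : ‖c‖ ^ (2 * s) ≤ p ^ (2 * s - 1) * ∑ a ∈ Finset.range p, ‖charSum (residuePart p A a) (powVec k) ψ‖ ^ (2 * s) := by
      rw [hc, charSum_residuePart hp.pos]
      have h4 := pow_sum_div_card_le_sum_pow (s := Finset.range p) (f := fun a => ‖charSum (residuePart p A a) (powVec k) ψ‖)
        (fun _ _ => norm_nonneg _) (2 * s - 1)
      rw [card_range, Nat.sub_add_cancel (by omega), div_le_iff₀ (by have := hp.pos; positivity)] at h4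
      refine (pow_le_pow_left₀ (norm_nonneg _) (norm_sum_le _ _) _).trans ?_
      exact h4.trans_eq (mul_comm _ _)
    have hFH : (‖c‖ ^ k) ^ 2 ≤ 2 * ‖F‖ ^ 2 + 2 * ‖H‖ ^ 2 := by
      rw [← norm_pow, hsplit]
      have := norm_add_le F H
      nlinarith [norm_nonneg (F + H), sq_nonneg (‖F‖ - ‖H‖)]
    calc (‖c‖ ^ 2) ^ (k + s) = (‖c‖ ^ k) ^ 2 * ‖c‖ ^ (2 * s) := by ring
      _ ≤ (2 * ‖F‖ ^ 2 + 2 * ‖H‖ ^ 2) * ‖c‖ ^ (2 * s) := by gcongr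
      _ = 2 * ‖F‖ ^ 2 * ‖c‖ ^ (2 * s) + 2 * (‖H‖ * ‖c‖ ^ s) ^ 2 := by ring
      _ ≤ 2 * ‖F‖ ^ 2 * (p ^ (2 * s - 1) * ∑ a ∈ Finset.range p, ‖charSum (residuePart p A a) (powVec k) ψ‖ ^ (2 * s)) +
          2 * (‖H‖ * ‖c‖ ^ s) ^ 2 := by gcongr
      _ = _ := by
        have : ∑ a ∈ Finset.range p, (‖F‖ * ‖charSum (residuePart p A a) (powVec k) ψ‖ ^ s) ^ 2 =
            ‖F‖ ^ 2 * ∑ a ∈ Finset.range p, ‖charSum (residuePart p A a) (powVec k) ψ‖ ^ (2 * s) := by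
          rw [mul_sum]
          refine sum_congr rfl fun a _ => ?_
          ring
        rw [this]
        ring
  have key2 := le_of_mul_le_mul_left key hW
  have hsum : ∑ a ∈ Finset.range p, (pairCount (D ×ˢ Sa a) Φ 0 : ℝ) ≤ p * (P ^ k * (k ^ k * ∏ j ∈ Icc 1 k, (p : ℝ) ^ (k - j)) *
        vinoCount k s (Ico 0 ((P / p + 1 : ℕ) : ℤ))) := by
    calc _ ≤ ∑ a ∈ Finset.range p, (P ^ k * (k ^ k * ∏ j ∈ Icc 1 k, (p : ℝ) ^ (k - j)) *
        vinoCount k s (Ico 0 ((P / p + 1 : ℕ) : ℤ)) : ℝ) := sum_le_sum fun a _ => by exact_mod_cast hDle a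
      _ = _ := by rw [sum_const, card_range, nsmul_eq_mul]
  have hpp : (p : ℝ) ^ (2 * s) = p ^ (2 * s - 1) * p := by rw [← pow_succ, Nat.sub_add_cancel (by omega)]
  rw [hpp]
  have : (p : ℝ) ^ (2 * s - 1) * ∑ a ∈ Finset.range p, (pairCount (D ×ˢ Sa a) Φ 0 : ℝ) ≤ p ^ (2 * s - 1) *
    (p * (P ^ k * (k ^ k * ∏ j ∈ Icc 1 k, (p : ℝ) ^ (k - j)) *
        vinoCount k s (Ico 0 ((P / p + 1 : ℕ) : ℤ)))) := by gcongr
  linarith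

theorem vinoCount_trivial (k n P : ℕ) : vinoCount k n (Ico 0 (P : ℤ)) ≤ P ^ (2 * n) := by
  rw [vinoCount, pairCount]
  refine (card_filter_le _ _).trans ?_
  rw [card_product, Fintype.card_piFinset]
  simp [two_mul, pow_add]

theorem exists_prime_root {k P X0 : ℕ} (hk : 2 ≤ k) (hX0 : 4 ≤ X0) (hP : X0 ^ k < P) :
    ∃ p : ℕ, p.Prime ∧ X0 < p ∧ p ≤ P ∧ P ≤ p ^ k ∧ (p : ℝ) ≤ 4 * (P : ℝ) ^ ((1 : ℝ) / k) := by
  classical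
  have hex : ∃ R : ℕ, P ≤ R ^ k := ⟨P, Nat.le_self_pow (by omega) P⟩
  set R := Nat.find hex with hR
  have h1 : P ≤ R ^ k := Nat.find_spec hex
  have hXR : X0 < R := by
    by_contra! h
    exact absurd (h1.trans (Nat.pow_le_pow_left h k)) (by omega)
  have h2 : (R - 1) ^ k < P := by
    have := Nat.find_min hex (m := R - 1) (by omega)
    omega
  obtain ⟨p, hp, hp1, hp2⟩ := Nat.exists_prime_lt_and_le_two_mul R (by omega)
  have h5 : 4 * (R - 1) ≤ (R - 1) ^ k := (Nat.mul_le_mul_right _ (by omega : 4 ≤ R - 1)).trans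
    ((sq (R - 1)).symm.le.trans (Nat.pow_le_pow_right (by omega) hk))
  refine ⟨p, hp, by omega, by omega, h1.trans (Nat.pow_le_pow_left hp1.le k), ?_⟩
  have h3 : ((R - 1 : ℕ) : ℝ) ≤ (P : ℝ) ^ ((1 : ℝ) / k) := by
    rw [one_div, Real.le_rpow_inv_iff_of_pos (by positivity) (by positivity) (by exact_mod_cast (show 0 < k by omega)), Real.rpow_natCast]
    exact_mod_cast h2.le
  have h4 : (p : ℝ) ≤ 4 * ((R - 1 : ℕ) : ℝ) := by
    exact_mod_cast (show p ≤ 4 * (R - 1) by omega)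
  linarith

theorem prod_pow_sub_eq (k : ℕ) (p : ℝ) : ∏ j ∈ Icc 1 k, p ^ (k - j) = p ^ (k * (k - 1) / 2) := by
  rw [prod_pow_eq_pow_sum]
  congr 1
  rw [← sum_range_id_mul_two_aux k]
where
  sum_range_id_mul_two_aux (k : ℕ) : ∑ j ∈ Icc 1 k, (k - j) = k * (k - 1) / 2 := by
    rw [← sum_range_id, ← sum_range_reflect, ← sum_Ioc_add_eq_sum_Icc_aux k]
  sum_Ioc_add_eq_sum_Icc_aux (k : ℕ) : ∑ j ∈ Icc 1 k, (k - j) = ∑ j ∈ Finset.range k, (k - 1 - j) := by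
    refine (sum_nbij (fun j => j + 1) ?_ ?_ ?_ ?_).symm
    · intro j hj; simp at hj ⊢; omega
    · intro a _ b _ h; simpa using h
    · intro j hj; simp at hj ⊢; exact ⟨j - 1, by omega, by omega⟩
    · intro j hj; simp at hj ⊢; omega

set_option maxHeartbeats 1000000 in
theorem vinoCount_bound_step {k s : ℕ} (hk : 2 ≤ k) (hs : k ^ 2 ≤ s) (hs' : s ≤ 9 * k ^ 2) {K η C : ℝ}
    (hK : K = k * (k + 1) / 2) (hη : 0 ≤ η) (hηK : η ≤ K) (hC : 1 ≤ C)
    (h : ∀ Q : ℕ, 1 ≤ Q → (vinoCount k s (Ico 0 (Q : ℤ)) : ℝ) ≤ C * (Q : ℝ) ^ (2 * s - K + η)) (P : ℕ) (hP : 1 ≤ P) :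
    (vinoCount k (k + s) (Ico 0 (P : ℤ)) : ℝ) ≤
      (k : ℝ) ^ (30 * k ^ 3) * C * (P : ℝ) ^ (2 * (k + s) - K + η * (1 - 1 / k)) := by
  have hk' : (2 : ℝ) ≤ k := by exact_mod_cast hk
  have hk1 : (1 : ℝ) ≤ k := by linarith
  have hsr : (k : ℝ) ^ 2 ≤ s := by exact_mod_cast hs
  have hsr' : (s : ℝ) ≤ 9 * k ^ 2 := by exact_mod_cast hs'
  have hfs : 1 / (k : ℝ) * ((k : ℝ) ^ 2 - η) = k - η / k := by
    have : (k : ℝ) ≠ 0 := by positivity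
    field_simp
  have hinv : 0 ≤ 1 - 1 / (k : ℝ) := by
    rw [sub_nonneg, div_le_one (by linarith)]
    exact hk1
  have hη' : 0 ≤ η * (1 - 1 / k) := mul_nonneg hη hinv
  have hη'K : η * (1 - 1 / k) ≤ K := (mul_le_of_le_one_right hη (by simp)).trans hηK
  have hK0 : 0 ≤ K := hη.trans hηK
  have hkk : 2 * (k : ℝ) ≤ k ^ 2 := by rw [sq]; gcongr
  have hKk : K ≤ (k : ℝ) ^ 2 := by rw [hK]; linarith
  set D : ℝ := (k : ℝ) ^ (30 * k ^ 3) with hD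
  have hD1 : 1 ≤ D := one_le_pow₀ hk1
  set E' : ℝ := 2 * (k + s) - K + η * (1 - 1 / k) with hE'
  have hE'low : 2 * ((k : ℝ) + s) - K ≤ E' := by rw [hE']; linarith
  have hE'0 : 0 ≤ E' := by linarith
  induction P using Nat.strong_induction_on with
  | _ P ih =>
  have hP0 : (0 : ℝ) < P := by exact_mod_cast hP
  have hP1 : (1 : ℝ) ≤ P := by exact_mod_cast hP
  by_cases hsmall : P ≤ (256 * k ^ 4) ^ k
  · calc (vinoCount k (k + s) (Ico 0 (P : ℤ)) : ℝ) ≤ (P : ℝ) ^ (2 * (k + s)) := by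
          exact_mod_cast vinoCount_trivial k (k + s) P
      _ = (P : ℝ) ^ (K - η * (1 - 1 / k)) * (P : ℝ) ^ E' := by
          rw [← Real.rpow_add hP0, ← Real.rpow_natCast]
          congr 1
          rw [hE']; push_cast; ring
      _ ≤ D * C * (P : ℝ) ^ E' := by
          refine mul_le_mul_of_nonneg_right ?_ (by positivity)
          refine le_trans ?_ (le_mul_of_one_le_right (by positivity) hC)
          calc (P : ℝ) ^ (K - η * (1 - 1 / k)) ≤ (P : ℝ) ^ ((k : ℝ) ^ 2) := by
                refine Real.rpow_le_rpow_of_exponent_le hP1 ?_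
                linarith
            _ = (P : ℝ) ^ (k ^ 2) := by
                rw [← Real.rpow_natCast (P : ℝ) (k ^ 2), Nat.cast_pow]
            _ ≤ (((256 * k ^ 4) ^ k : ℕ) : ℝ) ^ (k ^ 2) := by
                refine pow_le_pow_left₀ (by positivity) ?_ _
                exact_mod_cast hsmall
            _ ≤ (((k : ℝ) ^ 12) ^ k) ^ (k ^ 2) := by
                push_cast
                refine pow_le_pow_left₀ (by positivity) (pow_le_pow_left₀ (by positivity) ?_ _) _
                have : (2 : ℝ) ^ 8 ≤ (k : ℝ) ^ 8 := pow_le_pow_left₀ (by norm_num) hk' 8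
                calc (256 : ℝ) * (k : ℝ) ^ 4 ≤ (k : ℝ) ^ 8 * (k : ℝ) ^ 4 := by gcongr; linarith
                  _ = (k : ℝ) ^ 12 := by ring
            _ = (k : ℝ) ^ (12 * k ^ 3) := by rw [← pow_mul, ← pow_mul]; congr 1; ring
            _ ≤ D := pow_le_pow_right₀ hk1 (by gcongr; norm_num)
  · push Not at hsmall
    have hX0 : 4 ≤ 256 * k ^ 4 := by
      have : 1 ≤ k ^ 4 := Nat.one_le_pow _ _ (by omega)
      omega
    obtain ⟨p, hp, hpX, hpP, hPp, hpR⟩ := exists_prime_root hk hX0 hsmall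
    have hkp : k < p := by
      have : k ≤ k ^ 4 := Nat.le_self_pow (by norm_num) k
      omega
    have hp0 : (0 : ℝ) < p := by exact_mod_cast hp.pos
    have hstep := vinoCount_step (s := s) (by omega) ((pow_pos (by omega) 2).trans_le hs) hp hkp P hPp
    set Q := P / p + 1 with hQ
    have hQP : Q < P := by
      have h1 : P / p ≤ P / 4 := Nat.div_le_div_left (by omega) (by norm_num)
      omega
    have hQ2 : (Q : ℝ) ≤ 2 * (P / p) := by
      have h1 : ((P / p : ℕ) : ℝ) ≤ P / p := Nat.cast_div_le
      have h2 : (1 : ℝ) ≤ P / p := by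
        rw [le_div_iff₀ hp0, one_mul]
        exact_mod_cast hpP
      rw [hQ]; push_cast; linarith
    have hIH := ih Q hQP (Nat.succ_pos _)
    have hs1 := h Q (Nat.succ_pos _)
    rw [prod_pow_sub_eq] at hstep
    have hp1 : (1 : ℝ) ≤ p := by exact_mod_cast hp.one_le
    have hp4 : (p : ℝ) ^ (k * (k - 1) / 2) = (p : ℝ) ^ ((k : ℝ) ^ 2 - K) := by
      rw [← Real.rpow_natCast, Nat.cast_div (even_iff_two_dvd.1 (Nat.even_mul_pred_self k)) (by norm_num)]
      push_cast [Nat.cast_sub (show 1 ≤ k by omega)]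
      congr 1
      rw [hK]; ring
    set e : ℝ := 2 * s - K + η with he
    have hKs : K ≤ (k + s) / 2 := by rw [hK]; linarith
    have he0 : 0 ≤ e := by rw [he]; linarith
    have hQe : ∀ f : ℝ, 0 ≤ f → (Q : ℝ) ^ f ≤ 2 ^ f * ((P : ℝ) ^ f * (p : ℝ) ^ (-f)) := by
      intro f hf
      refine (Real.rpow_le_rpow (by positivity) hQ2 hf).trans_eq ?_
      rw [Real.mul_rpow (by norm_num) (by positivity), Real.div_rpow (by positivity) (by positivity),
        Real.rpow_neg hp0.le, div_eq_mul_inv]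
    have hT1 : 4 * (p : ℝ) ^ (2 * s) * (P ^ k * (k ^ k * (p : ℝ) ^ (k * (k - 1) / 2))) *
        vinoCount k s (Ico 0 (Q : ℤ)) ≤ D / 2 * C * (P : ℝ) ^ E' := by
      have hpk : (p : ℝ) ^ ((k : ℝ) ^ 2 - η) ≤ 4 ^ (k ^ 2) * (P : ℝ) ^ (k - η / k) := by
        have h0 : 0 ≤ (k : ℝ) ^ 2 - η := by linarith
        refine (Real.rpow_le_rpow hp0.le hpR h0).trans ?_
        rw [Real.mul_rpow (by norm_num) (by positivity), ← Real.rpow_mul hP0.le]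
        refine mul_le_mul ?_ (le_of_eq ?_) (by positivity) (by positivity)
        · rw [← Real.rpow_natCast (4 : ℝ) (k ^ 2)]
          refine Real.rpow_le_rpow_of_exponent_le (x := (4 : ℝ)) (by norm_num) ?_
          push_cast
          linarith
        · rw [hfs]
      have hD2 : 4 * (k : ℝ) ^ k * 4 ^ s * 4 ^ (k ^ 2) ≤ D / 2 := by
        have : (2 : ℝ) ^ (3 + 2 * s + 2 * k ^ 2) ≤ k ^ (3 + 2 * s + 2 * k ^ 2) := pow_le_pow_left₀ (by norm_num) hk' _
        have h3 : (k : ℝ) ^ (k + (3 + 2 * s + 2 * k ^ 2)) ≤ D := by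
          refine pow_le_pow_right₀ hk1 ?_
          have e1 : 2 * k ^ 2 ≤ k ^ 3 := by rw [pow_succ' k 2]; gcongr
          have e2 : 2 * k ≤ k ^ 2 := by rw [sq]; gcongr
          linarith
        rw [le_div_iff₀ (by norm_num)]
        refine le_trans ?_ h3
        calc _ = (k : ℝ) ^ k * 2 ^ (3 + 2 * s + 2 * k ^ 2) := by
              rw [pow_add, pow_add, pow_mul, pow_mul]; norm_num; ring
          _ ≤ _ := by rw [pow_add _ k]; gcongr
      calc _ ≤ 4 * (p : ℝ) ^ (2 * s) * (P ^ k * (k ^ k * (p : ℝ) ^ (k * (k - 1) / 2))) *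
            (C * (2 ^ e * ((P : ℝ) ^ e * (p : ℝ) ^ (-e)))) := by
            gcongr
            exact hs1.trans (by gcongr; exact hQe e he0)
        _ = 4 * (k : ℝ) ^ k * 2 ^ e * C * ((P : ℝ) ^ k * (P : ℝ) ^ e) *
            ((p : ℝ) ^ (2 * s) * (p : ℝ) ^ (k * (k - 1) / 2) * (p : ℝ) ^ (-e)) := by ring
        _ = 4 * (k : ℝ) ^ k * 2 ^ e * C * ((P : ℝ) ^ k * (P : ℝ) ^ e) * (p : ℝ) ^ ((k : ℝ) ^ 2 - η) := by
            rw [hp4, ← Real.rpow_natCast (p : ℝ), ← Real.rpow_add hp0, ← Real.rpow_add hp0]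
            congr 2
            rw [he]; push_cast; ring
        _ ≤ 4 * (k : ℝ) ^ k * 4 ^ s * C * ((P : ℝ) ^ k * (P : ℝ) ^ e) * (4 ^ (k ^ 2) * (P : ℝ) ^ (k - η / k)) := by
            gcongr
            calc (2 : ℝ) ^ e ≤ (2 : ℝ) ^ (2 * (s : ℝ)) :=
                  Real.rpow_le_rpow_of_exponent_le (by norm_num) (by rw [he]; linarith)
              _ = 4 ^ s := by rw [Real.rpow_mul (by norm_num), Real.rpow_natCast]; norm_num
        _ = (4 * (k : ℝ) ^ k * 4 ^ s * 4 ^ (k ^ 2)) * C * (P : ℝ) ^ E' := by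
            have : (P : ℝ) ^ E' = (P : ℝ) ^ k * (P : ℝ) ^ e * (P : ℝ) ^ (k - η / k) := by
              rw [← Real.rpow_natCast, ← Real.rpow_add hP0, ← Real.rpow_add hP0]
              congr 1
              rw [he, hE']; ring
            rw [this]; ring
        _ ≤ _ := by gcongr
    have hT2 : (2 * (k : ℝ) ^ 2 * p) ^ (k + s) * vinoCount k (k + s) (Ico 0 (Q : ℤ)) ≤ D / 2 * C * (P : ℝ) ^ E' := by
      have hpE : (p : ℝ) ^ (-E') ≤ (p : ℝ) ^ (-(k + s : ℕ) : ℝ) * ((p : ℝ) ^ (-(1 / 2) : ℝ)) ^ (k + s) := by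
        rw [← Real.rpow_natCast, ← Real.rpow_mul hp0.le, ← Real.rpow_add hp0]
        refine Real.rpow_le_rpow_of_exponent_le hp1 ?_
        push_cast
        linarith
      have h2E : (2 : ℝ) ^ E' ≤ 4 ^ (k + s) := by
        calc (2 : ℝ) ^ E' ≤ (2 : ℝ) ^ (2 * ((k + s : ℕ) : ℝ)) :=
              Real.rpow_le_rpow_of_exponent_le (by norm_num) (by rw [hE']; push_cast; linarith)
          _ = 4 ^ (k + s) := by rw [Real.rpow_mul (by norm_num), Real.rpow_natCast]; norm_num
      have hsq : (p : ℝ) ^ (-(1 / 2) : ℝ) * (8 * k ^ 2) ≤ 1 / 2 := by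
        have h16 : (16 * (k : ℝ) ^ 2) ≤ (p : ℝ) ^ (1 / 2 : ℝ) := by
          rw [← Real.sqrt_eq_rpow]
          refine Real.le_sqrt_of_sq_le ?_
          have : ((256 * k ^ 4 : ℕ) : ℝ) ≤ p := by exact_mod_cast hpX.le
          push_cast at this
          linarith
        rw [Real.rpow_neg hp0.le, inv_mul_le_iff₀ (by positivity)]
        linarith
      have hpp : (p : ℝ) ^ (k + s) * (p : ℝ) ^ (-(k + s : ℕ) : ℝ) = 1 := by
        rw [Real.rpow_neg hp0.le, Real.rpow_natCast]
        exact mul_inv_cancel₀ (by positivity)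
      calc _ ≤ (2 * (k : ℝ) ^ 2 * p) ^ (k + s) * (D * C * (4 ^ (k + s) * ((P : ℝ) ^ E' *
            ((p : ℝ) ^ (-(k + s : ℕ) : ℝ) * ((p : ℝ) ^ (-(1 / 2) : ℝ)) ^ (k + s))))) := by
            gcongr
            refine hIH.trans ?_
            gcongr
            refine (hQe E' hE'0).trans ?_
            gcongr
        _ = ((p : ℝ) ^ (k + s) * (p : ℝ) ^ (-(k + s : ℕ) : ℝ)) * (D * C * (P : ℝ) ^ E' *
              ((p : ℝ) ^ (-(1 / 2) : ℝ) * (8 * k ^ 2)) ^ (k + s)) := by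
            rw [mul_pow, mul_pow _ (8 * (k : ℝ) ^ 2), show (8 : ℝ) * k ^ 2 = (2 * k ^ 2) * 4 by ring, mul_pow (2 * (k : ℝ) ^ 2) 4]
            ring
        _ = D * C * (P : ℝ) ^ E' * ((p : ℝ) ^ (-(1 / 2) : ℝ) * (8 * k ^ 2)) ^ (k + s) := by rw [hpp, one_mul]
        _ ≤ D * C * (P : ℝ) ^ E' * (1 / 2) := by
            gcongr
            calc _ ≤ (1 / 2 : ℝ) ^ (k + s) := pow_le_pow_left₀ (by positivity) hsq _
              _ ≤ (1 / 2) ^ 1 := pow_le_pow_of_le_one (by norm_num) (by norm_num) (by omega)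
              _ = _ := pow_one _
        _ = _ := by ring
    linarith

/-- Vinogradov's mean value theorem. -/
theorem vinogradov_mean_value {k : ℕ} (hk : 2 ≤ k) (P : ℕ) (hP : 1 ≤ P) :
    (vinoCount k (9 * k ^ 2) (Ico 0 (P : ℤ)) : ℝ) ≤
      (k : ℝ) ^ (240 * k ^ 4) * (P : ℝ) ^ (18 * (k : ℝ) ^ 2 - k * (k + 1) / 2 + k ^ 2 / 1000) := by
  have hk' : (2 : ℝ) ≤ k := by exact_mod_cast hk
  have hk1 : (1 : ℝ) ≤ k := by linarith
  have hinv : 0 ≤ 1 - 1 / (k : ℝ) := by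
    rw [sub_nonneg, div_le_one (by linarith)]
    exact hk1
  set K : ℝ := k * (k + 1) / 2 with hK
  have hK0 : 0 ≤ K := by positivity
  have main : ∀ r : ℕ, r ≤ 8 * k → ∀ Q : ℕ, 1 ≤ Q → (vinoCount k (k ^ 2 + r * k) (Ico 0 (Q : ℤ)) : ℝ) ≤
      (k : ℝ) ^ (30 * k ^ 3 * r) * (Q : ℝ) ^ (2 * ((k ^ 2 + r * k : ℕ) : ℝ) - K + (1 - 1 / (k : ℝ)) ^ r * K) := by
    intro r
    induction r with
    | zero =>
      intro _ Q _
      have := vinoCount_trivial k (k ^ 2 + 0 * k) Q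
      simp only [mul_zero, pow_zero, one_mul, sub_add_cancel]
      calc (vinoCount k (k ^ 2 + 0 * k) (Ico 0 (Q : ℤ)) : ℝ) ≤ (Q : ℝ) ^ (2 * (k ^ 2 + 0 * k)) := by exact_mod_cast this
        _ = _ := by rw [← Real.rpow_natCast]; congr 1; push_cast; ring
    | succ r ih =>
      intro hr Q hQ
      have h1 := vinoCount_bound_step (s := k ^ 2 + r * k) hk (by omega) (by nlinarith) hK
        (by positivity : 0 ≤ (1 - 1 / (k : ℝ)) ^ r * K)
        (mul_le_of_le_one_left hK0 (pow_le_one₀ hinv (by simp))) (one_le_pow₀ hk1 : 1 ≤ (k : ℝ) ^ (30 * k ^ 3 * r))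
        (fun Q hQ => ih (by omega) Q hQ) Q hQ
      rw [show k ^ 2 + (r + 1) * k = k + (k ^ 2 + r * k) by ring]
      refine h1.trans_eq ?_
      rw [← pow_add]
      congr 2
      · ring
      · push_cast; ring
  have h := main (8 * k) le_rfl P hP
  rw [show k ^ 2 + 8 * k * k = 9 * k ^ 2 by ring, show 30 * k ^ 3 * (8 * k) = 240 * k ^ 4 by ring] at h
  refine h.trans ?_
  refine mul_le_mul_of_nonneg_left (Real.rpow_le_rpow_of_exponent_le (by exact_mod_cast hP) ?_) (by positivity)
  refine add_le_add (by push_cast; linarith) ?_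
  · have h1 : (1 - 1 / (k : ℝ)) ^ (8 * k) ≤ Real.exp (-8) := by
      have : 1 - 1 / (k : ℝ) ≤ Real.exp (-(1 / k)) := by
        have := Real.add_one_le_exp (-(1 / (k : ℝ)))
        linarith
      refine (pow_le_pow_left₀ hinv this _).trans_eq ?_
      rw [← Real.exp_nat_mul]
      congr 1
      push_cast
      field_simp
    have h2 : Real.exp (-8) ≤ 1 / 1000 := by
      rw [Real.exp_neg, ← one_div]
      refine one_div_le_one_div_of_le (by norm_num) ?_
      have := Real.exp_one_gt_d9
      calc (1000 : ℝ) ≤ 2.7182818283 ^ 8 := by norm_num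
        _ ≤ Real.exp 1 ^ 8 := by gcongr
        _ = Real.exp 8 := by rw [← Real.exp_nat_mul]; norm_num
    calc (1 - 1 / (k : ℝ)) ^ (8 * k) * K ≤ 1 / 1000 * K := mul_le_mul_of_nonneg_right (h1.trans h2) hK0
      _ ≤ _ := by rw [hK]; nlinarith

/-- `e(x) = exp(2πix)`. -/
noncomputable def ec (x : ℝ) : ℂ := Complex.exp ((2 * Real.pi * x : ℝ) * Complex.I)

theorem ec_add (x y : ℝ) : ec (x + y) = ec x * ec y := by
  rw [ec, ec, ec, ← Complex.exp_add]
  congr 1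
  push_cast
  ring

theorem norm_ec (x : ℝ) : ‖ec x‖ = 1 := Complex.norm_exp_ofReal_mul_I _

theorem ec_zero : ec 0 = 1 := by simp [ec]

theorem ec_sum {ι : Type*} (s : Finset ι) (f : ι → ℝ) : ec (∑ i ∈ s, f i) = ∏ i ∈ s, ec (f i) := by
  classical
  induction s using Finset.induction_on with
  | empty => simp [ec_zero]
  | insert a s ha ih => rw [sum_insert ha, prod_insert ha, ec_add, ih]

theorem ec_neg (x : ℝ) : ec (-x) = (starRingEnd ℂ) (ec x) := by
  rw [ec, ec, ← Complex.exp_conj, map_mul, Complex.conj_I, Complex.conj_ofReal]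
  congr 1
  push_cast
  ring

/-- The character `v ↦ e(θ · v)` of `ℤᵏ`. -/
noncomputable def ecv {k : ℕ} (θ : Fin k → ℝ) (v : Fin k → ℤ) : ℂ := ec (∑ j, θ j * v j)

section
variable {k : ℕ}

theorem ecv_add (θ : Fin k → ℝ) (u v : Fin k → ℤ) : ecv θ (u + v) = ecv θ u * ecv θ v := by
  rw [ecv, ecv, ecv, ← ec_add, ← sum_add_distrib]
  congr 1
  refine sum_congr rfl fun j _ => ?_
  simp
  ring

theorem ecv_sum {ι : Type*} (s : Finset ι) (θ : Fin k → ℝ) (u : ι → Fin k → ℤ) :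
    ecv θ (∑ i ∈ s, u i) = ∏ i ∈ s, ecv θ (u i) := by
  classical
  induction s using Finset.induction_on with
  | empty => simp [ecv, ec_zero]
  | insert a s ha ih => rw [sum_insert ha, prod_insert ha, ecv_add, ih]

theorem norm_ecv (θ : Fin k → ℝ) (v : Fin k → ℤ) : ‖ecv θ v‖ = 1 := norm_ec _

/-- Expansion of an even moment of a Weyl sum. -/
theorem norm_pow_eq_sum_pairCount (s : ℕ) (A : Finset ℤ) (V : Finset (Fin k → ℤ))
    (hV : ∀ x ∈ Fintype.piFinset (fun _ : Fin s => A), ∀ y ∈ Fintype.piFinset (fun _ : Fin s => A),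
      psumVec k s x - psumVec k s y ∈ V) (θ : Fin k → ℝ) :
    (((‖∑ x ∈ A, ecv θ (powVec k x)‖ ^ 2) ^ s : ℝ) : ℂ) =
      ∑ v ∈ V, (pairCount (Fintype.piFinset fun _ : Fin s => A) (psumVec k s) v : ℂ) * ecv θ v := by
  classical
  set B := Fintype.piFinset (fun _ : Fin s => A) with hB
  have h1 : (∑ x ∈ A, ecv θ (powVec k x)) ^ s = ∑ x ∈ B, ecv θ (psumVec k s x) := by
    have := prod_univ_sum (fun _ : Fin s => A) (fun _ x => ecv θ (powVec k x))
    rw [prod_const, card_univ, Fintype.card_fin] at this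
    rw [this]
    exact sum_congr rfl fun x _ => (ecv_sum _ _ _).symm
  have h2 : (((‖∑ x ∈ A, ecv θ (powVec k x)‖ ^ 2) ^ s : ℝ) : ℂ) =
      ∑ b ∈ B ×ˢ B, ecv θ (psumVec k s b.1 - psumVec k s b.2) := by
    rw [← pow_mul, mul_comm, pow_mul, ← norm_pow, h1, Complex.ofReal_pow, ← Complex.mul_conj', map_sum, sum_mul_sum, sum_product]
    refine sum_congr rfl fun x _ => sum_congr rfl fun y _ => ?_
    rw [sub_eq_add_neg, ecv_add]
    congr 1
    rw [ecv, ecv, ← ec_neg, ← sum_neg_distrib]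
    congr 1
    refine sum_congr rfl fun j _ => ?_
    simp
  rw [h2, ← sum_fiberwise_of_maps_to (t := V) (g := fun b => psumVec k s b.1 - psumVec k s b.2)
    (fun b hb => hV _ (mem_product.1 hb).1 _ (mem_product.1 hb).2)]
  refine sum_congr rfl fun v _ => ?_
  rw [pairCount, ← nsmul_eq_mul, ← sum_const]
  have : {b ∈ B ×ˢ B | psumVec k s b.1 = psumVec k s b.2 + v} = {b ∈ B ×ˢ B | psumVec k s b.1 - psumVec k s b.2 = v} := by
    refine filter_congr fun b _ => ?_
    rw [sub_eq_iff_eq_add, add_comm]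
  rw [this]
  refine sum_congr rfl fun b hb => ?_
  rw [(mem_filter.1 hb).2]

theorem psumVec_sub_mem (s X : ℕ) (x : Fin s → ℤ) (hx : x ∈ Fintype.piFinset (fun _ : Fin s => Icc (1 : ℤ) X)) (y : Fin s → ℤ)
    (hy : y ∈ Fintype.piFinset (fun _ : Fin s => Icc (1 : ℤ) X)) :
    psumVec k s x - psumVec k s y ∈ Fintype.piFinset
      (fun j : Fin k => Icc (-((s * X ^ (j.val + 1) : ℕ) : ℤ)) ((s * X ^ (j.val + 1) : ℕ) : ℤ)) := by
  have h : ∀ z ∈ Fintype.piFinset (fun _ : Fin s => Icc (1 : ℤ) X), ∀ j : Fin k, 0 ≤ psumVec k s z j ∧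
      psumVec k s z j ≤ ((s * X ^ (j.val + 1) : ℕ) : ℤ) := by
    intro z hz j
    rw [Fintype.mem_piFinset] at hz
    rw [psumVec_apply]
    constructor
    · exact sum_nonneg fun i _ => pow_nonneg (by have := mem_Icc.1 (hz i); omega) _
    · calc _ ≤ ∑ i : Fin s, (X : ℤ) ^ (j.val + 1) := by
            refine sum_le_sum fun i _ => ?_
            have := mem_Icc.1 (hz i)
            exact pow_le_pow_left₀ (by omega) this.2 _
        _ = _ := by simp
  rw [Fintype.mem_piFinset]
  intro j
  have h1 := h x hx j
  have h2 := h y hy j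
  rw [mem_Icc, Pi.sub_apply]
  omega

/-- Vinogradov's bilinear estimate. -/
theorem norm_bilinear_pow_le (s X : ℕ) (hs : 0 < s) (hX : 0 < X) (β : Fin k → ℝ) :
    ‖∑ x ∈ Icc (1 : ℤ) X, ∑ y ∈ Icc (1 : ℤ) X, ecv (fun j => β j * (x : ℝ) ^ (j.val + 1)) (powVec k y)‖ ^ (2 * s * (2 * s)) ≤
      ((X : ℝ) ^ (2 * s * (2 * s - 1))) ^ 2 * (vinoCount k s (Icc (1 : ℤ) X) : ℝ) ^ 2 *
      ∏ j : Fin k, ∑ w ∈ Icc (-((s * X ^ (j.val + 1) : ℕ) : ℤ)) ((s * X ^ (j.val + 1) : ℕ) : ℤ),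
        ‖∑ v ∈ Icc (-((s * X ^ (j.val + 1) : ℕ) : ℤ)) ((s * X ^ (j.val + 1) : ℕ) : ℤ), ec (β j * w * v)‖ := by
  classical
  set A := Icc (1 : ℤ) X with hA
  have hAc : #A = X := by simp [hA]
  set I : Fin k → Finset ℤ := fun j => Icc (-((s * X ^ (j.val + 1) : ℕ) : ℤ)) ((s * X ^ (j.val + 1) : ℕ) : ℤ) with hI
  set V := Fintype.piFinset I with hV
  have hmem := psumVec_sub_mem (k := k) s X
  set J : (Fin k → ℤ) → ℕ := fun v => pairCount (Fintype.piFinset fun _ : Fin s => A) (psumVec k s) v with hJ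
  have hJ0 : ∀ v, (J v : ℝ) ≤ vinoCount k s A := fun v => by exact_mod_cast pairCount_le _ _ v
  set f : (Fin k → ℝ) → ℂ := fun θ => ∑ y ∈ A, ecv θ (powVec k y) with hf
  have hexp : ∀ θ, ((‖f θ‖ ^ (2 * s) : ℝ) : ℂ) = ∑ v ∈ V, (J v : ℂ) * ecv θ v := fun θ => by
    rw [pow_mul]
    exact norm_pow_eq_sum_pairCount s A V hmem θ
  have hJsum : ∑ v ∈ V, (J v : ℝ) = (X : ℝ) ^ (2 * s) := by
    have := hexp 0
    simp only [hf, ecv, Pi.zero_apply, zero_mul, sum_const_zero, ec_zero, sum_const, hAc, mul_one, nsmul_eq_mul,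
      Complex.norm_natCast] at this
    exact_mod_cast this.symm
  have hXr : (0 : ℝ) < X := by exact_mod_cast hX
  set W := ∑ x ∈ A, f (fun j => β j * (x : ℝ) ^ (j.val + 1)) with hW
  -- first application of Hölder's inequality
  have h1 : ‖W‖ ^ (2 * s) ≤ (X : ℝ) ^ (2 * s - 1) * ∑ v ∈ V, (J v : ℝ) * ‖f (fun j => β j * v j)‖ := by
    have h2 := pow_sum_div_card_le_sum_pow (s := A) (f := fun x => ‖f (fun j => β j * (x : ℝ) ^ (j.val + 1))‖)
        (fun _ _ => norm_nonneg _) (2 * s - 1)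
    rw [hAc, Nat.sub_add_cancel (by omega), div_le_iff₀ (by positivity), mul_comm (∑ i ∈ A, _)] at h2
    refine (pow_le_pow_left₀ (norm_nonneg _) (norm_sum_le _ _) _).trans (h2.trans ?_)
    refine mul_le_mul_of_nonneg_left ?_ (by positivity)
    have h3 : ((∑ x ∈ A, ‖f (fun j => β j * (x : ℝ) ^ (j.val + 1))‖ ^ (2 * s) : ℝ) : ℂ) =
        ∑ v ∈ V, (J v : ℂ) * f (fun j => β j * v j) := by
      rw [Complex.ofReal_sum, sum_congr rfl fun x _ => hexp _, sum_comm]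
      refine sum_congr rfl fun v _ => ?_
      rw [← mul_sum]
      congr 1
      refine sum_congr rfl fun x _ => ?_
      simp only [ecv, powVec]
      congr 1
      refine sum_congr rfl fun j _ => ?_
      push_cast
      ring
    have h4 := congrArg norm h3
    rw [Complex.norm_real, Real.norm_of_nonneg (sum_nonneg fun _ _ => by positivity)] at h4
    rw [h4]
    refine (norm_sum_le _ _).trans_eq (sum_congr rfl fun v _ => ?_)
    rw [norm_mul, Complex.norm_natCast]
  -- second application of Hölder's inequality
  have h5 : (∑ v ∈ V, (J v : ℝ) * ‖f (fun j => β j * v j)‖) ^ (2 * s) ≤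
      ((X : ℝ) ^ (2 * s)) ^ (2 * s - 1) * ∑ v ∈ V, (J v : ℝ) * ‖f (fun j => β j * v j)‖ ^ (2 * s) := by
    set R := (X : ℝ) ^ (2 * s) with hR
    have hR0 : 0 < R := by positivity
    have h6 := Real.pow_arith_mean_le_arith_mean_pow V (fun v => (J v : ℝ) / R) (fun v => ‖f (fun j => β j * v j)‖)
      (fun _ _ => by positivity) (by rw [← sum_div, hJsum, div_self hR0.ne']) (fun _ _ => norm_nonneg _) (2 * s)
    simp only [div_mul_eq_mul_div] at h6
    rw [← sum_div, ← sum_div, div_pow, div_le_div_iff₀ (by positivity) hR0] at h6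
    refine le_of_mul_le_mul_right (h6.trans_eq ?_) hR0
    rw [show R ^ (2 * s) = R ^ (2 * s - 1) * R by rw [← pow_succ, Nat.sub_add_cancel (by omega)]]
    ring
  have h7 : ∑ v ∈ V, (J v : ℝ) * ‖f (fun j => β j * v j)‖ ^ (2 * s) ≤
      (vinoCount k s A : ℝ) * ((vinoCount k s A : ℝ) * ∏ j : Fin k, ∑ w ∈ I j, ‖∑ v ∈ I j, ec (β j * w * v)‖) := by
    calc _ ≤ ∑ v ∈ V, (vinoCount k s A : ℝ) * ‖f (fun j => β j * v j)‖ ^ (2 * s) := by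
          refine sum_le_sum fun v _ => mul_le_mul_of_nonneg_right (hJ0 v) (by positivity)
      _ = (vinoCount k s A : ℝ) * ∑ v ∈ V, ‖f (fun j => β j * v j)‖ ^ (2 * s) := by rw [mul_sum]
      _ ≤ _ := by
          refine mul_le_mul_of_nonneg_left ?_ (by positivity)
          have h8 : ((∑ v ∈ V, ‖f (fun j => β j * v j)‖ ^ (2 * s) : ℝ) : ℂ) =
              ∑ w ∈ V, (J w : ℂ) * ∏ j, ∑ v ∈ I j, ec (β j * w j * v) := by
            rw [Complex.ofReal_sum, sum_congr rfl fun x _ => hexp _, sum_comm]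
            refine sum_congr rfl fun w _ => ?_
            rw [← mul_sum, prod_univ_sum]
            congr 1
            refine sum_congr rfl fun v _ => ?_
            rw [ecv, ec_sum]
            refine prod_congr rfl fun j _ => ?_
            congr 1
            ring
          have h9 := congrArg norm h8
          rw [Complex.norm_real, Real.norm_of_nonneg (sum_nonneg fun _ _ => by positivity)] at h9
          rw [h9]
          refine (norm_sum_le _ _).trans ?_
          rw [prod_univ_sum, mul_sum]
          refine sum_le_sum fun w _ => ?_
          rw [norm_mul, Complex.norm_natCast, norm_prod]
          exact mul_le_mul_of_nonneg_right (hJ0 w) (prod_nonneg fun _ _ => norm_nonneg _)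
  calc ‖W‖ ^ (2 * s * (2 * s)) = (‖W‖ ^ (2 * s)) ^ (2 * s) := pow_mul _ _ _
    _ ≤ ((X : ℝ) ^ (2 * s - 1) * ∑ v ∈ V, (J v : ℝ) * ‖f (fun j => β j * v j)‖) ^ (2 * s) := by gcongr
    _ = ((X : ℝ) ^ (2 * s - 1)) ^ (2 * s) * (∑ v ∈ V, (J v : ℝ) * ‖f (fun j => β j * v j)‖) ^ (2 * s) := mul_pow _ _ _
    _ ≤ ((X : ℝ) ^ (2 * s - 1)) ^ (2 * s) * (((X : ℝ) ^ (2 * s)) ^ (2 * s - 1) *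
        ((vinoCount k s A : ℝ) * ((vinoCount k s A : ℝ) * ∏ j : Fin k, ∑ w ∈ I j, ‖∑ v ∈ I j, ec (β j * w * v)‖))) := by
        gcongr
        exact h5.trans (by gcongr)
    _ = _ := by
        rw [← pow_mul, ← pow_mul, mul_comm (2 * s - 1)]
        ring

end

theorem sum_Icc_neg_eq {M : Type*} [AddCommMonoid M] (f : ℤ → M) (Y : ℕ) :
    ∑ v ∈ Icc (-(Y : ℤ)) Y, f v = f 0 + ∑ n ∈ Finset.range Y, (f (n + 1) + f (-(n + 1))) := by
  induction Y with
  | zero => simp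
  | succ Y ih =>
    have : Icc (-((Y + 1 : ℕ) : ℤ)) ((Y + 1 : ℕ) : ℤ) =
        insert ((Y : ℤ) + 1) (insert (-((Y : ℤ) + 1)) (Icc (-(Y : ℤ)) Y)) := by
      ext x
      simp only [mem_insert, mem_Icc]
      omega
    rw [this, sum_insert (by simp only [mem_insert, mem_Icc]; omega), sum_insert (by simp only [mem_Icc]; omega), ih, sum_range_succ,
      ← add_assoc, add_comm]
    simp only [add_assoc]

theorem norm_ec_sub_one_ge {α : ℝ} (hα : |α| ≤ 1 / 2) : 4 * |α| ≤ ‖ec α - 1‖ := by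
  have h := Complex.norm_exp_I_mul_ofReal_sub_one (x := 2 * Real.pi * α)
  rw [mul_comm Complex.I] at h
  rw [ec, h, show 2 * Real.pi * α / 2 = Real.pi * α by ring, norm_mul, Real.norm_eq_abs, Real.norm_eq_abs, abs_of_pos (by norm_num : (0 : ℝ) < 2)]
  have hpi := Real.pi_pos
  have := Real.mul_abs_le_abs_sin (x := Real.pi * α) (by
    rw [abs_mul, abs_of_pos hpi]
    nlinarith)
  rw [abs_mul, abs_of_pos hpi] at this
  have e : 2 / Real.pi * (Real.pi * |α|) = 2 * |α| := by field_simp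
  rw [e] at this
  linarith

theorem norm_geom_le {α : ℝ} (hα0 : α ≠ 0) (hα : |α| ≤ 1 / 2) (Y : ℕ) :
    ‖∑ v ∈ Icc (-(Y : ℤ)) Y, ec (α * v)‖ ≤ 1 / (2 * |α|) := by
  have htel : (ec α - 1) * ∑ v ∈ Icc (-(Y : ℤ)) Y, ec (α * v) = ec (α * (Y + 1)) - ec (-(α * Y)) := by
    induction Y with
    | zero => simp [ec_zero]
    | succ Y ih =>
      rw [sum_Icc_neg_eq] at ih ⊢
      rw [sum_range_succ, ← add_assoc, mul_add, ih]
      push_cast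
      have e1 : ec (α * ((Y : ℝ) + 1 + 1)) = ec α * ec (α * (Y + 1)) := by rw [← ec_add]; ring_nf
      have e2 : ec (-(α * Y)) = ec α * ec (-(α * (Y + 1))) := by rw [← ec_add]; ring_nf
      have e3 : ec (α * (-1 + -(Y : ℝ))) = ec (-(α * (Y + 1))) := by ring_nf
      rw [e1, e2]
      simp only [mul_neg]
      ring
  have hpos : 0 < |α| := abs_pos.2 hα0
  have h1 := norm_ec_sub_one_ge hα
  have h2 : ‖(ec α - 1) * ∑ v ∈ Icc (-(Y : ℤ)) Y, ec (α * v)‖ ≤ 2 := by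
    rw [htel]
    refine (norm_sub_le _ _).trans ?_
    rw [norm_ec, norm_ec]
    norm_num
  rw [norm_mul] at h2
  rw [le_div_iff₀ (by positivity)]
  nlinarith [norm_nonneg (∑ v ∈ Icc (-(Y : ℤ)) Y, ec (α * v))]

theorem sum_norm_ec_trivial (β : ℝ) (Y : ℕ) :
    ∑ w ∈ Icc (-(Y : ℤ)) Y, ‖∑ v ∈ Icc (-(Y : ℤ)) Y, ec (β * w * v)‖ ≤ (2 * Y + 1 : ℝ) ^ 2 := by
  have hc : #(Icc (-(Y : ℤ)) Y) = 2 * Y + 1 := by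
    rw [Int.card_Icc]; omega
  calc _ ≤ ∑ w ∈ Icc (-(Y : ℤ)) Y, (2 * Y + 1 : ℝ) := by
        refine sum_le_sum fun w _ => (norm_sum_le _ _).trans ?_
        simp only [norm_ec, sum_const, hc, nsmul_eq_mul]
        push_cast
        linarith
    _ = _ := by
        rw [sum_const, hc, nsmul_eq_mul]
        push_cast
        ring

theorem sum_norm_ec_le {β : ℝ} (hβ0 : β ≠ 0) {Y : ℕ} (hβ : |β| * Y ≤ 1 / 2) :
    ∑ w ∈ Icc (-(Y : ℤ)) Y, ‖∑ v ∈ Icc (-(Y : ℤ)) Y, ec (β * w * v)‖ ≤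
      (2 * Y + 1 : ℝ) + |β|⁻¹ * (1 + Real.log Y) := by
  have hc : #(Icc (-(Y : ℤ)) Y) = 2 * Y + 1 := by
    rw [Int.card_Icc]; omega
  have hpos : 0 < |β| := abs_pos.2 hβ0
  rw [sum_Icc_neg_eq]
  refine add_le_add ?_ ?_
  · refine (norm_sum_le _ _).trans ?_
    simp only [norm_ec, sum_const, hc, nsmul_eq_mul]
    push_cast
    linarith
  · calc _ ≤ ∑ n ∈ Finset.range Y, |β|⁻¹ * ((n : ℝ) + 1)⁻¹ := by
          refine sum_le_sum fun n hn => ?_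
          have hn' : ((n : ℝ) + 1) ≤ Y := by exact_mod_cast Finset.mem_range.1 hn
          have hn0 : (0 : ℝ) < n + 1 := by positivity
          have hb : |β| * (n + 1) ≤ 1 / 2 := (mul_le_mul_of_nonneg_left hn' hpos.le).trans hβ
          have h1 := norm_geom_le (α := β * (n + 1)) (mul_ne_zero hβ0 hn0.ne') (by rwa [abs_mul, abs_of_pos hn0]) Y
          have h2 := norm_geom_le (α := -(β * (n + 1))) (neg_ne_zero.2 (mul_ne_zero hβ0 hn0.ne'))
            (by rwa [abs_neg, abs_mul, abs_of_pos hn0]) Y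
          rw [abs_neg] at h2
          rw [abs_mul, abs_of_pos hn0] at h1 h2
          push_cast
          have e : β * (-((n : ℝ) + 1)) = -(β * (n + 1)) := by ring
          rw [e]
          refine (add_le_add h1 h2).trans_eq ?_
          field_simp
          norm_num
      _ = |β|⁻¹ * ((harmonic Y : ℚ) : ℝ) := by
          rw [← mul_sum, harmonic]
          push_cast
          rfl
      _ ≤ _ := by
          refine mul_le_mul_of_nonneg_left (harmonic_le_one_add_log Y) (by positivity)

theorem norm_ec_sub_ec_le (a b : ℝ) : ‖ec a - ec b‖ ≤ 2 * Real.pi * |a - b| := by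
  have h : ec a - ec b = ec b * (ec (a - b) - 1) := by
    rw [mul_sub, ← ec_add, mul_one]
    congr 2
    ring
  rw [h, norm_mul, norm_ec, one_mul, ec, mul_comm _ Complex.I]
  refine (Real.norm_exp_I_mul_ofReal_sub_one_le).trans_eq ?_
  rw [Real.norm_eq_abs, abs_mul, abs_of_pos Real.two_pi_pos]

/-- The function `u ↦ u^{-it}`. -/
noncomputable def twist (t u : ℝ) : ℂ := ec (-(t * Real.log u / (2 * Real.pi)))

theorem norm_sum_sub_shift_le {F : ℕ → ℂ} (hF : ∀ n, ‖F n‖ ≤ 1) (N N' h : ℕ) (hN : N ≤ N') :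
    ‖∑ n ∈ Ioc N N', F n - ∑ n ∈ Ioc N N', F (n + h)‖ ≤ 2 * h := by
  have h1 : ∑ n ∈ Ioc N N', F (n + h) = ∑ n ∈ Ioc (N + h) (N' + h), F n := by
    rw [← map_add_right_Ioc, sum_map]
    rfl
  have h2 := sum_Ioc_consecutive F hN (show N' ≤ N' + h by omega)
  have h3 := sum_Ioc_consecutive F (show N ≤ N + h by omega) (show N + h ≤ N' + h by omega)
  have h4 : ∑ n ∈ Ioc N N', F n - ∑ n ∈ Ioc N N', F (n + h) = ∑ n ∈ Ioc N (N + h), F n - ∑ n ∈ Ioc N' (N' + h), F n := by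
    rw [h1]
    linear_combination h2 - h3
  have hb : ∀ M : ℕ, ‖∑ n ∈ Ioc M (M + h), F n‖ ≤ h := fun M => by
    refine (norm_sum_le _ _).trans ((sum_le_sum fun n _ => hF n).trans_eq ?_)
    simp
  rw [h4]
  refine (norm_sub_le _ _).trans ?_
  linarith [hb N, hb N']

/-- The coefficients of the Taylor expansion of the phase. -/
noncomputable def taylorCoeff (k : ℕ) (t : ℝ) (n : ℕ) (j : Fin k) : ℝ :=
  t * (-1) ^ (j.val + 1) / (2 * Real.pi * (j.val + 1) * (n : ℝ) ^ (j.val + 1))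

theorem norm_twist_sub_le {k : ℕ} {t : ℝ} (ht : 0 ≤ t) {n : ℕ} (hn : 0 < n) {x y : ℤ} (hxy : 0 ≤ (x * y : ℝ)) {Z : ℝ} (hZ : (x * y : ℝ) ≤ Z * n)
    (hZ2 : Z ≤ 1 / 2) :
    ‖twist t (n + x * y) - twist t n * ecv (fun j => taylorCoeff k t n j * (x : ℝ) ^ (j.val + 1)) (powVec k y)‖ ≤ 2 * t * Z ^ (k + 1) := by
  have hn' : (0 : ℝ) < n := by exact_mod_cast hn
  set z : ℝ := x * y / n with hz
  have hz0 : 0 ≤ z := by positivity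
  have hzZ : z ≤ Z := by rw [hz, div_le_iff₀ hn']; exact hZ
  have h1 : Real.log (n + x * y) = Real.log n + Real.log (1 + z) := by
    rw [← Real.log_mul hn'.ne' (by positivity)]
    congr 1
    rw [hz]
    field_simp
  have h2 : ∑ j : Fin k, taylorCoeff k t n j * (x : ℝ) ^ (j.val + 1) * ((powVec k y j : ℤ) : ℝ) =
      t / (2 * Real.pi) * ∑ i ∈ Finset.range k, (-z) ^ (i + 1) / (i + 1) := by
    rw [← Fin.sum_univ_eq_sum_range (fun i => (-z) ^ (i + 1) / ((i : ℝ) + 1)), mul_sum]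
    refine sum_congr rfl fun j _ => ?_
    rw [taylorCoeff, powVec, hz, neg_pow (_ / _), div_pow, mul_pow]
    push_cast
    have := Real.pi_pos
    field_simp
  have h3 := Real.abs_log_sub_add_sum_range_le (x := -z) (by rw [abs_neg, abs_of_nonneg hz0]; linarith) k
  rw [abs_neg, abs_of_nonneg hz0, sub_neg_eq_add] at h3
  have h4 : z ^ (k + 1) / (1 - z) ≤ 2 * Z ^ (k + 1) := by
    rw [div_le_iff₀ (by linarith)]
    have h5 : z ^ (k + 1) ≤ Z ^ (k + 1) := pow_le_pow_left₀ hz0 hzZ _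
    nlinarith [pow_nonneg (hz0.trans hzZ) (k + 1)]
  rw [twist, twist, ecv, ← ec_add]
  refine (norm_ec_sub_ec_le _ _).trans ?_
  rw [h1, h2]
  have h5 : -(t * (Real.log n + Real.log (1 + z)) / (2 * Real.pi)) - (-(t * Real.log n / (2 * Real.pi)) +
      t / (2 * Real.pi) * ∑ i ∈ Finset.range k, (-z) ^ (i + 1) / ((i : ℝ) + 1)) =
      -(t / (2 * Real.pi)) * (∑ i ∈ Finset.range k, (-z) ^ (i + 1) / ((i : ℝ) + 1) + Real.log (1 + z)) := by ring
  rw [h5, abs_mul, abs_neg, abs_of_nonneg (by have := Real.pi_pos; positivity : 0 ≤ t / (2 * Real.pi)), ← mul_assoc,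
    mul_div_cancel₀ _ (by have := Real.pi_pos; positivity)]
  calc _ ≤ t * (2 * Z ^ (k + 1)) := by gcongr; exact h3.trans h4
    _ = _ := by ring

theorem norm_sum_twist_le {k : ℕ} {t : ℝ} (ht : 0 ≤ t) {N N' X : ℕ} (hN : 0 < N) (hNN' : N ≤ N') (hN2 : N' ≤ 2 * N) (hX : 0 < X)
    (hX2 : 2 * X ^ 2 ≤ N) :
    ‖∑ n ∈ Ioc N N', twist t n‖ ≤ 2 * X ^ 2 + 2 * N * t * (X ^ 2 / N : ℝ) ^ (k + 1) + (X ^ 2 : ℝ)⁻¹ * ∑ n ∈ Ioc N N',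
      ‖∑ x ∈ Icc (1 : ℤ) X, ∑ y ∈ Icc (1 : ℤ) X, ecv (fun j => taylorCoeff k t n j * (x : ℝ) ^ (j.val + 1)) (powVec k y)‖ := by
  have hN0 : (0 : ℝ) < N := by exact_mod_cast hN
  have hX0 : (0 : ℝ) < X := by exact_mod_cast hX
  set S := ∑ n ∈ Ioc N N', twist t n with hS
  set Z : ℝ := X ^ 2 / N with hZ
  have hZ2 : Z ≤ 1 / 2 := by
    rw [hZ, div_le_iff₀ hN0]
    have : (2 * X ^ 2 : ℝ) ≤ N := by exact_mod_cast hX2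
    linarith
  set w : ℕ → ℤ → ℤ → ℂ := fun n x y => ecv (fun j => taylorCoeff k t n j * (x : ℝ) ^ (j.val + 1)) (powVec k y) with hw
  set Er : ℝ := 2 * X ^ 2 + 2 * N * t * Z ^ (k + 1) with hEr
  have h1 : ∀ x ∈ Icc (1 : ℤ) X, ∀ y ∈ Icc (1 : ℤ) X, ‖S - ∑ n ∈ Ioc N N', twist t n * w n x y‖ ≤ Er := by
    intro x hx y hy
    rw [mem_Icc] at hx hy
    obtain ⟨a, rfl⟩ := Int.eq_ofNat_of_zero_le (show 0 ≤ x by omega)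
    obtain ⟨b, rfl⟩ := Int.eq_ofNat_of_zero_le (show 0 ≤ y by omega)
    have ha : (a : ℝ) ≤ X := by exact_mod_cast hx.2
    have hb : (b : ℝ) ≤ X := by exact_mod_cast hy.2
    have hab : (a * b : ℝ) ≤ X ^ 2 := by rw [sq]; gcongr
    have h2 := norm_sum_sub_shift_le (F := fun n => twist t n) (fun n => (norm_ec _).le) N N' (a * b) hNN'
    have h3 : ‖∑ n ∈ Ioc N N', twist t ((n + a * b : ℕ) : ℝ) - ∑ n ∈ Ioc N N', twist t n * w n a b‖ ≤ N * (2 * t * Z ^ (k + 1)) := by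
      rw [← sum_sub_distrib]
      refine (norm_sum_le _ _).trans ?_
      calc _ ≤ ∑ n ∈ Ioc N N', 2 * t * Z ^ (k + 1) := by
            refine sum_le_sum fun n hn => ?_
            rw [mem_Ioc] at hn
            have hnr : (N : ℝ) ≤ n := by exact_mod_cast hn.1.le
            have := norm_twist_sub_le (k := k) ht (n := n) (by omega) (x := a) (y := b) (by push_cast; positivity) (Z := Z) (by
              push_cast
              refine hab.trans ?_
              rw [hZ, div_mul_eq_mul_div, le_div_iff₀ hN0]
              gcongr) hZ2
            push_cast at this ⊢
            exact this
        _ ≤ _ := by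
            rw [sum_const, nsmul_eq_mul, Nat.card_Ioc]
            refine mul_le_mul_of_nonneg_right ?_ (by positivity)
            exact_mod_cast (show N' - N ≤ N by omega)
    have h4 := norm_add_le (S - ∑ n ∈ Ioc N N', twist t ((n + a * b : ℕ) : ℝ)) (∑ n ∈ Ioc N N', twist t ((n + a * b : ℕ) : ℝ) - ∑ n ∈ Ioc N N', twist t n * w n a b)
    rw [sub_add_sub_cancel] at h4
    refine h4.trans ((add_le_add h2 h3).trans ?_)
    rw [hEr]
    push_cast
    linarith
  have hcard : #(Icc (1 : ℤ) X) = X := by simp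
  have h5 : ‖∑ x ∈ Icc (1 : ℤ) X, ∑ y ∈ Icc (1 : ℤ) X, (S - ∑ n ∈ Ioc N N', twist t n * w n x y)‖ ≤ X ^ 2 * Er := by
    refine (norm_sum_le _ _).trans ((sum_le_sum fun x hx => (norm_sum_le _ _).trans (sum_le_sum fun y hy => h1 x hx y hy)).trans_eq ?_)
    rw [sum_const, sum_const, hcard, nsmul_eq_mul, nsmul_eq_mul]
    ring
  have h6 : ∑ x ∈ Icc (1 : ℤ) X, ∑ y ∈ Icc (1 : ℤ) X, (S - ∑ n ∈ Ioc N N', twist t n * w n x y) =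
      (X : ℂ) ^ 2 * S - ∑ n ∈ Ioc N N', twist t n * ∑ x ∈ Icc (1 : ℤ) X, ∑ y ∈ Icc (1 : ℤ) X, w n x y := by
    simp only [sum_sub_distrib, sum_const, hcard, nsmul_eq_mul, mul_sum]
    congr 1
    · ring
    · rw [sum_comm]
      rw [sum_congr rfl fun x _ => sum_comm]
      rw [sum_comm]
      refine sum_congr rfl fun n _ => ?_
      rw [sum_comm]
  rw [h6] at h5
  have h7 : ‖∑ n ∈ Ioc N N', twist t n * ∑ x ∈ Icc (1 : ℤ) X, ∑ y ∈ Icc (1 : ℤ) X, w n x y‖ ≤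
      ∑ n ∈ Ioc N N', ‖∑ x ∈ Icc (1 : ℤ) X, ∑ y ∈ Icc (1 : ℤ) X, w n x y‖ := by
    refine (norm_sum_le _ _).trans_eq (sum_congr rfl fun n _ => ?_)
    rw [norm_mul, twist, norm_ec, one_mul]
  have h8 : (X : ℝ) ^ 2 * ‖S‖ ≤ X ^ 2 * Er + ∑ n ∈ Ioc N N', ‖∑ x ∈ Icc (1 : ℤ) X, ∑ y ∈ Icc (1 : ℤ) X, w n x y‖ := by
    have h9 := norm_add_le ((X : ℂ) ^ 2 * S - ∑ n ∈ Ioc N N', twist t n * ∑ x ∈ Icc (1 : ℤ) X, ∑ y ∈ Icc (1 : ℤ) X, w n x y)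
      (∑ n ∈ Ioc N N', twist t n * ∑ x ∈ Icc (1 : ℤ) X, ∑ y ∈ Icc (1 : ℤ) X, w n x y)
    rw [sub_add_cancel, norm_mul, norm_pow, Complex.norm_natCast] at h9
    linarith
  have hXX : (0 : ℝ) < X ^ 2 := by positivity
  refine le_of_mul_le_mul_left ?_ hXX
  rw [mul_add, mul_inv_cancel_left₀ hXX.ne']
  exact h8

noncomputable def sepSum (β : ℝ) (Y : ℕ) : ℝ :=
  ∑ w ∈ Icc (-(Y : ℤ)) Y, ‖∑ v ∈ Icc (-(Y : ℤ)) Y, ec (β * w * v)‖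

theorem sepSum_nonneg (β : ℝ) (Y : ℕ) : 0 ≤ sepSum β Y := sum_nonneg fun _ _ => norm_nonneg _

theorem sepSum_trivial (β : ℝ) {s X : ℕ} (hs : 1 ≤ s) (hX : 1 ≤ X) (j : ℕ) :
    sepSum β (s * X ^ j) ≤ 9 * s ^ 2 * X ^ (2 * j) := by
  refine (sum_norm_ec_trivial β _).trans ?_
  have h : (1 : ℝ) ≤ s * X ^ j := by
    exact_mod_cast Nat.succ_le_of_lt (show 0 < s * X ^ j by positivity)
  push_cast
  calc (2 * (s * X ^ j : ℝ) + 1) ^ 2 ≤ (3 * (s * X ^ j)) ^ 2 := by gcongr; linarith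
    _ = _ := by ring

theorem sepSum_le_of_middle {N n X j s : ℕ} {lam t β : ℝ} (hlam : 0 < lam) (hN : 1 ≤ N) (hn1 : N ≤ n) (hn2 : n ≤ 2 * N)
    (hX1 : (X : ℝ) ≤ (N : ℝ) ^ (2 / 5 : ℝ)) (hX2 : (N : ℝ) ^ (2 / 5 : ℝ) ≤ 2 * X) (ht : t = (N : ℝ) ^ lam)
    (hj : 1 ≤ j) (hβ : |β| = t / (2 * Real.pi * j * (n : ℝ) ^ j)) (hj1 : 2 * lam ≤ j) (hj2 : (j : ℝ) ≤ 4 * lam)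
    (hs : 1 ≤ s) (hs2 : (s : ℝ) ≤ 3 * (N : ℝ) ^ (lam / 5)) :
    sepSum β (s * X ^ j) ≤ 200 * s * j * 8 ^ j * X ^ (2 * j) * (N : ℝ) ^ (-(lam / 10)) := by
  have hN0 : (0 : ℝ) < N := by exact_mod_cast hN
  have hN1 : (1 : ℝ) ≤ N := by exact_mod_cast hN
  have hn0 : (0 : ℝ) < n := by exact_mod_cast (hN.trans hn1)
  have hj0 : (1 : ℝ) ≤ j := by exact_mod_cast hj
  have hs0 : (1 : ℝ) ≤ s := by exact_mod_cast hs
  have hX0 : (0 : ℝ) < X := by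
    have : (0 : ℝ) < (N : ℝ) ^ (2 / 5 : ℝ) := by positivity
    linarith
  have hX : 1 ≤ X := by exact_mod_cast hX0
  have ht0 : 0 < t := by rw [ht]; positivity
  have hβ0 : 0 < |β| := by rw [hβ]; positivity
  have hπ := Real.pi_gt_three
  have hπ2 := Real.pi_lt_d2
  have hXj : (X : ℝ) ^ j ≤ (N : ℝ) ^ (2 / 5 * j : ℝ) := by
    rw [Real.rpow_mul hN0.le, Real.rpow_natCast]; gcongr
  have hXj2 : (N : ℝ) ^ (2 / 5 * j : ℝ) ≤ 2 ^ j * X ^ j := by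
    rw [Real.rpow_mul hN0.le, Real.rpow_natCast, ← mul_pow]; gcongr
  have hNj : (N : ℝ) ^ j ≤ n ^ j := by gcongr; 
  have hNjr : (N : ℝ) ^ (j : ℝ) = (N : ℝ) ^ j := Real.rpow_natCast _ _
  have hA : |β| * ((s * X ^ j : ℕ) : ℝ) ≤ 1 / 2 := by
    rw [hβ, div_mul_eq_mul_div, div_le_iff₀ (by positivity)]
    push_cast
    have h1 : (N : ℝ) ^ lam * (N : ℝ) ^ (lam / 5) * (N : ℝ) ^ (2 / 5 * j : ℝ) ≤ (N : ℝ) ^ j := by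
      rw [← hNjr, ← Real.rpow_add hN0, ← Real.rpow_add hN0]
      exact Real.rpow_le_rpow_of_exponent_le hN1 (by linarith)
    calc t * (s * X ^ j) ≤ (N : ℝ) ^ lam * (3 * (N : ℝ) ^ (lam / 5) * (N : ℝ) ^ (2 / 5 * j : ℝ)) := by
          rw [ht]; gcongr
      _ = 3 * ((N : ℝ) ^ lam * (N : ℝ) ^ (lam / 5) * (N : ℝ) ^ (2 / 5 * j : ℝ)) := by ring
      _ ≤ 3 * (n : ℝ) ^ j := by gcongr; exact h1.trans hNj
      _ ≤ (Real.pi * j) * (n : ℝ) ^ j := by gcongr; nlinarith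
      _ = _ := by ring
  have hB := sum_norm_ec_le (abs_pos.1 hβ0) hA
  refine hB.trans ?_
  have hQ : (0 : ℝ) < (N : ℝ) ^ (-(lam / 10)) := by positivity
  have h1 : (2 * ((s * X ^ j : ℕ) : ℝ) + 1) ≤ 3 * s * j * 8 ^ j * X ^ (2 * j) * (N : ℝ) ^ (-(lam / 10)) := by
    have h2 : 1 ≤ (2 ^ j * X ^ j : ℝ) * (N : ℝ) ^ (-(lam / 10)) := by
      calc (1 : ℝ) ≤ (N : ℝ) ^ (2 / 5 * j : ℝ) * (N : ℝ) ^ (-(lam / 10)) := by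
            rw [← Real.rpow_add hN0]; exact Real.one_le_rpow hN1 (by linarith)
        _ ≤ _ := by gcongr
    have h3 : (1 : ℝ) ≤ s * X ^ j := by
      exact_mod_cast Nat.succ_le_of_lt (show 0 < s * X ^ j by positivity)
    have h4 : (2 : ℝ) ^ j ≤ j * 8 ^ j := by
      have : (2 : ℝ) ^ j ≤ 8 ^ j := by gcongr; norm_num
      nlinarith [show (0 : ℝ) < 8 ^ j by positivity]
    push_cast
    calc (2 * (s * X ^ j : ℝ) + 1) ≤ 3 * s * X ^ j * 1 := by linarith
      _ ≤ 3 * s * X ^ j * ((2 ^ j * X ^ j : ℝ) * (N : ℝ) ^ (-(lam / 10))) := by gcongr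
      _ = 3 * s * 2 ^ j * X ^ (2 * j) * (N : ℝ) ^ (-(lam / 10)) := by ring
      _ ≤ 3 * s * (j * 8 ^ j) * X ^ (2 * j) * (N : ℝ) ^ (-(lam / 10)) := by gcongr
      _ = _ := by ring
  have h2 : |β|⁻¹ ≤ 2 * Real.pi * j * 8 ^ j * X ^ (2 * j) * (N : ℝ) ^ (-(lam / 5)) := by
    rw [hβ, inv_div, div_le_iff₀ ht0, ht]
    have e1 : (N : ℝ) ^ (-(lam / 5)) * (N : ℝ) ^ lam = (N : ℝ) ^ (4 / 5 * lam) := by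
      rw [← Real.rpow_add hN0]; congr 1; ring
    have e2 : (N : ℝ) ^ j ≤ (N : ℝ) ^ (4 / 5 * lam) * ((N : ℝ) ^ (2 / 5 * j : ℝ)) ^ 2 := by
      rw [← hNjr, ← Real.rpow_natCast _ 2, ← Real.rpow_mul hN0.le, ← Real.rpow_add hN0]
      refine Real.rpow_le_rpow_of_exponent_le hN1 ?_
      push_cast; linarith
    have e3 : (n : ℝ) ^ j ≤ 2 ^ j * (N : ℝ) ^ j := by
      rw [← mul_pow]; gcongr; exact_mod_cast hn2
    have e5 : (n : ℝ) ^ j ≤ 8 ^ j * X ^ (2 * j) * (N : ℝ) ^ (4 / 5 * lam) := by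
      calc (n : ℝ) ^ j ≤ 2 ^ j * ((N : ℝ) ^ (4 / 5 * lam) * (2 ^ j * X ^ j) ^ 2) := by
            refine e3.trans ?_; gcongr; refine e2.trans ?_; gcongr
        _ = (2 * 4) ^ j * X ^ (2 * j) * (N : ℝ) ^ (4 / 5 * lam) := by
            rw [mul_pow (2 : ℝ) 4, show (4 : ℝ) = 2 ^ 2 by norm_num, ← pow_mul]; ring
        _ = _ := by norm_num
    calc 2 * Real.pi * j * (n : ℝ) ^ j ≤ 2 * Real.pi * j * (8 ^ j * X ^ (2 * j) * (N : ℝ) ^ (4 / 5 * lam)) := by gcongr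
      _ = _ := by rw [← e1]; ring
  have h3 : 1 + Real.log ((s * X ^ j : ℕ) : ℝ) ≤ 17 * s * (N : ℝ) ^ (lam / 10) := by
    have e0 : (1 : ℝ) ≤ (N : ℝ) ^ (lam / 10) := Real.one_le_rpow hN1 (by linarith)
    push_cast
    rw [Real.log_mul (by positivity) (by positivity)]
    have e1 : Real.log ((X : ℝ) ^ j) ≤ 16 * (N : ℝ) ^ (lam / 10) := by
      calc Real.log ((X : ℝ) ^ j) ≤ Real.log ((N : ℝ) ^ (2 / 5 * j : ℝ)) := Real.log_le_log (by positivity) hXj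
        _ = 2 / 5 * j * Real.log N := Real.log_rpow hN0 _
        _ ≤ 2 / 5 * (4 * lam) * Real.log N := by gcongr
        _ = 16 * Real.log ((N : ℝ) ^ (lam / 10)) := by rw [Real.log_rpow hN0]; ring
        _ ≤ _ := by gcongr; exact (Real.log_le_sub_one_of_pos (by positivity)).trans (by linarith)
    have e2 := Real.log_le_sub_one_of_pos (show (0 : ℝ) < s by linarith)
    nlinarith
  have h4 : |β|⁻¹ * (1 + Real.log ((s * X ^ j : ℕ) : ℝ)) ≤ 110 * s * j * 8 ^ j * X ^ (2 * j) * (N : ℝ) ^ (-(lam / 10)) := by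
    have e1 : (N : ℝ) ^ (-(lam / 5)) * (N : ℝ) ^ (lam / 10) = (N : ℝ) ^ (-(lam / 10)) := by
      rw [← Real.rpow_add hN0]; congr 1; ring
    calc _ ≤ |β|⁻¹ * (17 * s * (N : ℝ) ^ (lam / 10)) := by gcongr
      _ ≤ (2 * Real.pi * j * 8 ^ j * X ^ (2 * j) * (N : ℝ) ^ (-(lam / 5))) * (17 * s * (N : ℝ) ^ (lam / 10)) := by gcongr
      _ = (34 * Real.pi) * s * j * 8 ^ j * X ^ (2 * j) * ((N : ℝ) ^ (-(lam / 5)) * (N : ℝ) ^ (lam / 10)) := by ring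
      _ ≤ _ := by rw [e1]; gcongr; linarith
  have h5 : (0 : ℝ) ≤ s * j * 8 ^ j * X ^ (2 * j) * (N : ℝ) ^ (-(lam / 10)) := by positivity
  linarith

theorem prod_pow_two_mul_succ (x : ℝ) (k : ℕ) : ∏ j : Fin k, x ^ (2 * (j.val + 1)) = x ^ (k * (k + 1)) := by
  rw [Fin.prod_univ_eq_prod_range (fun j => x ^ (2 * (j + 1))) k]
  induction k with
  | zero => simp
  | succ k ih => rw [prod_range_succ, ih, ← pow_add]; congr 1; ring

theorem card_middle_ge {lam : ℝ} {k : ℕ} (hlam : 1 / 2 ≤ lam) (hk : 5 * lam ≤ k) :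
    lam ≤ #{j : Fin k | 2 * lam ≤ ((j.val + 1 : ℕ) : ℝ) ∧ ((j.val + 1 : ℕ) : ℝ) ≤ 4 * lam} := by
  set G : Finset (Fin k) := {j : Fin k | 2 * lam ≤ ((j.val + 1 : ℕ) : ℝ) ∧ ((j.val + 1 : ℕ) : ℝ) ≤ 4 * lam} with hG
  have h1 : ∀ i : ℕ, 1 ≤ i → 2 * lam ≤ i → (i : ℝ) ≤ 4 * lam → i ∈ G.image (fun j => j.val + 1) := by
    intro i hi h2 h4
    have : (i : ℝ) ≤ k := by linarith
    have hik : i ≤ k := by exact_mod_cast this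
    refine mem_image.2 ⟨⟨i - 1, by omega⟩, ?_, by simp; omega⟩
    simp only [hG, mem_filter, mem_univ, true_and]
    rw [Nat.sub_add_cancel hi]
    exact ⟨h2, h4⟩
  have h0 : #(G.image (fun j => j.val + 1)) ≤ #G := card_image_le
  have h0' : (#(G.image (fun j => j.val + 1)) : ℝ) ≤ #G := by exact_mod_cast h0
  refine le_trans ?_ h0'
  rcases le_or_gt 1 lam with h | h
  · have h2 : Icc ⌈2 * lam⌉₊ ⌊4 * lam⌋₊ ⊆ G.image (fun j => j.val + 1) := by
      intro i hi
      rw [mem_Icc] at hi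
      have e1 : 2 * lam ≤ i := Nat.ceil_le.1 hi.1
      have e2 : (i : ℝ) ≤ 4 * lam := (Nat.le_floor_iff (by linarith)).1 hi.2
      refine h1 i ?_ e1 e2
      have : (1 : ℝ) ≤ i := by linarith
      exact_mod_cast this
    have h3 := card_le_card h2
    rw [Nat.card_Icc] at h3
    have e1 := Nat.ceil_lt_add_one (show 0 ≤ 2 * lam by linarith)
    have e2 := Nat.lt_floor_add_one (4 * lam)
    have e3 : (⌊4 * lam⌋₊ + 1 : ℝ) ≤ #(G.image (fun j => j.val + 1)) + ⌈2 * lam⌉₊ := by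
      exact_mod_cast (show ⌊4 * lam⌋₊ + 1 ≤ #(G.image (fun j => j.val + 1)) + ⌈2 * lam⌉₊ by omega)
    linarith
  · have h2 : {2} ⊆ G.image (fun j => j.val + 1) := by
      rw [singleton_subset_iff]
      exact h1 2 (by norm_num) (by push_cast; linarith) (by push_cast; linarith)
    have h3 := card_le_card h2
    rw [card_singleton] at h3
    have : (1 : ℝ) ≤ #(G.image (fun j => j.val + 1)) := by exact_mod_cast h3
    linarith

theorem const_pow_le {k : ℕ} (hk : 3 ≤ k) : ((k : ℝ) ^ (240 * k ^ 4)) ^ 2 * (1800 * (k : ℝ) ^ 3 * 8 ^ k) ^ k ≤ (3 * (k : ℝ) ^ 2) ^ (324 * k ^ 4) := by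
  have hk' : (3 : ℝ) ≤ k := by exact_mod_cast hk
  have hk1 : (1 : ℝ) ≤ k := by linarith
  have h1 : (1800 * (k : ℝ) ^ 3 * 8 ^ k) ≤ k ^ (10 + 2 * k) := by
    calc (1800 * (k : ℝ) ^ 3 * 8 ^ k) ≤ (3 ^ 7) * (k : ℝ) ^ 3 * (3 ^ 2) ^ k := by gcongr <;> norm_num
      _ ≤ (k ^ 7) * (k : ℝ) ^ 3 * (k ^ 2) ^ k := by gcongr
      _ = _ := by rw [← pow_mul, ← pow_add, ← pow_add]
  calc ((k : ℝ) ^ (240 * k ^ 4)) ^ 2 * (1800 * (k : ℝ) ^ 3 * 8 ^ k) ^ k ≤ ((k : ℝ) ^ (240 * k ^ 4)) ^ 2 * (k ^ (10 + 2 * k)) ^ k := by gcongr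
    _ = (k : ℝ) ^ (480 * k ^ 4 + (10 + 2 * k) * k) := by rw [← pow_mul, ← pow_mul, ← pow_add]; congr 1; ring
    _ ≤ (k : ℝ) ^ (2 * (324 * k ^ 4)) := by
        refine pow_le_pow_right₀ hk1 ?_
        nlinarith [Nat.pow_le_pow_left hk 3, Nat.pow_le_pow_left hk 2]
    _ = ((k : ℝ) ^ 2) ^ (324 * k ^ 4) := by rw [pow_mul]
    _ ≤ _ := by gcongr; nlinarith

theorem combine_bounds {A J K E P D Y R X2 F H q h v : ℝ} {M : ℕ} (hJ0 : 0 ≤ J) (hD : 0 ≤ D) (hY : 0 ≤ Y) (hX2 : 0 ≤ X2) (hR0 : 0 ≤ R)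
    (hJ : J ≤ K * E) (hP : P ≤ D * Y * R) (hP0 : 0 ≤ P)
    (hXX : A ^ 2 * E ^ 2 * Y = X2 ^ M * F) (hF : F ≤ H) (hR : R ≤ q) (hfin : H * q ≤ h ^ M) (hv : K ^ 2 * D ≤ v ^ M) :
    A ^ 2 * J ^ 2 * P ≤ (X2 * v * h) ^ M := by
  have hXM : 0 ≤ X2 ^ M := by positivity
  have hKD : 0 ≤ K ^ 2 * D := by positivity
  rcases hXM.eq_or_lt with h0 | h0
  · have e0 : A ^ 2 * J ^ 2 * P ≤ A ^ 2 * (K * E) ^ 2 * (D * Y * R) := by gcongr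
    rw [mul_pow, mul_pow, ← h0]
    calc _ ≤ _ := e0
      _ = (A ^ 2 * E ^ 2 * Y) * (K ^ 2 * D * R) := by ring
      _ = 0 := by rw [hXX, ← h0]; ring
      _ ≤ _ := by simp
  have hF0 : 0 ≤ F := by
    have : 0 ≤ X2 ^ M * F := hXX ▸ (by positivity)
    exact nonneg_of_mul_nonneg_right this h0
  have hH : 0 ≤ H := hF0.trans hF
  have hq : 0 ≤ q := hR0.trans hR
  calc A ^ 2 * J ^ 2 * P ≤ A ^ 2 * (K * E) ^ 2 * (D * Y * R) := by gcongr
    _ = (K ^ 2 * D) * (A ^ 2 * E ^ 2 * Y) * R := by ring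
    _ = (K ^ 2 * D) * X2 ^ M * (F * R) := by rw [hXX]; ring
    _ ≤ v ^ M * X2 ^ M * (H * q) := by gcongr; exact mul_nonneg (hKD.trans hv) hXM
    _ ≤ v ^ M * X2 ^ M * h ^ M := by gcongr; exact mul_nonneg (hKD.trans hv) hXM
    _ = _ := by rw [mul_pow, mul_pow]; ring

set_option maxHeartbeats 1000000 in
theorem norm_bilinear_le {N n X k : ℕ} {lam t : ℝ} (hlam : 1 / 2 ≤ lam) (hN : 1 ≤ N) (hn1 : N ≤ n) (hn2 : n ≤ 2 * N)
    (hX1 : (X : ℝ) ≤ (N : ℝ) ^ (2 / 5 : ℝ)) (hX2 : (N : ℝ) ^ (2 / 5 : ℝ) ≤ 2 * X) (ht : t = (N : ℝ) ^ lam)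
    (hk1 : 5 * lam ≤ k) (hk2 : (k : ℝ) ≤ 7 * lam) (hk3 : 3 ≤ k) :
    ‖∑ x ∈ Icc (1 : ℤ) X, ∑ y ∈ Icc (1 : ℤ) X, ecv (fun j => taylorCoeff k t n j * (x : ℝ) ^ (j.val + 1)) (powVec k y)‖ ≤
      X ^ 2 * (3 * k ^ 2) * (N : ℝ) ^ (-(1 / 16000000 / lam ^ 2)) := by
  have hN0 : (0 : ℝ) < N := by exact_mod_cast hN
  have hN1 : (1 : ℝ) ≤ N := by exact_mod_cast hN
  have hX0 : (0 : ℝ) < X := by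
    have : (0 : ℝ) < (N : ℝ) ^ (2 / 5 : ℝ) := by positivity
    linarith
  have hX : 1 ≤ X := by exact_mod_cast hX0
  have hk' : (3 : ℝ) ≤ k := by exact_mod_cast hk3
  have hl0 : 0 < lam := by linarith
  have ht0 : 0 < t := by rw [ht]; positivity
  set W := ∑ x ∈ Icc (1 : ℤ) X, ∑ y ∈ Icc (1 : ℤ) X, ecv (fun j => taylorCoeff k t n j * (x : ℝ) ^ (j.val + 1)) (powVec k y) with hW
  rcases lt_or_ge (3 * (N : ℝ) ^ (lam / 5)) ((9 * k ^ 2 : ℕ) : ℝ) with hs | hs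
  · have h1 : ‖W‖ ≤ X ^ 2 := by
      refine (norm_sum_le _ _).trans ((sum_le_sum fun x hx => (norm_sum_le _ _).trans (sum_le_sum fun y hy => (norm_ecv _ _).le)).trans_eq ?_)
      simp [sq]
    have h2 : 1 ≤ 3 * (k : ℝ) ^ 2 * (N : ℝ) ^ (-(1 / 16000000 / lam ^ 2)) := by
      have h3 : (N : ℝ) ^ (lam / 5) ≤ 3 * (k : ℝ) ^ 2 := by push_cast at hs; linarith
      have h4 : 1 / 16000000 / lam ^ 2 ≤ lam / 5 := by
        rw [div_le_iff₀ (by positivity)]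
        have : (1 / 2 : ℝ) ^ 3 ≤ lam ^ 3 := by gcongr
        nlinarith
      calc (1 : ℝ) ≤ (N : ℝ) ^ (lam / 5) * (N : ℝ) ^ (-(1 / 16000000 / lam ^ 2)) := by
            rw [← Real.rpow_add hN0]; exact Real.one_le_rpow hN1 (by linarith)
        _ ≤ _ := by gcongr
    calc ‖W‖ ≤ X ^ 2 * 1 := by linarith
      _ ≤ X ^ 2 * (3 * (k : ℝ) ^ 2 * (N : ℝ) ^ (-(1 / 16000000 / lam ^ 2))) := by gcongr
      _ = _ := by ring
  have hm := norm_bilinear_pow_le (9 * k ^ 2) X (by positivity) hX (taylorCoeff k t n)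
  rw [← hW] at hm
  set J := (vinoCount k (9 * k ^ 2) (Icc (1 : ℤ) X) : ℝ) with hJ
  have hJb : J ≤ (k : ℝ) ^ (240 * k ^ 4) * (X : ℝ) ^ (18 * (k : ℝ) ^ 2 - k * (k + 1) / 2 + k ^ 2 / 1000) := by
    refine le_trans ?_ (vinogradov_mean_value (by omega) X hX)
    rw [hJ]
    have := vinoCount_le_of_affine (k := k) (n := 9 * k ^ 2) (A := Icc (1 : ℤ) X) (C := Ico 0 (X : ℤ)) 1 1 one_ne_zero (fun x hx => by
      rw [mem_Icc] at hx
      exact ⟨x - 1, by rw [mem_Ico]; omega, by ring⟩)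
    exact_mod_cast this
  set Q := (N : ℝ) ^ (-(lam / 10)) with hQ
  have hQ0 : 0 < Q := by positivity
  set D := (1800 * (k : ℝ) ^ 3 * 8 ^ k) with hD
  have h8k : (1 : ℝ) ≤ 8 ^ k := one_le_pow₀ (by norm_num)
  set G : Finset (Fin k) := {j : Fin k | 2 * lam ≤ ((j.val + 1 : ℕ) : ℝ) ∧ ((j.val + 1 : ℕ) : ℝ) ≤ 4 * lam} with hG
  have hP : ∏ j : Fin k, sepSum (taylorCoeff k t n j) (9 * k ^ 2 * X ^ (j.val + 1)) ≤ D ^ k * (X : ℝ) ^ (k * (k + 1)) * Q ^ #G := by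
    calc _ ≤ ∏ j : Fin k, (D * (X : ℝ) ^ (2 * (j.val + 1)) * if j ∈ G then Q else 1) := by
          refine prod_le_prod (fun j _ => sepSum_nonneg _ _) fun j _ => ?_
          split_ifs with hj
          · simp only [hG, mem_filter, mem_univ, true_and] at hj
            have hβ : |taylorCoeff k t n j| = t / (2 * Real.pi * ((j.val + 1 : ℕ) : ℝ) * (n : ℝ) ^ (j.val + 1)) := by
              rw [taylorCoeff, abs_div, abs_mul, abs_pow, abs_neg, abs_one, one_pow, mul_one, abs_of_pos ht0]
              congr 1
              push_cast
              exact abs_of_nonneg (by positivity)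
            refine (sepSum_le_of_middle hl0 hN hn1 hn2 hX1 hX2 ht (Nat.succ_le_succ (Nat.zero_le _)) hβ hj.1 hj.2 (Nat.succ_le_of_lt (by positivity)) hs).trans ?_
            rw [← hQ]
            have h1 : ((j.val + 1 : ℕ) : ℝ) ≤ k := by exact_mod_cast j.2
            have h2 : (8 : ℝ) ^ (j.val + 1) ≤ 8 ^ k := pow_le_pow_right₀ (by norm_num) j.2
            calc _ ≤ 200 * ((9 * k ^ 2 : ℕ) : ℝ) * k * 8 ^ k * X ^ (2 * (j.val + 1)) * Q := by gcongr
              _ = _ := by rw [hD]; push_cast; ring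
          · rw [mul_one]
            refine (sepSum_trivial _ (Nat.succ_le_of_lt (by positivity)) hX _).trans ?_
            gcongr
            rw [hD]
            push_cast
            have h1 : (k : ℝ) ≤ 8 ^ k := by exact_mod_cast (Nat.lt_pow_self (by norm_num)).le
            calc (9 * (9 * (k : ℝ) ^ 2) ^ 2 : ℝ) = 729 * k ^ 3 * k := by ring
              _ ≤ 1800 * (k : ℝ) ^ 3 * 8 ^ k := by gcongr; norm_num
      _ = _ := by
          rw [prod_mul_distrib, prod_mul_distrib, prod_pow_two_mul_succ, prod_const, card_univ, Fintype.card_fin]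
          congr 1
          rw [prod_ite_mem, univ_inter, prod_const]
  have hGc : lam ≤ #G := card_middle_ge hlam hk1
  have hQG : Q ^ #G ≤ (N : ℝ) ^ (-(lam ^ 2 / 10)) := by
    rw [hQ, ← Real.rpow_natCast _ #G, ← Real.rpow_mul hN0.le]
    refine Real.rpow_le_rpow_of_exponent_le hN1 ?_
    nlinarith
  have hXk : (X : ℝ) ^ ((k : ℝ) ^ 2 / 500) ≤ (N : ℝ) ^ (lam ^ 2 / 25) := by
    calc (X : ℝ) ^ ((k : ℝ) ^ 2 / 500) ≤ ((N : ℝ) ^ (2 / 5 : ℝ)) ^ ((k : ℝ) ^ 2 / 500) := by gcongr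
      _ = (N : ℝ) ^ (2 / 5 * ((k : ℝ) ^ 2 / 500)) := by rw [Real.rpow_mul hN0.le]
      _ ≤ _ := by
        refine Real.rpow_le_rpow_of_exponent_le hN1 ?_
        nlinarith
  have hM : 2 * (9 * k ^ 2) * (2 * (9 * k ^ 2)) = 324 * k ^ 4 := by ring
  refine le_of_pow_le_pow_left₀ (n := 324 * k ^ 4) (by positivity) (by positivity) ?_
  rw [hM] at hm
  refine hm.trans ?_
  have hXX : ((X : ℝ) ^ (2 * (9 * k ^ 2) * (2 * (9 * k ^ 2) - 1))) ^ 2 * ((X : ℝ) ^ (18 * (k : ℝ) ^ 2 - k * (k + 1) / 2 + k ^ 2 / 1000)) ^ 2 * (X : ℝ) ^ (k * (k + 1)) =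
      (X : ℝ) ^ (2 * (324 * k ^ 4)) * (X : ℝ) ^ ((k : ℝ) ^ 2 / 500) := by
    rw [← Real.rpow_natCast (X : ℝ) (2 * (9 * k ^ 2) * (2 * (9 * k ^ 2) - 1)), ← Real.rpow_natCast (X : ℝ) (k * (k + 1)), ← Real.rpow_natCast (X : ℝ) (2 * (324 * k ^ 4)),
      ← Real.rpow_natCast _ 2, ← Real.rpow_natCast _ 2, ← Real.rpow_mul hX0.le, ← Real.rpow_mul hX0.le, ← Real.rpow_add hX0, ← Real.rpow_add hX0, ← Real.rpow_add hX0]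
    congr 1
    have : 1 ≤ 2 * (9 * k ^ 2) := Nat.succ_le_of_lt (by positivity)
    push_cast [Nat.cast_sub this]
    ring
  have hfin : (N : ℝ) ^ (lam ^ 2 / 25) * (N : ℝ) ^ (-(lam ^ 2 / 10)) ≤ ((N : ℝ) ^ (-(1 / 16000000 / lam ^ 2))) ^ (324 * k ^ 4) := by
    rw [← Real.rpow_add hN0, ← Real.rpow_natCast _ (324 * k ^ 4), ← Real.rpow_mul hN0.le]
    refine Real.rpow_le_rpow_of_exponent_le hN1 ?_
    have h4 : (k : ℝ) ^ 4 ≤ (7 * lam) ^ 4 := by gcongr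
    have h5 : 1 / 16000000 / lam ^ 2 * (324 * (k : ℝ) ^ 4) ≤ lam ^ 2 / 20 := by
      calc 1 / 16000000 / lam ^ 2 * (324 * (k : ℝ) ^ 4) ≤ 1 / 16000000 / lam ^ 2 * (324 * (7 * lam) ^ 4) := by gcongr
        _ = 777924 / 16000000 * lam ^ 2 := by field_simp; ring
        _ ≤ _ := by nlinarith [sq_nonneg lam]
    push_cast
    nlinarith [sq_nonneg lam]
  rw [pow_mul (X : ℝ) 2] at hXX
  exact combine_bounds (by positivity) (by positivity) (by positivity) (by positivity) (by positivity) hJb hP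
    (prod_nonneg fun j _ => sepSum_nonneg _ _) hXX hXk hQG hfin (const_pow_le hk3)

theorem norm_sum_twist_trivial (t : ℝ) (N N' : ℕ) (h : N' ≤ 2 * N) : ‖∑ n ∈ Ioc N N', twist t n‖ ≤ N := by
  refine (norm_sum_le _ _).trans ((sum_le_sum fun n _ => (norm_ec _).le).trans ?_)
  rw [sum_const, nsmul_eq_mul, mul_one, Nat.card_Ioc]
  exact_mod_cast (show N' - N ≤ N by omega)

set_option maxHeartbeats 1000000 in
/-- Vinogradov's estimate for zeta sums over dyadic intervals. -/
theorem norm_sum_twist_le_exp {t : ℝ} (ht : 2 ≤ t) {N N' : ℕ} (hN : 1 ≤ N) (hNt : (N : ℝ) ≤ t ^ 2) (hNN' : N ≤ N') (hN2 : N' ≤ 2 * N) :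
    ‖∑ n ∈ Ioc N N', twist t n‖ ≤ 200 * Real.log t ^ 2 * N * Real.exp (-(1 / 16000000 * Real.log N ^ 3 / Real.log t ^ 2)) := by
  have hN0 : (0 : ℝ) < N := by exact_mod_cast hN
  have hN1 : (1 : ℝ) ≤ N := by exact_mod_cast hN
  have ht0 : 0 < t := by linarith
  have hlt : 0.69 < Real.log t := lt_of_lt_of_le (by linarith [Real.log_two_gt_d9]) (Real.log_le_log (by norm_num) ht)
  have hL0 : 0 ≤ Real.log N := Real.log_nonneg hN1
  have hLt : Real.log N ≤ 2 * Real.log t := by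
    have := Real.log_le_log hN0 hNt
    rwa [Real.log_pow] at this
  rcases lt_or_ge N 32 with h32 | h32
  · refine (norm_sum_twist_trivial t N N' hN2).trans ?_
    have h1 : Real.log N ≤ 31 := by
      have := Real.log_le_sub_one_of_pos hN0
      have h3 : (N : ℝ) ≤ 31 := by exact_mod_cast (show N ≤ 31 by omega)
      linarith
    have h2 : 1 / 16000000 * Real.log N ^ 3 / Real.log t ^ 2 ≤ 1 / 2 := by
      rw [div_le_iff₀ (by positivity)]
      have : Real.log N ^ 2 ≤ (2 * Real.log t) ^ 2 := by gcongr
      have h3 : Real.log N ^ 3 ≤ 31 * (2 * Real.log t) ^ 2 := by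
        rw [pow_succ' _ 2]
        gcongr
      linarith [sq_nonneg (Real.log t)]
    have h3 : (1 / 2 : ℝ) ≤ Real.exp (-(1 / 16000000 * Real.log N ^ 3 / Real.log t ^ 2)) := by
      have := Real.add_one_le_exp (-(1 / 16000000 * Real.log N ^ 3 / Real.log t ^ 2))
      linarith
    have h4 : 1 ≤ 200 * Real.log t ^ 2 * (1 / 2) := by
      have : (0.69 : ℝ) ^ 2 ≤ Real.log t ^ 2 := by gcongr
      linarith
    calc (N : ℝ) ≤ (200 * Real.log t ^ 2 * (1 / 2)) * N := le_mul_of_one_le_left hN0.le h4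
      _ = 200 * Real.log t ^ 2 * N * (1 / 2) := by ring
      _ ≤ _ := by gcongr
  have h32' : (32 : ℝ) ≤ N := by exact_mod_cast h32
  have hL1 : 1 ≤ Real.log N := by
    rw [Real.le_log_iff_exp_le hN0]
    linarith [Real.exp_one_lt_d9]
  set lam := Real.log t / Real.log N with hlam
  have hlamN : lam * Real.log N = Real.log t := div_mul_cancel₀ _ (by linarith)
  have hlam1 : 1 / 2 ≤ lam := by rw [hlam, le_div_iff₀ (by linarith)]; linarith
  have hlam2 : (1 / 2 : ℝ) ^ 2 ≤ lam ^ 2 := by gcongr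
  have hlamt : lam ≤ Real.log t := div_le_self (by linarith) hL1
  have htN : t = (N : ℝ) ^ lam := by
    rw [Real.rpow_def_of_pos hN0, mul_comm, hlamN, Real.exp_log ht0]
  set k := ⌈5 * lam⌉₊ with hk
  have hk1 : 5 * lam ≤ k := Nat.le_ceil _
  have hk2 : (k : ℝ) ≤ 7 * lam := by
    have := Nat.ceil_lt_add_one (show 0 ≤ 5 * lam by linarith)
    linarith
  have hk3 : 3 ≤ k := by
    have : (2 : ℝ) < k := by linarith
    exact_mod_cast this
  set X := ⌊(N : ℝ) ^ (2 / 5 : ℝ)⌋₊ with hX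
  have hX1 : (X : ℝ) ≤ (N : ℝ) ^ (2 / 5 : ℝ) := Nat.floor_le (by positivity)
  have hN25 : (1 : ℝ) ≤ (N : ℝ) ^ (2 / 5 : ℝ) := Real.one_le_rpow hN1 (by norm_num)
  have hXp : 0 < X := Nat.floor_pos.2 hN25
  have hXr : (1 : ℝ) ≤ X := by exact_mod_cast hXp
  have hX2 : (N : ℝ) ^ (2 / 5 : ℝ) ≤ 2 * X := by
    have := Nat.lt_floor_add_one ((N : ℝ) ^ (2 / 5 : ℝ))
    rw [← hX] at this
    linarith
  have hXX : (X : ℝ) ^ 2 ≤ N * (N : ℝ) ^ (-(1 / 5) : ℝ) := by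
    calc (X : ℝ) ^ 2 ≤ ((N : ℝ) ^ (2 / 5 : ℝ)) ^ 2 := by gcongr
      _ = (N : ℝ) ^ (1 + (-(1 / 5)) : ℝ) := by
        rw [← Real.rpow_natCast _ 2, ← Real.rpow_mul hN0.le]; congr 1; norm_num
      _ = _ := by rw [Real.rpow_add hN0, Real.rpow_one]
  have h2N : (N : ℝ) ^ (-(1 / 5) : ℝ) ≤ 1 / 2 := by
    rw [Real.rpow_neg hN0.le, inv_le_comm₀ (by positivity) (by norm_num)]
    calc (1 / 2 : ℝ)⁻¹ = (32 : ℝ) ^ (1 / 5 : ℝ) := by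
          rw [show (32 : ℝ) = 2 ^ (5 : ℝ) by norm_num, ← Real.rpow_mul (by norm_num)]; norm_num
      _ ≤ _ := by gcongr
  have hX2N : 2 * X ^ 2 ≤ N := by
    have : (2 * X ^ 2 : ℝ) ≤ N := by linarith [mul_le_mul_of_nonneg_left h2N hN0.le]
    exact_mod_cast this
  have hmain := norm_sum_twist_le (k := k) ht0.le (by omega) hNN' hN2 hXp hX2N
  set E := (N : ℝ) ^ (-(1 / 16000000 / lam ^ 2)) with hE
  have hE0 : 0 < E := by positivity
  have hEe : E = Real.exp (-(1 / 16000000 * Real.log N ^ 3 / Real.log t ^ 2)) := by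
    rw [hE, Real.rpow_def_of_pos hN0, hlam]
    congr 1
    field_simp
  have h15 : (N : ℝ) ^ (-(1 / 5) : ℝ) ≤ E := by
    refine Real.rpow_le_rpow_of_exponent_le hN1 ?_
    have : 1 / 16000000 / lam ^ 2 ≤ 1 / 5 := by
      rw [div_le_iff₀ (by positivity)]
      linarith
    linarith
  have hA : 2 * (X : ℝ) ^ 2 ≤ 2 * N * E := by
    have : (N : ℝ) * (N : ℝ) ^ (-(1 / 5) : ℝ) ≤ N * E := by gcongr
    linarith
  have hB : 2 * N * t * (X ^ 2 / N : ℝ) ^ (k + 1) ≤ 2 * N * E := by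
    have e1 : (X ^ 2 / N : ℝ) ≤ (N : ℝ) ^ (-(1 / 5) : ℝ) := by
      rw [div_le_iff₀ hN0]; linarith
    have e2 : t * (X ^ 2 / N : ℝ) ^ (k + 1) ≤ E := by
      calc t * (X ^ 2 / N : ℝ) ^ (k + 1) ≤ t * ((N : ℝ) ^ (-(1 / 5) : ℝ)) ^ (k + 1) := by gcongr
        _ = (N : ℝ) ^ (lam + -(1 / 5) * ((k + 1 : ℕ) : ℝ)) := by
          rw [Real.rpow_add hN0, ← htN, Real.rpow_mul hN0.le, Real.rpow_natCast]
        _ ≤ (N : ℝ) ^ (-(1 / 5) : ℝ) := by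
          refine Real.rpow_le_rpow_of_exponent_le hN1 ?_
          push_cast; linarith
        _ ≤ E := h15
    calc _ = 2 * N * (t * (X ^ 2 / N : ℝ) ^ (k + 1)) := by ring
      _ ≤ _ := by gcongr
  have hC : (X ^ 2 : ℝ)⁻¹ * ∑ n ∈ Ioc N N', ‖∑ x ∈ Icc (1 : ℤ) X, ∑ y ∈ Icc (1 : ℤ) X, ecv (fun j : Fin k => taylorCoeff k t n j * (x : ℝ) ^ (j.val + 1)) (powVec k y)‖ ≤
      147 * lam ^ 2 * N * E := by
    calc _ ≤ (X ^ 2 : ℝ)⁻¹ * ∑ n ∈ Ioc N N', X ^ 2 * (3 * k ^ 2) * E := by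
          gcongr with n hn
          rw [mem_Ioc] at hn
          exact norm_bilinear_le hlam1 hN hn.1.le (by omega) hX1 hX2 htN hk1 hk2 hk3
      _ = ((N' - N : ℕ) : ℝ) * (3 * k ^ 2) * E := by
          rw [sum_const, nsmul_eq_mul, Nat.card_Ioc]
          field_simp
      _ ≤ N * (3 * (7 * lam) ^ 2) * E := by
          gcongr
          omega
      _ = _ := by ring
  rw [← hEe]
  refine hmain.trans ((add_le_add (add_le_add hA hB) hC).trans ?_)
  have h1 : lam ^ 2 ≤ Real.log t ^ 2 := by gcongr
  have h2 : 4 ≤ 16 * lam ^ 2 := by linarith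
  have h3 : 4 + 147 * lam ^ 2 ≤ 200 * Real.log t ^ 2 := by linarith
  have h4 : 0 < N * E := by positivity
  linarith [mul_le_mul_of_nonneg_right h3 h4.le]

noncomputable def zetaDefect (n : ℕ) (s : ℂ) : ℂ :=
  (s - 1) * (1 / ((n : ℂ) + 1) ^ s) + (((n : ℂ) + 1) ^ (1 - s) - (n : ℂ) ^ (1 - s))

theorem hasDerivAt_ofReal_cpow' (c : ℂ) {u : ℝ} (hu : 0 < u) :
    HasDerivAt (fun u : ℝ => (u : ℂ) ^ c) (c * (u : ℂ) ^ (c - 1)) u := by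
  have := (((hasDerivAt_id (u : ℂ)).cpow_const (c := c) (Or.inl (by simpa using hu))).comp_ofReal)
  simpa using this

theorem norm_cpow_neg_sub_le {n : ℕ} (hn : 1 ≤ n) {s : ℂ} (hs : 0 ≤ s.re) {u : ℝ} (hu1 : n ≤ u) (hu2 : u ≤ n + 1) :
    ‖((n : ℂ) + 1) ^ (-s) - (u : ℂ) ^ (-s)‖ ≤ ‖s‖ * (n : ℝ) ^ (-s.re - 1) := by
  have hn0 : (0 : ℝ) < n := by exact_mod_cast hn
  have h := Convex.norm_image_sub_le_of_norm_hasDerivWithin_le (f := fun u : ℝ => (u : ℂ) ^ (-s)) (f' := fun u : ℝ => -s * (u : ℂ) ^ (-s - 1))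
    (s := Set.Icc (n : ℝ) (n + 1)) (x := u) (y := n + 1) (C := ‖s‖ * (n : ℝ) ^ (-s.re - 1))
    (fun x hx => (hasDerivAt_ofReal_cpow' (-s) (hn0.trans_le hx.1)).hasDerivWithinAt) (fun x hx => by
      rw [norm_mul, norm_neg, Complex.norm_cpow_eq_rpow_re_of_pos (hn0.trans_le hx.1)]
      gcongr
      simp only [Complex.sub_re, Complex.neg_re, Complex.one_re]
      exact Real.rpow_le_rpow_of_nonpos hn0 hx.1 (by linarith)) (convex_Icc _ _) ⟨hu1, hu2⟩ ⟨by linarith, le_rfl⟩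
  push_cast at h
  refine h.trans ?_
  have h1 : ‖(n : ℝ) + 1 - u‖ ≤ 1 := by
    rw [Real.norm_eq_abs, abs_le]; constructor <;> linarith
  exact mul_le_of_le_one_right (by positivity) h1

theorem norm_zetaDefect_le {n : ℕ} (hn : 1 ≤ n) {s : ℂ} (hs : 0 ≤ s.re) :
    ‖zetaDefect n s‖ ≤ ‖s - 1‖ * ‖s‖ * (n : ℝ) ^ (-s.re - 1) := by
  have hn0 : (0 : ℝ) < n := by exact_mod_cast hn
  have h := Convex.norm_image_sub_le_of_norm_hasDerivWithin_le
    (f := fun u : ℝ => (u : ℂ) ^ (1 - s) + (s - 1) * ((n : ℂ) + 1) ^ (-s) * (u : ℂ))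
    (f' := fun u : ℝ => (1 - s) * (u : ℂ) ^ (1 - s - 1) + (s - 1) * ((n : ℂ) + 1) ^ (-s) * 1)
    (s := Set.Icc (n : ℝ) (n + 1)) (x := n) (y := n + 1) (C := ‖s - 1‖ * ‖s‖ * (n : ℝ) ^ (-s.re - 1))
    (fun x hx => ((hasDerivAt_ofReal_cpow' (1 - s) (hn0.trans_le hx.1)).add
      ((hasDerivAt_id (x : ℂ)).comp_ofReal.const_mul _)).hasDerivWithinAt) (fun x hx => by
      have : (1 - s) * (x : ℂ) ^ (1 - s - 1) + (s - 1) * ((n : ℂ) + 1) ^ (-s) * 1 = (s - 1) * (((n : ℂ) + 1) ^ (-s) - (x : ℂ) ^ (-s)) := by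
        rw [show (1 - s - 1) = -s by ring]; ring
      rw [this, norm_mul, mul_assoc]
      gcongr
      exact norm_cpow_neg_sub_le hn hs hx.1 hx.2) (convex_Icc _ _) ⟨le_rfl, by linarith⟩ ⟨by linarith, le_rfl⟩
  have h2 : (n : ℝ) + 1 - n = 1 := by ring
  rw [h2, norm_one, mul_one] at h
  refine le_trans (le_of_eq ?_) h
  congr 1
  rw [zetaDefect, one_div, ← Complex.cpow_neg]
  push_cast
  ring

noncomputable def tailWeight (n : ℕ) : ℝ := 4 * ((n : ℝ) ^ (-(1 / 2) : ℝ) - ((n + 1 : ℕ) : ℝ) ^ (-(1 / 2) : ℝ))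

theorem rpow_le_tailWeight {n : ℕ} (hn : 1 ≤ n) : (n : ℝ) ^ (-(3 / 2) : ℝ) ≤ tailWeight n := by
  have hn0 : (0 : ℝ) < n := by exact_mod_cast hn
  have hn1 : (1 : ℝ) ≤ n := by exact_mod_cast hn
  set a := Real.sqrt n with ha
  set b := Real.sqrt (n + 1 : ℕ) with hb
  have ha0 : 0 < a := Real.sqrt_pos.2 hn0
  have hb0 : 0 < b := Real.sqrt_pos.2 (by positivity)
  have ha2 : a ^ 2 = n := Real.sq_sqrt hn0.le
  have hb2 : b ^ 2 = n + 1 := by rw [hb, Real.sq_sqrt (by positivity)]; push_cast; ring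
  have e1 : (n : ℝ) ^ (-(1 / 2) : ℝ) = a⁻¹ := by rw [Real.rpow_neg hn0.le, ← Real.sqrt_eq_rpow]
  have e2 : ((n + 1 : ℕ) : ℝ) ^ (-(1 / 2) : ℝ) = b⁻¹ := by rw [Real.rpow_neg (by positivity), ← Real.sqrt_eq_rpow]
  have e3 : (n : ℝ) ^ (-(3 / 2) : ℝ) = (a * a ^ 2)⁻¹ := by
    rw [show (-(3 / 2) : ℝ) = -(1 / 2) - 1 by norm_num, Real.rpow_sub_one hn0.ne', e1, ha2, mul_inv]; rfl
  rw [tailWeight, e1, e2, e3]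
  have hab : a ≤ b := Real.sqrt_le_sqrt (by push_cast; linarith)
  have hba : b ≤ 3 / 2 * a := by
    refine le_of_sq_le_sq ?_ (by positivity)
    nlinarith
  have h1 : a⁻¹ - b⁻¹ = 1 / (a * b * (a + b)) := by
    field_simp
    nlinarith
  rw [h1, ← one_div, mul_one_div, div_le_div_iff₀ (by positivity) (by positivity)]
  have : b * (a + b) ≤ (3 / 2 * a) * (a + 3 / 2 * a) := by gcongr
  nlinarith [sq_nonneg a]

theorem hasSum_tailWeight (N : ℕ) : HasSum (fun n => tailWeight (n + N)) (4 * (N : ℝ) ^ (-(1 / 2) : ℝ)) ∨ N = 0 := by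
  rcases Nat.eq_zero_or_pos N with h | hN
  · exact Or.inr h
  left
  rw [hasSum_iff_tendsto_nat_of_nonneg (fun i => (by positivity : (0 : ℝ) ≤ ((i + N : ℕ) : ℝ) ^ (-(3 / 2) : ℝ)).trans (rpow_le_tailWeight (by omega)))]
  have h1 : ∀ n, ∑ i ∈ Finset.range n, tailWeight (i + N) = 4 * (N : ℝ) ^ (-(1 / 2) : ℝ) - 4 * ((n + N : ℕ) : ℝ) ^ (-(1 / 2) : ℝ) := by
    intro n
    have := Finset.sum_range_sub' (fun i => 4 * ((i + N : ℕ) : ℝ) ^ (-(1 / 2) : ℝ)) n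
    simp only [zero_add] at this
    rw [← this]
    refine sum_congr rfl fun i _ => ?_
    rw [tailWeight, mul_sub, show i + N + 1 = i + 1 + N by ring]
  simp only [h1]
  have h2 : Tendsto (fun n : ℕ => 4 * (N : ℝ) ^ (-(1 / 2) : ℝ) - 4 * ((n + N : ℕ) : ℝ) ^ (-(1 / 2) : ℝ)) atTop (nhds (4 * (N : ℝ) ^ (-(1 / 2) : ℝ) - 4 * 0)) := by
    refine Tendsto.const_sub _ (Tendsto.const_mul _ ?_)
    exact (tendsto_rpow_neg_atTop (by norm_num : (0 : ℝ) < 1 / 2)).comp (tendsto_natCast_atTop_atTop.comp (tendsto_add_atTop_nat N))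
  simpa using h2

theorem differentiable_zetaDefect {n : ℕ} (hn : 1 ≤ n) : Differentiable ℂ (zetaDefect n) := by
  have hn0 : (n : ℂ) ≠ 0 := by exact_mod_cast (by omega : n ≠ 0)
  have hn1 : (n : ℂ) + 1 ≠ 0 := by exact_mod_cast (by omega : n + 1 ≠ 0)
  have : zetaDefect n = fun s => (s - 1) * (((n : ℂ) + 1) ^ (-s)) + (((n : ℂ) + 1) ^ (1 - s) - (n : ℂ) ^ (1 - s)) := by
    ext s; rw [zetaDefect, one_div, Complex.cpow_neg]
  rw [this]
  intro s
  refine DifferentiableAt.add (DifferentiableAt.mul (by fun_prop) ?_) (DifferentiableAt.sub ?_ ?_)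
  · exact (by fun_prop : DifferentiableAt ℂ (fun s : ℂ => -s) s).const_cpow (Or.inl hn1)
  · exact (by fun_prop : DifferentiableAt ℂ (fun s : ℂ => 1 - s) s).const_cpow (Or.inl hn1)
  · exact (by fun_prop : DifferentiableAt ℂ (fun s : ℂ => 1 - s) s).const_cpow (Or.inl hn0)

theorem norm_zetaDefect_le_tailWeight {n : ℕ} (hn : 1 ≤ n) {s : ℂ} (hs : 1 / 2 ≤ s.re) :
    ‖zetaDefect n s‖ ≤ ‖s - 1‖ * ‖s‖ * tailWeight n := by
  refine (norm_zetaDefect_le hn (by linarith)).trans ?_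
  gcongr
  refine le_trans (Real.rpow_le_rpow_of_exponent_le (by exact_mod_cast hn) ?_) (rpow_le_tailWeight hn)
  linarith

theorem zeta1_eq_of_one_lt {N : ℕ} (hN : 1 ≤ N) {s : ℂ} (hs : 1 < s.re) :
    riemannZeta₁ s = (s - 1) * ∑ n ∈ Finset.range N, 1 / ((n : ℂ) + 1) ^ s + (N : ℂ) ^ (1 - s) + ∑' n : ℕ, zetaDefect (n + N) s := by
  have hs1 : s ≠ 1 := by rintro rfl; simp at hs
  have h1 : riemannZeta₁ s = (s - 1) * riemannZeta s := by
    rw [riemannZeta_eq_inv_sub_mul hs1, mul_inv_cancel_left₀ (sub_ne_zero.2 hs1)]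
  have hsum : Summable (fun n : ℕ => 1 / ((n : ℂ) + 1) ^ s) := by
    have := (summable_nat_add_iff 1).2 (Complex.summable_one_div_nat_cpow.2 hs)
    exact_mod_cast this
  rw [h1, zeta_eq_tsum_one_div_nat_add_one_cpow hs, ← hsum.sum_add_tsum_nat_add N]
  have hsumN : Summable (fun n : ℕ => 1 / (((n + N : ℕ) : ℂ) + 1) ^ s) := (summable_nat_add_iff N).2 hsum
  have hT := (hasSum_tailWeight N).resolve_right (by omega)
  have hd : Summable (fun n : ℕ => zetaDefect (n + N) s) :=
    Summable.of_norm_bounded (hT.summable.mul_left (‖s - 1‖ * ‖s‖)) fun n => norm_zetaDefect_le_tailWeight (by omega) (by linarith)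
  have hlim := hd.hasSum.tendsto_sum_nat
  have hpart : ∀ M : ℕ, ∑ i ∈ Finset.range M, zetaDefect (i + N) s =
      (s - 1) * ∑ i ∈ Finset.range M, 1 / (((i + N : ℕ) : ℂ) + 1) ^ s + (((M + N : ℕ) : ℂ) ^ (1 - s) - (N : ℂ) ^ (1 - s)) := by
    intro M
    have := Finset.sum_range_sub (fun i => ((i + N : ℕ) : ℂ) ^ (1 - s)) M
    simp only [zero_add] at this
    rw [← this, mul_sum, ← sum_add_distrib]
    refine sum_congr rfl fun i _ => ?_
    rw [zetaDefect]
    push_cast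
    ring_nf
  simp only [hpart] at hlim
  have hz : Tendsto (fun M : ℕ => ((M + N : ℕ) : ℂ) ^ (1 - s)) atTop (nhds 0) := by
    rw [tendsto_zero_iff_norm_tendsto_zero]
    have : (fun M : ℕ => ‖((M + N : ℕ) : ℂ) ^ (1 - s)‖) = fun M : ℕ => ((M + N : ℕ) : ℝ) ^ (-(s.re - 1)) := by
      ext M
      rw [Complex.norm_natCast_cpow_of_pos (by omega)]
      simp
    rw [this]
    exact (tendsto_rpow_neg_atTop (by linarith : 0 < s.re - 1)).comp (tendsto_natCast_atTop_atTop.comp (tendsto_add_atTop_nat N))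
  have hlim2 := (hsumN.hasSum.tendsto_sum_nat.const_mul (s - 1)).add (hz.sub_const ((N : ℂ) ^ (1 - s)))
  have := tendsto_nhds_unique hlim hlim2
  rw [this]
  push_cast
  ring

theorem zeta1_eq {N : ℕ} (hN : 1 ≤ N) {s : ℂ} (hs : 1 / 2 < s.re) :
    riemannZeta₁ s = (s - 1) * ∑ n ∈ Finset.range N, 1 / ((n : ℂ) + 1) ^ s + (N : ℂ) ^ (1 - s) + ∑' n : ℕ, zetaDefect (n + N) s := by
  set R := ‖s‖ + 3 with hR
  set U : Set ℂ := {z | 1 / 2 < z.re} ∩ Metric.ball 0 R with hU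
  have hUo : IsOpen U := (isOpen_lt continuous_const Complex.continuous_re).inter Metric.isOpen_ball
  have hUc : Convex ℝ U := (convex_halfSpace_re_gt _).inter (convex_ball _ _)
  have hT := (hasSum_tailWeight N).resolve_right (by omega)
  have hd : DifferentiableOn ℂ (fun w : ℂ => ∑' n : ℕ, zetaDefect (n + N) w) U := by
    refine Complex.differentiableOn_tsum_of_summable_norm (u := fun n => (R + 1) * R * tailWeight (n + N)) (hT.summable.mul_left _)
      (fun n => (differentiable_zetaDefect (by omega)).differentiableOn) hUo fun n w hw => ?_
    refine (norm_zetaDefect_le_tailWeight (by omega) hw.1.le).trans ?_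
    have h1 : ‖w‖ ≤ R := (mem_ball_zero_iff.1 hw.2).le
    have h0 : 0 ≤ tailWeight (n + N) := (by positivity : (0 : ℝ) ≤ ((n + N : ℕ) : ℝ) ^ (-(3 / 2) : ℝ)).trans (rpow_le_tailWeight (by omega))
    have h2 : ‖w - 1‖ ≤ R + 1 := by
      refine (norm_sub_le _ _).trans ?_
      simp; linarith
    gcongr
  have hN0 : (N : ℂ) ≠ 0 := by exact_mod_cast (by omega : N ≠ 0)
  have hfin : DifferentiableOn ℂ (fun w : ℂ => (w - 1) * ∑ n ∈ Finset.range N, 1 / ((n : ℂ) + 1) ^ w + (N : ℂ) ^ (1 - w)) U := by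
    intro w _
    refine DifferentiableAt.differentiableWithinAt ?_
    refine DifferentiableAt.add (DifferentiableAt.mul (by fun_prop) (DifferentiableAt.fun_sum fun n _ => ?_)) ?_
    · have hn1 : (n : ℂ) + 1 ≠ 0 := by exact_mod_cast (by omega : n + 1 ≠ 0)
      refine DifferentiableAt.div (by fun_prop) (differentiableAt_id.const_cpow (Or.inl hn1)) ?_
      rw [Complex.cpow_ne_zero_iff]; exact Or.inl hn1
    · exact (by fun_prop : DifferentiableAt ℂ (fun s : ℂ => 1 - s) w).const_cpow (Or.inl hN0)
  have hA1 : AnalyticOnNhd ℂ riemannZeta₁ U := differentiable_riemannZeta₁.differentiableOn.analyticOnNhd hUo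
  have hA2 := (hfin.add hd).analyticOnNhd hUo
  have h2U : (2 : ℂ) ∈ U := ⟨by simp; norm_num, by simp [hR]; linarith [norm_nonneg s]⟩
  have := hA1.eqOn_of_preconnected_of_eventuallyEq hA2 hUc.isPreconnected h2U (by
    have : {z : ℂ | 1 < z.re} ∈ nhds (2 : ℂ) := (isOpen_lt continuous_const Complex.continuous_re).mem_nhds (by simp)
    filter_upwards [this] with w hw
    exact zeta1_eq_of_one_lt hN hw)
  exact this ⟨hs, by simp [hR]⟩

theorem norm_zeta1_sub_le {N : ℕ} (hN : 1 ≤ N) {s : ℂ} (hs : 1 / 2 < s.re) :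
    ‖riemannZeta₁ s - ((s - 1) * ∑ n ∈ Finset.range N, 1 / ((n : ℂ) + 1) ^ s + (N : ℂ) ^ (1 - s))‖ ≤ 4 * ‖s - 1‖ * ‖s‖ * (N : ℝ) ^ (-(1 / 2) : ℝ) := by
  have hT := (hasSum_tailWeight N).resolve_right (by omega)
  rw [zeta1_eq hN hs, add_sub_cancel_left]
  refine (tsum_of_norm_bounded (hT.mul_left (‖s - 1‖ * ‖s‖)) fun n => norm_zetaDefect_le_tailWeight (by omega) hs.le).trans_eq ?_
  ring

theorem norm_sum_antitone_mul_le {a : ℕ → ℝ} (ha : Antitone a) (ha0 : ∀ n, 0 ≤ a n) (z : ℕ → ℂ) {B : ℝ} (n : ℕ)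
    (hB : ∀ j ≤ n, ‖∑ i ∈ Finset.range j, z i‖ ≤ B) :
    ‖∑ i ∈ Finset.range n, (a i : ℂ) * z i‖ ≤ a 0 * B := by
  have hB0 : 0 ≤ B := (norm_nonneg _).trans (hB 0 (Nat.zero_le _))
  have key : ∀ n : ℕ, ∑ i ∈ Finset.range n, (a i : ℂ) * z i = (a n : ℂ) * ∑ i ∈ Finset.range n, z i +
      ∑ i ∈ Finset.range n, ((a i - a (i + 1) : ℝ) : ℂ) * ∑ l ∈ Finset.range (i + 1), z l := by
    intro n
    induction n with
    | zero => simp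
    | succ n ih =>
      rw [sum_range_succ, ih, sum_range_succ (fun i => ((a i - a (i + 1) : ℝ) : ℂ) * _), sum_range_succ z]
      push_cast
      ring
  rw [key]
  calc _ ≤ a n * B + ∑ i ∈ Finset.range n, (a i - a (i + 1)) * B := by
        refine (norm_add_le _ _).trans (add_le_add ?_ ((norm_sum_le _ _).trans (sum_le_sum fun i hi => ?_)))
        · rw [norm_mul, Complex.norm_of_nonneg (ha0 n)]
          exact mul_le_mul_of_nonneg_left (hB n le_rfl) (ha0 n)
        · have h := sub_nonneg.2 (ha (Nat.le_succ i))
          rw [norm_mul, Complex.norm_of_nonneg h]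
          exact mul_le_mul_of_nonneg_left (hB _ (mem_range.1 hi)) h
    _ = a 0 * B := by
        rw [← sum_mul, sum_range_sub']
        ring

theorem cpow_neg_eq_twist {n : ℕ} (hn : 1 ≤ n) (σ t : ℝ) :
    1 / (n : ℂ) ^ ((σ : ℂ) + t * Complex.I) = ((n : ℝ) ^ (-σ) : ℝ) * twist t n := by
  have hn0 : (0 : ℝ) < n := by exact_mod_cast hn
  have hnc : (n : ℂ) ≠ 0 := by exact_mod_cast (by omega : n ≠ 0)
  rw [one_div, ← Complex.cpow_neg, neg_add, Complex.cpow_add _ _ hnc, Complex.ofReal_cpow hn0.le]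
  congr 1
  · push_cast; rfl
  · rw [twist, ec, Complex.cpow_def_of_ne_zero hnc, ← Complex.natCast_log]
    congr 1
    have : (2 * Real.pi * -(t * Real.log n / (2 * Real.pi)) : ℝ) = -(t * Real.log n) := by
      field_simp
    rw [this]
    push_cast
    ring

theorem sum_Ioc_eq_sum_range {M : Type*} [AddCommMonoid M] (f : ℕ → M) (a b : ℕ) :
    ∑ n ∈ Ioc a b, f n = ∑ i ∈ Finset.range (b - a), f (a + 1 + i) := by
  have : Ioc a b = Ico (a + 1) (b + 1) := by ext; simp
  rw [this, sum_Ico_eq_sum_range]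
  congr 2
  omega

theorem norm_sum_dyadic_le {T t σ : ℝ} (ht : 2 ≤ t) (htT : t ≤ T) (hσ : 0 ≤ σ) {N N' : ℕ} (hN : 1 ≤ N) (hNt : (N : ℝ) ≤ t ^ 2) (hNN' : N ≤ N') (hN2 : N' ≤ 2 * N) :
    ‖∑ n ∈ Ioc N N', 1 / (n : ℂ) ^ ((σ : ℂ) + t * Complex.I)‖ ≤
      200 * Real.log T ^ 2 * ((N : ℝ) ^ (1 - σ) * Real.exp (-(1 / 16000000 * Real.log N ^ 3 / Real.log T ^ 2))) := by
  have hN0 : (0 : ℝ) < N := by exact_mod_cast hN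
  have hlt : 0 < Real.log t := Real.log_pos (by linarith)
  have hlT : Real.log t ≤ Real.log T := Real.log_le_log (by linarith) htT
  have hL0 : 0 ≤ Real.log N := Real.log_nonneg (by exact_mod_cast hN)
  set B := 200 * Real.log T ^ 2 * N * Real.exp (-(1 / 16000000 * Real.log N ^ 3 / Real.log T ^ 2)) with hB
  have h1 : ∀ N'', N ≤ N'' → N'' ≤ 2 * N → ‖∑ n ∈ Ioc N N'', twist t n‖ ≤ B := by
    intro N'' h1 h2
    refine (norm_sum_twist_le_exp ht hN hNt h1 h2).trans ?_
    rw [hB]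
    gcongr
  have h2 := norm_sum_antitone_mul_le (a := fun i => ((N + 1 + i : ℕ) : ℝ) ^ (-σ)) (fun i j hij => by
      refine Real.rpow_le_rpow_of_nonpos (by positivity) ?_ (by linarith)
      exact_mod_cast (by omega : N + 1 + i ≤ N + 1 + j)) (fun n => by positivity) (fun i => twist t ((N + 1 + i : ℕ) : ℝ)) (B := B) (N' - N) (fun j hj => by
      have := h1 (N + j) (by omega) (by omega)
      rwa [sum_Ioc_eq_sum_range, Nat.add_sub_cancel_left] at this)
  have h3 : ∑ n ∈ Ioc N N', 1 / (n : ℂ) ^ ((σ : ℂ) + t * Complex.I) = ∑ i ∈ Finset.range (N' - N), ((((N + 1 + i : ℕ) : ℝ) ^ (-σ) : ℝ) : ℂ) * twist t ((N + 1 + i : ℕ) : ℝ) := by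
    rw [sum_Ioc_eq_sum_range]
    exact sum_congr rfl fun i _ => cpow_neg_eq_twist (by omega) σ t
  rw [h3]
  refine h2.trans ?_
  have h4 : ((N + 1 + 0 : ℕ) : ℝ) ^ (-σ) ≤ (N : ℝ) ^ (-σ) :=
    Real.rpow_le_rpow_of_nonpos hN0 (by push_cast; linarith) (by linarith)
  have hB0 : 0 ≤ B := by positivity
  calc _ ≤ (N : ℝ) ^ (-σ) * B := by gcongr
    _ = 200 * Real.log T ^ 2 * ((N : ℝ) * (N : ℝ) ^ (-σ) * Real.exp (-(1 / 16000000 * Real.log N ^ 3 / Real.log T ^ 2))) := by rw [hB]; ring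
    _ = _ := by
      rw [show (1 - σ) = 1 + -σ by ring, Real.rpow_add hN0, Real.rpow_one]

theorem block_saving {L l v : ℝ} (hL : 0 < L) (hl : 0 ≤ l) (hv : 0 ≤ v) :
    v ^ 2 * l - 1 / 16000000 * l ^ 3 / L ^ 2 ≤ 4000 * (v ^ 3 * L) := by
  rcases le_total l (4000 * v * L) with h | h
  · have h1 : v ^ 2 * l ≤ v ^ 2 * (4000 * v * L) := by gcongr
    have h2 : 0 ≤ 1 / 16000000 * l ^ 3 / L ^ 2 := by positivity
    linarith
  · have h1 : v ^ 2 * l ≤ 1 / 16000000 * l ^ 3 / L ^ 2 := by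
      rw [le_div_iff₀ (by positivity)]
      have : (4000 * v * L) ^ 2 ≤ l ^ 2 := by gcongr
      nlinarith
    have : 0 ≤ 4000 * (v ^ 3 * L) := by positivity
    linarith

theorem norm_sum_Ioc_le_of_dyadic {f : ℕ → ℂ} {B : ℝ} (hB0 : 0 ≤ B) (h1 : ‖f 1‖ ≤ 1) (K : ℕ)
    (hB : ∀ N N', 1 ≤ N → N ≤ N' → N' ≤ 2 * N → N' ≤ K → ‖∑ n ∈ Ioc N N', f n‖ ≤ B) (j : ℕ) :
    ∀ N ≤ K, N ≤ 2 ^ j → ‖∑ n ∈ Ioc 0 N, f n‖ ≤ 1 + j * B := by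
  induction j with
  | zero =>
    intro N _ hN
    interval_cases N
    · simp
    · simpa using h1
  | succ j ih =>
    intro N hK hN
    rcases le_total N (2 ^ j) with h | h
    · refine (ih N hK h).trans ?_
      push_cast
      nlinarith
    · have e : ∑ n ∈ Ioc 0 N, f n = ∑ n ∈ Ioc 0 (2 ^ j), f n + ∑ n ∈ Ioc (2 ^ j) N, f n := by
        rw [sum_Ioc_consecutive _ (Nat.zero_le _) h]
      rw [e]
      refine (norm_add_le _ _).trans ((add_le_add (ih _ (h.trans hK) le_rfl) (hB _ _ Nat.one_le_two_pow h (by rw [pow_succ] at hN; omega) hK)).trans_eq ?_)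
      push_cast; ring

theorem norm_zeta_le_aux {T t σ : ℝ} (hT : 3 ≤ Real.log T) (ht : 2 ≤ t) (htT : t ≤ T) (hσ : 1 / 2 < σ) (hσ3 : σ ≤ 3)
    (hσ1 : 1 - (Real.log (Real.log T) / Real.log T) ^ (2 / 3 : ℝ) ≤ σ) :
    ‖riemannZeta (σ + t * Complex.I)‖ ≤ Real.log T ^ 4010 := by
  set L := Real.log T with hL
  set l := Real.log L with hl
  have hL0 : 0 < L := by linarith
  have hl0 : 0 ≤ l := Real.log_nonneg (by linarith)
  set v := (l / L) ^ (1 / 3 : ℝ) with hv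
  have hv0 : 0 ≤ v := by positivity
  have hv2 : (l / L) ^ (2 / 3 : ℝ) = v ^ 2 := by
    rw [hv, ← Real.rpow_natCast _ 2, ← Real.rpow_mul (by positivity)]; norm_num
  have hv3 : v ^ 3 * L = l := by
    have : v ^ 3 = l / L := by
      rw [hv, ← Real.rpow_natCast _ 3, ← Real.rpow_mul (by positivity)]; norm_num
    rw [this, div_mul_cancel₀ _ hL0.ne']
  rw [hv2] at hσ1
  set s : ℂ := σ + t * Complex.I with hs
  have hsre : s.re = σ := by simp [hs]
  have hsim : s.im = t := by simp [hs]
  set K := ⌊t ^ 2⌋₊ with hK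
  have hKt : (K : ℝ) ≤ t ^ 2 := Nat.floor_le (by positivity)
  have hKt2 : t ^ 2 < K + 1 := Nat.lt_floor_add_one _
  have hK1 : 1 ≤ K := by
    have : (0 : ℝ) < K := by nlinarith
    exact_mod_cast this
  have hK0 : (0 : ℝ) < K := by exact_mod_cast hK1
  set B := 200 * L ^ 2 * L ^ 4000 with hB
  have hblock : ∀ N N', 1 ≤ N → N ≤ N' → N' ≤ 2 * N → N' ≤ K → ‖∑ n ∈ Ioc N N', 1 / (n : ℂ) ^ s‖ ≤ B := by
    intro N N' h1 h2 h3 h4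
    have hN1 : (1 : ℝ) ≤ N := by exact_mod_cast h1
    have hN0 : (0 : ℝ) < N := by linarith
    have hNt : (N : ℝ) ≤ t ^ 2 := le_trans (by exact_mod_cast h2.trans h4) hKt
    refine (norm_sum_dyadic_le ht htT (by linarith) h1 hNt h2 h3).trans ?_
    rw [hB, ← hL]
    gcongr
    calc (N : ℝ) ^ (1 - σ) * Real.exp (-(1 / 16000000 * Real.log N ^ 3 / L ^ 2)) ≤
          (N : ℝ) ^ (v ^ 2) * Real.exp (-(1 / 16000000 * Real.log N ^ 3 / L ^ 2)) := by
          gcongr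
          linarith
      _ = Real.exp (v ^ 2 * Real.log N - 1 / 16000000 * Real.log N ^ 3 / L ^ 2) := by
          rw [Real.rpow_def_of_pos hN0, ← Real.exp_add]; congr 1; ring
      _ ≤ Real.exp (4000 * l) := by
          refine Real.exp_le_exp.2 ((block_saving hL0 (Real.log_nonneg hN1) hv0).trans_eq ?_)
          rw [hv3]
      _ = L ^ 4000 := by
          rw [show (4000 : ℝ) * l = ((4000 : ℕ) : ℝ) * l by norm_num, Real.exp_nat_mul, hl, Real.exp_log hL0]
  have hB0 : 0 ≤ B := by positivity
  have hlt0 : 0 < Real.log t := Real.log_pos (by linarith)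
  have hltL : Real.log t ≤ L := Real.log_le_log (by linarith) htT
  set j := ⌈4 * Real.log t⌉₊ with hj
  have hj1 : 4 * Real.log t ≤ j := Nat.le_ceil _
  have hj2 : (j : ℝ) ≤ 5 * L := by
    have := Nat.ceil_lt_add_one (show 0 ≤ 4 * Real.log t by linarith)
    linarith
  have hKj : K ≤ 2 ^ j := by
    have : (K : ℝ) ≤ 2 ^ j := by
      rw [← Real.log_le_log_iff hK0 (by positivity), Real.log_pow]
      have h1 := Real.log_le_log hK0 hKt
      rw [Real.log_pow] at h1
      push_cast at h1
      nlinarith [Real.log_two_gt_d9]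
    exact_mod_cast this
  have hsum := norm_sum_Ioc_le_of_dyadic (f := fun n => 1 / (n : ℂ) ^ s) hB0 (by simp) K hblock j K le_rfl hKj
  have hs1 : s - 1 ≠ 0 := by
    intro h
    have := congrArg Complex.im h
    simp [hsim] at this
    linarith
  have hs1t : t ≤ ‖s - 1‖ := by
    have := Complex.abs_im_le_norm (s - 1)
    simp only [Complex.sub_im, Complex.one_im, hsim, sub_zero] at this
    exact (le_abs_self t).trans this
  have hst : ‖s‖ ≤ 3 * t := by
    have := Complex.norm_le_abs_re_add_abs_im s
    rw [hsre, hsim, abs_of_nonneg (by linarith), abs_of_nonneg (by linarith)] at this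
    linarith
  have happ := norm_zeta1_sub_le hK1 (s := s) (by rw [hsre]; exact hσ)
  have hrange : ∑ n ∈ Finset.range K, 1 / ((n : ℂ) + 1) ^ s = ∑ n ∈ Ioc 0 K, 1 / (n : ℂ) ^ s := by
    rw [sum_Ioc_eq_sum_range]
    refine sum_congr (by simp) fun n _ => ?_
    push_cast
    ring_nf
  rw [hrange] at happ
  set S := ∑ n ∈ Ioc 0 K, 1 / (n : ℂ) ^ s with hS
  have hz : riemannZeta s = (s - 1)⁻¹ * riemannZeta₁ s := riemannZeta_eq_inv_sub_mul (sub_ne_zero.1 hs1)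
  have hdecomp : riemannZeta s = (s - 1)⁻¹ * (riemannZeta₁ s - ((s - 1) * S + (K : ℂ) ^ (1 - s))) + S + (s - 1)⁻¹ * (K : ℂ) ^ (1 - s) := by
    rw [hz]; field_simp; ring
  have hp0 : 0 < ‖s - 1‖ := norm_pos_iff.2 hs1
  have hKs : (K : ℝ) ^ (1 / 2 : ℝ) ≤ t := by
    rw [← Real.sqrt_eq_rpow, Real.sqrt_le_left (by linarith)]; exact hKt
  have hKs2 : t ≤ 2 * (K : ℝ) ^ (1 / 2 : ℝ) := by
    rw [← Real.sqrt_eq_rpow]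
    refine le_of_sq_le_sq ?_ (by positivity)
    rw [mul_pow, Real.sq_sqrt hK0.le]
    nlinarith [show (1 : ℝ) ≤ K by exact_mod_cast hK1]
  have e1 : ‖(s - 1)⁻¹ * (riemannZeta₁ s - ((s - 1) * S + (K : ℂ) ^ (1 - s)))‖ ≤ 24 := by
    rw [norm_mul, norm_inv]
    calc _ ≤ ‖s - 1‖⁻¹ * (4 * ‖s - 1‖ * ‖s‖ * (K : ℝ) ^ (-(1 / 2) : ℝ)) := by gcongr
      _ = 4 * ‖s‖ * (K : ℝ) ^ (-(1 / 2) : ℝ) := by field_simp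
      _ ≤ 4 * (3 * t) * (K : ℝ) ^ (-(1 / 2) : ℝ) := by gcongr
      _ ≤ 24 := by
        rw [Real.rpow_neg hK0.le, ← div_eq_mul_inv, div_le_iff₀ (by positivity)]
        linarith
  have e2 : ‖(s - 1)⁻¹ * (K : ℂ) ^ (1 - s)‖ ≤ 1 := by
    rw [norm_mul, norm_inv, Complex.norm_natCast_cpow_of_pos hK1, ← div_eq_inv_mul, div_le_one hp0]
    refine le_trans ?_ (hKs.trans hs1t)
    refine Real.rpow_le_rpow_of_exponent_le (by exact_mod_cast hK1) ?_
    simp only [Complex.sub_re, Complex.one_re, hsre]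
    linarith
  have e3 : ‖S‖ ≤ 1 + 5 * L * B := hsum.trans (by gcongr)
  rw [hdecomp]
  have h3 : ‖(s - 1)⁻¹ * (riemannZeta₁ s - ((s - 1) * S + (K : ℂ) ^ (1 - s))) + S + (s - 1)⁻¹ * (K : ℂ) ^ (1 - s)‖ ≤ 26 + 5 * L * B := by
    refine (norm_add_le _ _).trans ((add_le_add (norm_add_le _ _) le_rfl).trans ?_)
    linarith
  refine h3.trans ?_
  have h4 : (1 : ℝ) ≤ L ^ 4003 := one_le_pow₀ (by linarith)
  calc 26 + 5 * L * B = 26 + 1000 * L ^ 4003 := by rw [hB]; ring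
    _ ≤ 3 ^ 7 * L ^ 4003 := by norm_num; linarith
    _ ≤ L ^ 7 * L ^ 4003 := by gcongr
    _ = L ^ 4010 := by rw [← pow_add]

/-- Vinogradov–Korobov bound for `ζ` to the left of the line `Re s = 1`. -/
theorem norm_zeta_le {T : ℝ} {s : ℂ} (hT : 3 ≤ Real.log T) (hs1 : 2 ≤ |s.im|) (hsT : |s.im| ≤ T) (hσ : 1 / 2 < s.re) (hσ3 : s.re ≤ 3)
    (hσ1 : 1 - (Real.log (Real.log T) / Real.log T) ^ (2 / 3 : ℝ) ≤ s.re) :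
    ‖riemannZeta s‖ ≤ Real.log T ^ 4010 := by
  have h := norm_zeta_le_aux hT hs1 hsT hσ hσ3 hσ1
  rcases abs_cases s.im with ⟨h1, _⟩ | ⟨h1, _⟩
  · rw [h1, Complex.re_add_im] at h
    exact h
  · rw [h1] at h
    have : ((s.re : ℂ) + ((-s.im : ℝ) : ℂ) * Complex.I) = (starRingEnd ℂ) s := by
      apply Complex.ext <;> simp
    rw [this, riemannZeta_conj, Complex.norm_conj] at h
    exact h

open Metric in
theorem exists_eq_mul_exp_on_ball {f : ℂ → ℂ} (hf : Differentiable ℂ f) {c : ℂ} {R : ℝ} (hR : 0 < R)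
    (h0 : ∀ z ∈ ball c R, f z ≠ 0) :
    ∃ F : ℂ → ℂ, F c = 0 ∧ (∀ z ∈ ball c R, HasDerivAt F (deriv f z / f z) z) ∧
      ∀ z ∈ ball c R, f z = f c * Complex.exp (F z) := by
  have hd : DifferentiableOn ℂ (fun z => deriv f z / f z) (ball c R) := fun z hz =>
    ((hf.deriv z).div (hf z) (h0 z hz)).differentiableWithinAt
  obtain ⟨F, hFc, hF⟩ := hd.isExactOn_ball.with_val_at c 0
  have hcb : c ∈ ball c R := mem_ball_self hR
  refine ⟨F, hFc, hF, fun z hz => ?_⟩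
  have hder : ∀ z ∈ ball c R, HasDerivAt (fun z => f z * Complex.exp (-F z)) 0 z := by
    intro z hz
    refine ((hf z).hasDerivAt.mul (hF z hz).neg.cexp).congr_deriv ?_
    field_simp [h0 z hz]
    ring
  have hconst := isOpen_ball.is_const_of_deriv_eq_zero (convex_ball c R).isPreconnected
    (fun z hz => (hder z hz).differentiableAt.differentiableWithinAt) (fun z hz => (hder z hz).deriv) hz hcb
  simp only [hFc, neg_zero, Complex.exp_zero, mul_one] at hconst
  rw [← hconst, mul_assoc, ← Complex.exp_add, neg_add_cancel, Complex.exp_zero, mul_one]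

open Metric in
theorem norm_log_le_of_no_zeros {f F : ℂ → ℂ} {c : ℂ} {R M : ℝ} (hM : 0 < M) (hR : 0 < R) (hfc : f c ≠ 0)
    (hFc : F c = 0) (hF : DifferentiableOn ℂ F (ball c R)) (hfF : ∀ z ∈ ball c R, f z = f c * Complex.exp (F z))
    (hfM : ∀ z ∈ ball c R, ‖f z‖ ≤ Real.exp M * ‖f c‖) {z : ℂ} (hz : z ∈ ball c R) :
    ‖F z‖ ≤ 2 * M * ‖z - c‖ / (R - ‖z - c‖) := by
  have hmap : ∀ w ∈ ball (0 : ℂ) R, w + c ∈ ball c R := fun w hw => by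
    rw [mem_ball_zero_iff] at hw
    rwa [mem_ball, dist_eq_norm, add_sub_cancel_right]
  have h := Complex.borelCaratheodory_zero (f := fun w => F (w + c)) (z := z - c) hM
    (hF.comp (differentiable_id.add_const c).differentiableOn hmap) (fun w hw => ?_) hR
    (by rwa [mem_ball_zero_iff, ← dist_eq_norm]) (by simp [hFc])
  · simpa using h
  · have h1 := hfM _ (hmap w hw)
    rw [hfF _ (hmap w hw), norm_mul, Complex.norm_exp, mul_comm] at h1
    exact Real.exp_le_exp.1 (le_of_mul_le_mul_right h1 (norm_pos_iff.2 hfc))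

open Metric in
theorem norm_logDeriv_le_of_no_zeros {f : ℂ → ℂ} (hf : Differentiable ℂ f) {c : ℂ} {R M : ℝ} (hM : 0 < M) (hR : 0 < R)
    (h0 : ∀ z ∈ ball c R, f z ≠ 0) (hfM : ∀ z ∈ ball c R, ‖f z‖ ≤ Real.exp M * ‖f c‖) :
    ‖deriv f c / f c‖ ≤ 4 * M / R := by
  obtain ⟨F, hFc, hF, hfF⟩ := exists_eq_mul_exp_on_ball hf hR h0
  have hcb : c ∈ ball c R := mem_ball_self hR
  have hFd : DifferentiableOn ℂ F (ball c R) := fun z hz => (hF z hz).differentiableAt.differentiableWithinAt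
  have hsub : closedBall c (R / 2) ⊆ ball c R := closedBall_subset_ball (by linarith)
  have h := Complex.norm_deriv_le_of_forall_mem_sphere_norm_le (f := F) (c := c) (R := R / 2) (C := 2 * M) (by linarith)
    ((hFd.mono (by rw [closure_ball _ (by positivity)]; exact hsub)).diffContOnCl) (fun z hz => ?_)
  · rw [(hF c hcb).deriv] at h
    refine h.trans_eq ?_
    field_simp; ring
  · have h1 := norm_log_le_of_no_zeros hM hR (h0 c hcb) hFc hFd hfF hfM (hsub (sphere_subset_closedBall hz))
    rw [mem_sphere_iff_norm.1 hz] at h1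
    refine h1.trans_eq ?_
    field_simp; ring

open Metric in
theorem norm_le_of_sphere {f : ℂ → ℂ} (hf : Differentiable ℂ f) {c : ℂ} {r B : ℝ} (hr : 0 < r)
    (hB : ∀ z ∈ sphere c r, ‖f z‖ ≤ B) {z : ℂ} (hz : z ∈ closedBall c r) : ‖f z‖ ≤ B := by
  refine Complex.norm_le_of_forall_mem_frontier_norm_le (U := ball c r) isBounded_ball hf.diffContOnCl ?_ ?_
  · rw [frontier_ball c hr.ne']; exact hB
  · rwa [closure_ball c hr.ne']

open Metric in
theorem exists_div_zero {f : ℂ → ℂ} (hf : Differentiable ℂ f) {c ρ : ℂ} {r M : ℝ} (hfc : f c ≠ 0)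
    (hfM : ∀ z ∈ sphere c r, ‖f z‖ ≤ Real.exp M * ‖f c‖) (hρ : ρ ∈ closedBall c (r / 3)) (hfρ : f ρ = 0) :
    ∃ g : ℂ → ℂ, Differentiable ℂ g ∧ g c ≠ 0 ∧ (∀ z ∈ sphere c r, ‖g z‖ ≤ Real.exp (M - Real.log 2) * ‖g c‖) ∧
      (∀ z, g z = 0 → z = ρ ∨ f z = 0) ∧ deriv f c / f c = deriv g c / g c + 1 / (c - ρ) := by
  have hcρ : c - ρ ≠ 0 := fun h => hfc (by rw [sub_eq_zero.1 h, hfρ])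
  have hd : Differentiable ℂ (dslope f ρ) := by
    rw [← differentiableOn_univ, Complex.differentiableOn_dslope univ_mem]
    exact hf.differentiableOn
  have hds : ∀ z, dslope f ρ z * (z - ρ) = f z := by
    intro z
    have := sub_smul_dslope f ρ z
    rw [hfρ, sub_zero, smul_eq_mul] at this
    rw [← this, mul_comm]
  have hgc : dslope f ρ c * (c - ρ) = f c := hds c
  refine ⟨fun z => dslope f ρ z * (c - ρ), hd.mul_const _, by simpa only [hgc], fun z hz => ?_, fun z hz => ?_, ?_⟩
  · have h1 : ‖c - ρ‖ ≤ r / 3 := by rw [← dist_eq_norm, dist_comm]; exact hρ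
    have h2 : ‖z - c‖ = r := mem_sphere_iff_norm.1 hz
    have h3 : 2 * (r / 3) ≤ ‖z - ρ‖ := by
      have := norm_sub_norm_le (z - c) (ρ - c)
      rw [norm_sub_rev ρ c, h2, sub_sub_sub_cancel_right] at this
      linarith
    have h4 : ‖f z‖ ≤ Real.exp M * ‖f c‖ := hfM z hz
    rw [← hds z, norm_mul] at h4
    simp only [hgc, norm_mul]
    rw [Real.exp_sub, Real.exp_log two_pos]
    have h5 : ‖dslope f ρ z‖ * (2 * ‖c - ρ‖) ≤ ‖dslope f ρ z‖ * ‖z - ρ‖ := by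
      gcongr; linarith
    rw [div_mul_eq_mul_div, le_div_iff₀ two_pos]
    linarith
  · rcases mul_eq_zero.1 hz with h | h
    · right; rw [← hds z, h, zero_mul]
    · exact absurd h hcρ
  · have e : f = fun z => dslope f ρ z * (z - ρ) := funext fun z => (hds z).symm
    have h1 : HasDerivAt (fun z => dslope f ρ z * (z - ρ)) (deriv (dslope f ρ) c * (c - ρ) + dslope f ρ c * 1) c :=
      (hd c).hasDerivAt.mul ((hasDerivAt_id c).sub_const ρ)
    rw [← e] at h1
    have h2 : HasDerivAt (fun z => dslope f ρ z * (c - ρ)) (deriv (dslope f ρ) c * (c - ρ)) c := (hd c).hasDerivAt.mul_const _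
    rw [h1.deriv, h2.deriv]
    simp only [hgc]
    have : dslope f ρ c = f c / (c - ρ) := by rw [eq_div_iff hcρ, hgc]
    rw [this]
    field_simp

open Metric in
theorem landau_aux (n : ℕ) : ∀ {f : ℂ → ℂ} (_ : Differentiable ℂ f) {c : ℂ} {r M : ℝ} (_ : 0 < r) (_ : f c ≠ 0)
    (_ : ∀ z ∈ sphere c r, ‖f z‖ ≤ Real.exp M * ‖f c‖)
    (_ : ∀ ρ ∈ closedBall c (r / 3), f ρ = 0 → ρ.re ≤ c.re) (_ : M < n * Real.log 2),
    -(12 * M / r) ≤ (deriv f c / f c).re := by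
  induction n with
  | zero =>
    intro f hf c r M hr hfc hfM hz hMn
    exfalso
    have h1 := norm_le_of_sphere hf hr hfM (mem_closedBall_self hr.le)
    have h2 : Real.exp M < 1 := Real.exp_zero ▸ Real.exp_lt_exp.2 (by simpa using hMn)
    have h3 := norm_pos_iff.2 hfc
    nlinarith
  | succ n ih =>
    intro f hf c r M hr hfc hfM hz hMn
    by_cases h0 : ∀ z ∈ ball c (r / 3), f z ≠ 0
    · have hM0 : 0 ≤ M := by
        by_contra! hneg
        have h1 := norm_le_of_sphere hf hr hfM (mem_closedBall_self hr.le)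
        have h2 : Real.exp M < 1 := Real.exp_zero ▸ Real.exp_lt_exp.2 hneg
        have h3 := norm_pos_iff.2 hfc
        nlinarith
      have key : ∀ M' > M, -(12 * M' / r) ≤ (deriv f c / f c).re := by
        intro M' hM'
        have h := norm_logDeriv_le_of_no_zeros hf (c := c) (R := r / 3) (M := M') (by linarith) (by positivity) h0 (fun z hz => by
          refine (norm_le_of_sphere hf hr hfM (closedBall_subset_closedBall (by linarith) (ball_subset_closedBall hz))).trans ?_
          gcongr)
        have h2 := (abs_le.1 (Complex.abs_re_le_norm (deriv f c / f c))).1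
        have : 4 * M' / (r / 3) = 12 * M' / r := by field_simp; ring
        linarith
      refine le_of_forall_pos_le_add fun ε hε => ?_
      have := key (M + ε * r / 12) (by linarith [show 0 < ε * r / 12 by positivity])
      have e : 12 * (M + ε * r / 12) / r = 12 * M / r + ε := by field_simp
      linarith
    · push Not at h0
      obtain ⟨ρ, hρ, hfρ⟩ := h0
      have hρ' := ball_subset_closedBall hρ
      obtain ⟨g, hg, hgc, hgM, hgz, hgd⟩ := exists_div_zero hf hfc hfM hρ' hfρ
      have h1 := ih hg hr hgc hgM (fun z hzz hgz0 => (hgz z hgz0).elim (fun h => h ▸ hz ρ hρ' hfρ) (hz z hzz))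
        (by push_cast at hMn; linarith)
      have h2 : 0 ≤ (1 / (c - ρ)).re := by
        rw [one_div, Complex.inv_re]
        exact div_nonneg (by simpa using hz ρ hρ' hfρ) (Complex.normSq_nonneg _)
      rw [hgd, Complex.add_re]
      have h3 : 12 * (M - Real.log 2) / r ≤ 12 * M / r := by
        gcongr
        linarith [Real.log_pos one_lt_two]
      linarith

open Metric in
theorem landau_re_logDeriv_ge {f : ℂ → ℂ} (hf : Differentiable ℂ f) {c : ℂ} {r M : ℝ} (hr : 0 < r) (hfc : f c ≠ 0)
    (hfM : ∀ z ∈ sphere c r, ‖f z‖ ≤ Real.exp M * ‖f c‖)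
    (hz : ∀ ρ ∈ closedBall c (r / 3), f ρ = 0 → ρ.re ≤ c.re) :
    -(12 * M / r) ≤ (deriv f c / f c).re := by
  obtain ⟨n, hn⟩ := exists_nat_gt (M / Real.log 2)
  exact landau_aux n hf hr hfc hfM hz ((div_lt_iff₀ (Real.log_pos one_lt_two)).1 hn)

open Metric in
theorem landau_re_logDeriv_ge_of_zero {f : ℂ → ℂ} (hf : Differentiable ℂ f) {c ρ : ℂ} {r M : ℝ} (hr : 0 < r) (hfc : f c ≠ 0)
    (hfM : ∀ z ∈ sphere c r, ‖f z‖ ≤ Real.exp M * ‖f c‖)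
    (hz : ∀ ρ ∈ closedBall c (r / 3), f ρ = 0 → ρ.re ≤ c.re) (hρ : ρ ∈ closedBall c (r / 3)) (hfρ : f ρ = 0) :
    -(12 * M / r) + (1 / (c - ρ)).re ≤ (deriv f c / f c).re := by
  obtain ⟨g, hg, hgc, hgM, hgz, hgd⟩ := exists_div_zero hf hfc hfM hρ hfρ
  have h1 := landau_re_logDeriv_ge hg hr hgc hgM (fun z hzz hgz0 => (hgz z hgz0).elim (fun h => h ▸ hz ρ hρ hfρ) (hz z hzz))
  rw [hgd, Complex.add_re]
  have h3 : 12 * (M - Real.log 2) / r ≤ 12 * M / r := by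
    gcongr
    linarith [Real.log_pos one_lt_two]
  linarith

theorem re_comb_nonneg {z : ℂ} (hz : ‖z‖ = 1) : 0 ≤ 3 + 4 * z.re + (z ^ 2).re := by
  have h : z.re ^ 2 + z.im ^ 2 = 1 := by
    have := Complex.sq_norm z
    rw [hz, Complex.normSq_apply] at this
    linarith
  rw [sq, Complex.mul_re]
  nlinarith [sq_nonneg (1 + z.re)]

theorem term_vonMangoldt_re (σ γ : ℝ) (n : ℕ) :
    LSeries.term (fun n => (ArithmeticFunction.vonMangoldt n : ℂ)) ((σ : ℂ) + γ * Complex.I) n =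
      ((ArithmeticFunction.vonMangoldt n * (n : ℝ) ^ (-σ) : ℝ) : ℂ) * twist γ n := by
  rcases Nat.eq_zero_or_pos n with rfl | hn
  · simp
  · rw [LSeries.term_of_ne_zero hn.ne', div_eq_mul_one_div, cpow_neg_eq_twist hn]
    push_cast
    ring

theorem norm_twist (t u : ℝ) : ‖twist t u‖ = 1 := by
  rw [twist, ec, Complex.norm_exp_ofReal_mul_I]

theorem twist_two_mul (t u : ℝ) : twist (2 * t) u = twist t u ^ 2 := by
  rw [twist, twist, ec, ec, ← Complex.exp_nat_mul]
  congr 1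
  push_cast
  ring

theorem twist_zero (u : ℝ) : twist 0 u = 1 := by
  simp [twist, ec]

theorem neg_logDeriv_zeta_hasSum {σ : ℝ} (hσ : 1 < σ) (γ : ℝ) :
    HasSum (fun n : ℕ => ArithmeticFunction.vonMangoldt n * (n : ℝ) ^ (-σ) * (twist γ n).re)
      (-(deriv riemannZeta (σ + γ * Complex.I) / riemannZeta (σ + γ * Complex.I)).re) := by
  have hs : 1 < ((σ : ℂ) + γ * Complex.I).re := by simpa using hσ
  have h1 := (ArithmeticFunction.LSeriesSummable_vonMangoldt hs).hasSum
  have h2 := ArithmeticFunction.LSeries_vonMangoldt_eq_deriv_riemannZeta_div hs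
  rw [LSeries] at h2
  rw [h2] at h1
  have h3 := Complex.hasSum_re h1
  rw [neg_div, Complex.neg_re] at h3
  refine h3.congr_fun fun n => ?_
  rw [term_vonMangoldt_re, Complex.re_ofReal_mul]

theorem three_four_one {σ : ℝ} (hσ : 1 < σ) (γ : ℝ) :
    0 ≤ 3 * -(deriv riemannZeta σ / riemannZeta σ).re +
      4 * -(deriv riemannZeta (σ + γ * Complex.I) / riemannZeta (σ + γ * Complex.I)).re +
      -(deriv riemannZeta (σ + (2 * γ : ℝ) * Complex.I) / riemannZeta (σ + (2 * γ : ℝ) * Complex.I)).re := by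
  have h0 := neg_logDeriv_zeta_hasSum hσ 0
  simp only [Complex.ofReal_zero, zero_mul, add_zero] at h0
  refine (((h0.mul_left 3).add ((neg_logDeriv_zeta_hasSum hσ γ).mul_left 4)).add (neg_logDeriv_zeta_hasSum hσ (2 * γ))).nonneg
    fun n => ?_
  rw [twist_two_mul, twist_zero]
  have h1 := re_comb_nonneg (norm_twist γ n)
  have h2 : 0 ≤ ArithmeticFunction.vonMangoldt n * (n : ℝ) ^ (-σ) :=
    mul_nonneg ArithmeticFunction.vonMangoldt_nonneg (by positivity)
  have := mul_nonneg h2 h1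
  simp only [Complex.one_re]
  linarith

theorem riemannZeta₁_eq {s : ℂ} (hs : s ≠ 1) : riemannZeta₁ s = (s - 1) * riemannZeta s := by
  rw [riemannZeta_eq_inv_sub_mul hs, mul_inv_cancel_left₀ (sub_ne_zero.2 hs)]

theorem riemannZeta₁_ne_zero_of_one_le_re {s : ℂ} (hs : 1 ≤ s.re) : riemannZeta₁ s ≠ 0 := by
  by_cases h : s = 1
  · rw [h, riemannZeta₁_one]; exact one_ne_zero
  · rw [riemannZeta₁_eq h]
    exact mul_ne_zero (sub_ne_zero.2 h) (riemannZeta_ne_zero_of_one_le_re hs)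

theorem logDeriv_zeta_eq {s : ℂ} (hs : s ≠ 1) (hz : riemannZeta s ≠ 0) :
    deriv riemannZeta s / riemannZeta s = deriv riemannZeta₁ s / riemannZeta₁ s - 1 / (s - 1) := by
  have hs1 : s - 1 ≠ 0 := sub_ne_zero.2 hs
  have hz1 : riemannZeta₁ s ≠ 0 := by rw [riemannZeta₁_eq hs]; exact mul_ne_zero hs1 hz
  rw [deriv_riemannZeta_eq_neg_inv_sub_sq_mul_add hs, riemannZeta_eq_inv_sub_mul hs]
  field_simp
  ring

theorem exists_bound_near_one : ∃ C ≥ (1 : ℝ), ∀ δ : ℝ, 0 < δ → δ ≤ 1 →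
    -(deriv riemannZeta (1 + δ : ℝ) / riemannZeta (1 + δ : ℝ)).re ≤ 1 / δ + C ∧
    ‖riemannZeta (1 + δ : ℝ)‖ ≤ C / δ := by
  have hc1 : Continuous fun x : ℝ => riemannZeta₁ x := differentiable_riemannZeta₁.continuous.comp Complex.continuous_ofReal
  have hc2 : Continuous fun x : ℝ => deriv riemannZeta₁ x :=
    differentiable_riemannZeta₁.deriv.continuous.comp Complex.continuous_ofReal
  obtain ⟨C1, hC1⟩ := (isCompact_Icc (a := (1 : ℝ)) (b := 2)).exists_bound_of_continuousOn hc1.continuousOn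
  obtain ⟨C2, hC2⟩ := (isCompact_Icc (a := (1 : ℝ)) (b := 2)).exists_bound_of_continuousOn
    (f := fun x : ℝ => deriv riemannZeta₁ x / riemannZeta₁ x)
    (hc2.continuousOn.div hc1.continuousOn fun x hx => riemannZeta₁_ne_zero_of_one_le_re (by simpa using hx.1))
  refine ⟨max 1 (max C1 C2), le_max_left _ _, fun δ h0 h1 => ?_⟩
  have hmem : 1 + δ ∈ Set.Icc (1 : ℝ) 2 := ⟨by linarith, by linarith⟩
  have hne : ((1 + δ : ℝ) : ℂ) ≠ 1 := by
    intro h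
    have : (1 + δ : ℝ) = 1 := by exact_mod_cast h
    linarith
  have hsub : ((1 + δ : ℝ) : ℂ) - 1 = (δ : ℂ) := by push_cast; ring
  have hz : riemannZeta (1 + δ : ℝ) ≠ 0 := riemannZeta_ne_zero_of_one_le_re (by simp; linarith)
  constructor
  · rw [logDeriv_zeta_eq hne hz, hsub, Complex.sub_re]
    have e : (1 / (δ : ℂ)).re = 1 / δ := by
      rw [← Complex.ofReal_one, ← Complex.ofReal_div, Complex.ofReal_re]
    have h3 := (abs_le.1 ((Complex.abs_re_le_norm _).trans (hC2 _ hmem))).1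
    have h4 : C2 ≤ max 1 (max C1 C2) := (le_max_right _ _).trans (le_max_right _ _)
    rw [e]
    linarith
  · rw [riemannZeta_eq_inv_sub_mul hne, hsub, norm_mul, norm_inv, Complex.norm_of_nonneg h0.le, inv_mul_eq_div]
    gcongr
    exact (hC1 _ hmem).trans ((le_max_left _ _).trans (le_max_right _ _))

theorem norm_inv_zeta_le {s : ℂ} (hs : 1 < s.re) : ‖riemannZeta s‖⁻¹ ≤ ‖riemannZeta s.re‖ := by
  have hre : 1 < (s.re : ℂ).re := by simpa using hs
  have h1 := ArithmeticFunction.LSeries_zeta_mul_Lseries_moebius hs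
  rw [ArithmeticFunction.LSeries_zeta_eq_riemannZeta hs] at h1
  rw [← norm_inv, inv_eq_of_mul_eq_one_right h1, LSeries]
  have hz := zeta_eq_tsum_one_div_nat_cpow hre
  have hsum : Summable fun n : ℕ => 1 / (n : ℝ) ^ s.re := Real.summable_one_div_nat_rpow.2 hs
  have h2 : riemannZeta s.re = ((∑' n : ℕ, 1 / (n : ℝ) ^ s.re : ℝ) : ℂ) := by
    rw [hz, Complex.ofReal_tsum]
    refine tsum_congr fun n => ?_
    rw [Complex.ofReal_div, Complex.ofReal_cpow (by positivity)]
    simp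
  rw [h2, Complex.norm_of_nonneg (tsum_nonneg fun n => by positivity)]
  refine tsum_of_norm_bounded hsum.hasSum fun n => ?_
  rw [LSeries.norm_term_eq]
  split_ifs with h
  · positivity
  · gcongr
    have := ArithmeticFunction.abs_moebius_le_one (n := n)
    rw [Complex.norm_intCast]
    exact_mod_cast this

open Metric in
theorem zeta_ratio_le {T C δ t θ : ℝ} (hT : 3 ≤ Real.log T) (hθ : θ = (Real.log (Real.log T) / Real.log T) ^ (2 / 3 : ℝ))
    (hθ4 : θ ≤ 1 / 4) (hδ0 : 1 / Real.log T ≤ δ) (hδ1 : δ ≤ 1) (hC : ∀ δ : ℝ, 0 < δ → δ ≤ 1 → ‖riemannZeta (1 + δ : ℝ)‖ ≤ C / δ)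
    (hCL : 2 * C ≤ Real.log T) (ht : 3 ≤ |t|) (htT : |t| + 1 ≤ T) :
    ∀ z ∈ closedBall (((1 + δ : ℝ) : ℂ) + t * Complex.I) θ,
      ‖riemannZeta₁ z‖ ≤ Real.exp (4012 * Real.log (Real.log T)) * ‖riemannZeta₁ (((1 + δ : ℝ) : ℂ) + t * Complex.I)‖ := by
  intro z hz
  set L := Real.log T with hL
  have hL0 : 0 < L := by linarith
  have hδ : 0 < δ := lt_of_lt_of_le (by positivity) hδ0
  set s : ℂ := ((1 + δ : ℝ) : ℂ) + t * Complex.I with hs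
  have hsre : s.re = 1 + δ := by simp [hs]
  have hsim : s.im = t := by simp [hs]
  have hzs : ‖z - s‖ ≤ θ := by rwa [← dist_eq_norm]
  have hre := abs_le.1 ((Complex.abs_re_le_norm (z - s)).trans hzs)
  have him := abs_le.1 ((Complex.abs_im_le_norm (z - s)).trans hzs)
  rw [Complex.sub_re, hsre] at hre
  rw [Complex.sub_im, hsim] at him
  have him1 : 2 ≤ |z.im| := by
    rcases abs_cases t with h | h <;> rcases abs_cases z.im with h' | h' <;> linarith
  have him2 : |z.im| ≤ T := by
    rcases abs_cases t with h | h <;> rcases abs_cases z.im with h' | h' <;> linarith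
  have hz1 := norm_zeta_le hT him1 him2 (by linarith) (by linarith) (by rw [← hθ]; linarith)
  have hne1 : z ≠ 1 := fun h => by rw [h] at him1; norm_num at him1
  have hne2 : s ≠ 1 := fun h => by rw [h] at hsre; simp at hsre; linarith
  have hs1 : 2 ≤ ‖s - 1‖ := by
    have := Complex.abs_im_le_norm (s - 1)
    rw [Complex.sub_im, hsim, Complex.one_im, sub_zero] at this
    linarith
  have hzs1 : ‖z - 1‖ ≤ 2 * ‖s - 1‖ := by
    have : z - 1 = (z - s) + (s - 1) := by ring
    rw [this]
    refine (norm_add_le _ _).trans ?_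
    linarith
  have hζs : 1 ≤ C / δ * ‖riemannZeta s‖ := by
    have h1 := norm_inv_zeta_le (s := s) (by linarith)
    rw [hsre] at h1
    have h2 := h1.trans (hC δ hδ hδ1)
    have h3 : 0 < ‖riemannZeta s‖ := norm_pos_iff.2 (riemannZeta_ne_zero_of_one_le_re (by linarith))
    rwa [inv_eq_one_div, div_le_iff₀ h3] at h2
  have hCd : 2 * (C / δ) ≤ L ^ 2 := by
    rw [mul_div_assoc', div_le_iff₀ hδ]
    have : 1 ≤ L * δ := by rwa [div_le_iff₀' hL0] at hδ0
    nlinarith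
  rw [riemannZeta₁_eq hne1, riemannZeta₁_eq hne2, norm_mul, norm_mul]
  have hexp : Real.exp (4012 * Real.log L) = L ^ 4012 := by
    rw [show (4012 : ℝ) * Real.log L = ((4012 : ℕ) : ℝ) * Real.log L by norm_num, Real.exp_nat_mul, Real.exp_log hL0]
  rw [hexp]
  calc _ ≤ 2 * ‖s - 1‖ * L ^ 4010 := by gcongr
    _ ≤ 2 * ‖s - 1‖ * L ^ 4010 * (C / δ * ‖riemannZeta s‖) := le_mul_of_one_le_right (by positivity) hζs
    _ = (2 * (C / δ)) * (L ^ 4010 * (‖s - 1‖ * ‖riemannZeta s‖)) := by ring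
    _ ≤ L ^ 2 * (L ^ 4010 * (‖s - 1‖ * ‖riemannZeta s‖)) := mul_le_mul_of_nonneg_right hCd (mul_nonneg (pow_nonneg hL0.le 4010) (by positivity))
    _ = _ := by rw [← mul_assoc, ← pow_add]

open Metric in
theorem zero_free_aux {T C K θ : ℝ} {ρ : ℂ} (hT : 3 ≤ Real.log T) (hθ : θ = (Real.log (Real.log T) / Real.log T) ^ (2 / 3 : ℝ))
    (hθ4 : θ ≤ 1 / 4) (hK : K = 61 * (4012 * Real.log (Real.log T) / θ)) (hKL : 2 * K ≤ Real.log T)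
    (hC1 : ∀ δ : ℝ, 0 < δ → δ ≤ 1 → -(deriv riemannZeta (1 + δ : ℝ) / riemannZeta (1 + δ : ℝ)).re ≤ 1 / δ + C)
    (hC : ∀ δ : ℝ, 0 < δ → δ ≤ 1 → ‖riemannZeta (1 + δ : ℝ)‖ ≤ C / δ)
    (hCK : 3 * C + 5 ≤ 4012 * Real.log (Real.log T) / θ)
    (hCL : 2 * C ≤ Real.log T) (hγ : 3 ≤ |ρ.im|) (hγT : 2 * |ρ.im| + 1 ≤ T) (hρ : riemannZeta₁ ρ = 0) :
    ρ.re ≤ 1 - 1 / (14 * K) := by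
  set L := Real.log T with hL
  have hL0 : 0 < L := by linarith
  set l := Real.log L with hl
  have hl1 : 1 ≤ l := by
    rw [hl, Real.le_log_iff_exp_le hL0]
    linarith [Real.exp_one_lt_d9]
  have hθ0 : 0 < θ := by rw [hθ]; positivity
  set Q := 4012 * l / θ with hQ
  have hQ0 : 0 < Q := by positivity
  have hK0 : 0 < K := by rw [hK]; positivity
  have hQ4 : 4012 ≤ Q := by
    rw [hQ, le_div_iff₀ hθ0]; nlinarith
  set δ := 1 / (2 * K) with hδ
  have hδ0 : 0 < δ := by positivity
  have hδL : 1 / L ≤ δ := by rw [hδ]; gcongr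
  have hδ1 : δ ≤ 1 := by
    rw [hδ, div_le_one (by positivity), hK]; linarith
  have hρ1 : ρ.re < 1 := by
    by_contra! h
    exact riemannZeta₁_ne_zero_of_one_le_re h hρ
  set γ := ρ.im with hγdef
  set s : ℂ := ((1 + δ : ℝ) : ℂ) + γ * Complex.I with hs
  set s2 : ℂ := ((1 + δ : ℝ) : ℂ) + (2 * γ : ℝ) * Complex.I with hs2
  have hsre : s.re = 1 + δ := by simp [hs]
  have hsim : s.im = γ := by simp [hs]
  have hs2re : s2.re = 1 + δ := by simp [hs2]
  have hs2im : s2.im = 2 * γ := by simp [hs2]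
  have hsρ : s - ρ = ((1 + δ - ρ.re : ℝ) : ℂ) := by
    apply Complex.ext
    · simp [hs]
    · simp [hs]; linarith
  have hgap : 0 < 1 + δ - ρ.re := by linarith
  have hzle : ∀ w : ℂ, w.re = 1 + δ → ∀ z ∈ closedBall w (θ / 3), riemannZeta₁ z = 0 → z.re ≤ w.re := by
    intro w hw z _ hz
    by_contra! h
    exact riemannZeta₁_ne_zero_of_one_le_re (by linarith) hz
  have hKθ : 12 ≤ 7 * (K * θ) := by
    have : K * θ = 61 * 4012 * l := by rw [hK, hQ]; field_simp
    rw [this]; nlinarith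
  by_cases hball : ρ ∈ closedBall s (θ / 3)
  · have h2γ : |2 * γ| = 2 * |γ| := by rw [abs_mul, abs_two]
    have hne : s ≠ 1 := fun h => by rw [h] at hsre; simp at hsre; linarith
    have hne2 : s2 ≠ 1 := fun h => by rw [h] at hs2re; simp at hs2re; linarith
    have hnz : ∀ w : ℂ, w.re = 1 + δ → riemannZeta w ≠ 0 := fun w hw => riemannZeta_ne_zero_of_one_le_re (by linarith)
    have hinv : ∀ w : ℂ, 1 ≤ |w.im| → (1 / (w - 1)).re ≤ 1 := by
      intro w hw
      refine (Complex.re_le_norm _).trans ?_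
      rw [norm_div, norm_one, div_le_one (by
        have := Complex.abs_im_le_norm (w - 1)
        simp at this; linarith)]
      have := Complex.abs_im_le_norm (w - 1)
      simp at this; linarith
    have r1 := zeta_ratio_le hT hθ hθ4 hδL hδ1 hC hCL hγ (by linarith)
    have r2 := zeta_ratio_le (t := 2 * γ) hT hθ hθ4 hδL hδ1 hC hCL (by rw [h2γ]; linarith) (by rw [h2γ]; linarith)
    have l1 := landau_re_logDeriv_ge_of_zero differentiable_riemannZeta₁ hθ0 (riemannZeta₁_ne_zero_of_one_le_re (s := s) (by linarith))
      (fun z hz => r1 z (sphere_subset_closedBall hz)) (hzle s hsre) hball hρ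
    have l2 := landau_re_logDeriv_ge differentiable_riemannZeta₁ hθ0 (riemannZeta₁_ne_zero_of_one_le_re (s := s2) (by linarith))
      (fun z hz => r2 z (sphere_subset_closedBall hz)) (hzle s2 hs2re)
    rw [← hL, ← hl] at l1 l2
    have hQe : 12 * (4012 * l) / θ = 12 * Q := by rw [hQ]; ring
    rw [hQe] at l1 l2
    have h341 := three_four_one (σ := 1 + δ) (by linarith) γ
    rw [← hs, ← hs2, logDeriv_zeta_eq hne (hnz s hsre), logDeriv_zeta_eq hne2 (hnz s2 hs2re), Complex.sub_re, Complex.sub_re] at h341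
    have h1 := hC1 δ hδ0 hδ1
    have i1 := hinv s (by rw [hsim]; linarith)
    have i2 := hinv s2 (by rw [hs2im, h2γ]; linarith)
    have e : (1 / (s - ρ)).re = 1 / (1 + δ - ρ.re) := by
      rw [hsρ, ← Complex.ofReal_one, ← Complex.ofReal_div, Complex.ofReal_re]
    rw [e] at l1
    have hδi : 1 / δ = 2 * K := by rw [hδ, one_div_one_div]
    rw [hδi] at h1
    have hfin : 4 * (1 / (1 + δ - ρ.re)) ≤ 7 * K := by
      have : K = 61 * Q := hK
      linarith
    rw [mul_one_div, div_le_iff₀ hgap] at hfin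
    have : 4 / (7 * K) ≤ 1 + δ - ρ.re := by rw [div_le_iff₀ (by positivity)]; linarith
    have e2 : 4 / (7 * K) = δ + 1 / (14 * K) := by rw [hδ]; field_simp; norm_num
    linarith
  · rw [mem_closedBall, dist_comm, dist_eq_norm, hsρ, Complex.norm_of_nonneg hgap.le, not_le] at hball
    have : δ + 1 / (14 * K) ≤ θ / 3 := by
      have e2 : δ + 1 / (14 * K) = 4 / (7 * K) := by rw [hδ]; field_simp; norm_num
      rw [e2, div_le_div_iff₀ (by positivity) (by norm_num)]
      linarith
    linarith

open Metric in
theorem inv_zeta_aux {T C K θ : ℝ} {s : ℂ} (hT : 3 ≤ Real.log T) (hθ : θ = (Real.log (Real.log T) / Real.log T) ^ (2 / 3 : ℝ))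
    (hθ4 : θ ≤ 1 / 4) (hK : K = 61 * (4012 * Real.log (Real.log T) / θ)) (hKL : 56 * K ≤ Real.log T)
    (hC1 : ∀ δ : ℝ, 0 < δ → δ ≤ 1 → -(deriv riemannZeta (1 + δ : ℝ) / riemannZeta (1 + δ : ℝ)).re ≤ 1 / δ + C)
    (hC : ∀ δ : ℝ, 0 < δ → δ ≤ 1 → ‖riemannZeta (1 + δ : ℝ)‖ ≤ C / δ)
    (hCK : 3 * C + 5 ≤ 4012 * Real.log (Real.log T) / θ)
    (hCL : 2 * C ≤ Real.log T) (hγ : 4 ≤ |s.im|) (hγT : 2 * |s.im| + 3 ≤ T) (hs : 1 - 1 / (112 * K) ≤ s.re) (hs2 : s.re ≤ 2) :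
    riemannZeta₁ s ≠ 0 ∧ ‖riemannZeta₁ s‖⁻¹ ≤ Real.log T ^ 8026 := by
  set L := Real.log T with hL
  have hL0 : 0 < L := by linarith
  set l := Real.log L with hl
  have hl1 : 1 ≤ l := by
    rw [hl, Real.le_log_iff_exp_le hL0]
    linarith [Real.exp_one_lt_d9]
  have hθ0 : 0 < θ := by rw [hθ]; positivity
  have hK0 : 0 < K := by rw [hK]; positivity
  have hKθ : 61 * 4012 ≤ K * θ := by
    have : K * θ = 61 * 4012 * l := by rw [hK]; field_simp
    rw [this]; nlinarith
  have hK1 : 61 * 4012 ≤ K := by nlinarith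
  set η := 1 / (14 * K) with hη
  have hη0 : 0 < η := by positivity
  have hη8 : 1 / (112 * K) = η / 8 := by rw [hη]; field_simp; norm_num
  rw [hη8] at hs
  have hηθ : 2 * η ≤ θ := by
    rw [hη, mul_one_div, div_le_iff₀ (by positivity)]
    linarith
  set t := s.im with ht
  have hlow : ∀ w : ℂ, 1 + η / 2 ≤ w.re → w.re ≤ 2 → 1 ≤ |w.im| → ‖riemannZeta₁ w‖⁻¹ ≤ L ^ 2 := by
    intro w h1 h2 h3
    have hd : w.re = 1 + (w.re - 1) := by ring
    have hnz : 0 < ‖riemannZeta w‖ := norm_pos_iff.2 (riemannZeta_ne_zero_of_one_le_re (by linarith))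
    have h4 := (norm_inv_zeta_le (s := w) (by linarith))
    rw [hd] at h4
    have h5 := h4.trans (hC (w.re - 1) (by linarith) (by linarith))
    have hne : w ≠ 1 := fun h => by rw [h] at h1; simp at h1; linarith
    have h6 : 1 ≤ ‖w - 1‖ := by
      have := Complex.abs_im_le_norm (w - 1)
      simp at this; linarith
    rw [riemannZeta₁_eq hne, norm_mul]
    have hC0 : 0 ≤ C := by
      have := (norm_nonneg _).trans (hC 1 one_pos le_rfl)
      simpa using this
    calc (‖w - 1‖ * ‖riemannZeta w‖)⁻¹ ≤ ‖riemannZeta w‖⁻¹ := by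
          gcongr
          exact le_mul_of_one_le_left hnz.le h6
      _ ≤ C / (w.re - 1) := h5
      _ ≤ C / (η / 2) := by gcongr; linarith
      _ ≤ L ^ 2 := by
          rw [div_le_iff₀ (by positivity)]
          have : 1 ≤ L * (η / 2) := by
            have : η / 2 = 1 / (28 * K) := by rw [hη]; field_simp; norm_num
            rw [this, mul_one_div, le_div_iff₀ (by positivity)]
            linarith
          nlinarith
  by_cases hcase : 1 + η / 2 ≤ s.re
  · exact ⟨riemannZeta₁_ne_zero_of_one_le_re (by linarith), (hlow s hcase hs2 (by linarith)).trans
      (pow_le_pow_right₀ (by linarith) (by norm_num))⟩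
  push Not at hcase
  set w : ℂ := ((1 + η / 2 : ℝ) : ℂ) + t * Complex.I with hw
  have hwre : w.re = 1 + η / 2 := by simp [hw]
  have hwim : w.im = t := by simp [hw]
  have hη1 : η ≤ 1 := by linarith
  have hwlow := hlow w hwre.ge (by linarith) (by rw [hwim]; linarith)
  have hwnz : riemannZeta₁ w ≠ 0 := riemannZeta₁_ne_zero_of_one_le_re (by linarith)
  set R := 3 / 2 * η with hR
  have hR0 : 0 < R := by positivity
  have hratio := zeta_ratio_le (δ := η / 2) (t := t) hT hθ hθ4 (by
    rw [← hL, div_le_iff₀' hL0]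
    have : η / 2 = 1 / (28 * K) := by rw [hη]; field_simp; norm_num
    rw [this, mul_one_div, le_div_iff₀ (by positivity)]
    linarith) (by linarith) hC hCL (by linarith) (by linarith [abs_nonneg t])
  rw [← hw, ← hL, ← hl] at hratio
  have hnz : ∀ z ∈ ball w R, riemannZeta₁ z ≠ 0 := by
    intro z hz h0
    have hzs : ‖z - w‖ < R := by rwa [← dist_eq_norm]
    have hre := abs_lt.1 ((Complex.abs_re_le_norm (z - w)).trans_lt hzs)
    have him := abs_lt.1 ((Complex.abs_im_le_norm (z - w)).trans_lt hzs)
    rw [Complex.sub_re, hwre] at hre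
    rw [Complex.sub_im, hwim] at him
    have := zero_free_aux hT hθ hθ4 hK (by linarith) hC1 hC hCK hCL (by
      rcases abs_cases t with h | h <;> rcases abs_cases z.im with h' | h' <;> linarith) (by
      rcases abs_cases t with h | h <;> rcases abs_cases z.im with h' | h' <;> linarith) h0
    linarith
  obtain ⟨F, hFc, hF, hfF⟩ := exists_eq_mul_exp_on_ball differentiable_riemannZeta₁ hR0 hnz
  have hws : ‖s - w‖ ≤ R / 2 := by
    have : s - w = ((s.re - (1 + η / 2) : ℝ) : ℂ) := by
      apply Complex.ext <;> simp [hw, ht]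
    rw [this, Complex.norm_real, Real.norm_eq_abs, abs_le]
    constructor <;> linarith
  have hsb : s ∈ ball w R := by rw [mem_ball, dist_eq_norm]; linarith
  have hFs := norm_log_le_of_no_zeros (M := 4012 * l) (by positivity) hR0 hwnz hFc
    (fun z hz => (hF z hz).differentiableAt.differentiableWithinAt) hfF
    (fun z hz => hratio z (closedBall_subset_closedBall (by linarith) (ball_subset_closedBall hz))) hsb
  refine ⟨hnz s hsb, ?_⟩
  have hFs2 : ‖F s‖ ≤ 8024 * l := by
    refine hFs.trans ?_
    rw [div_le_iff₀ (by linarith)]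
    nlinarith
  rw [hfF s hsb, norm_mul, Complex.norm_exp, mul_inv, ← Real.exp_neg]
  have h7 : -(F s).re ≤ 8024 * l := by
    have := (abs_le.1 ((Complex.abs_re_le_norm (F s)).trans hFs2)).1
    linarith
  have hexp : Real.exp (8024 * l) = L ^ 8024 := by
    rw [show (8024 : ℝ) * l = ((8024 : ℕ) : ℝ) * l by norm_num, Real.exp_nat_mul, hl, Real.exp_log hL0]
  calc _ ≤ L ^ 2 * Real.exp (8024 * l) := by gcongr
    _ = _ := by rw [hexp, ← pow_add]

theorem tendsto_log_div_self : Tendsto (fun L : ℝ => Real.log L / L) atTop (nhds 0) := by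
  have := Real.isLittleO_log_id_atTop.tendsto_div_nhds_zero
  simpa using this

theorem log_div_rpow_identity {L l : ℝ} (hL : 0 < L) (hl : 0 < l) :
    l / (l / L) ^ (2 / 3 : ℝ) = L ^ (2 / 3 : ℝ) * l ^ (1 / 3 : ℝ) := by
  have h : l = l ^ (1 / 3 : ℝ) * l ^ (2 / 3 : ℝ) := by
    rw [← Real.rpow_add hl]; norm_num
  rw [Real.div_rpow hl.le hL.le, div_div_eq_mul_div]
  nth_rewrite 1 [h]
  field_simp

open Metric in
theorem exists_low_bound : ∃ ε > (0 : ℝ), ∃ C : ℝ, ∀ s : ℂ, |s.im| ≤ 4 → 1 - ε ≤ s.re → s.re ≤ 2 →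
    riemannZeta₁ s ≠ 0 ∧ ‖riemannZeta₁ s‖⁻¹ ≤ C := by
  set S : Set ℂ := Set.Icc (1 : ℝ) 2 ×ℂ Set.Icc (-4 : ℝ) 4 with hS
  have hSc : IsCompact S := isCompact_Icc.reProdIm isCompact_Icc
  have hcont : ContinuousOn (fun s => (riemannZeta₁ s)⁻¹) S :=
    differentiable_riemannZeta₁.continuous.continuousOn.inv₀ fun s hs => riemannZeta₁_ne_zero_of_one_le_re hs.1.1
  obtain ⟨B, hB⟩ := hSc.exists_bound_of_continuousOn hcont
  have hB0 : 0 < |B| + 1 := by positivity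
  set U : Set ℂ := {s | (|B| + 1)⁻¹ < ‖riemannZeta₁ s‖} with hU
  have hUo : IsOpen U := isOpen_lt continuous_const differentiable_riemannZeta₁.continuous.norm
  have hSU : S ⊆ U := by
    intro s hs
    have h1 := hB s hs
    have h2 : 0 < ‖riemannZeta₁ s‖ := norm_pos_iff.2 (riemannZeta₁_ne_zero_of_one_le_re hs.1.1)
    rw [norm_inv] at h1
    show (|B| + 1)⁻¹ < ‖riemannZeta₁ s‖
    rw [inv_lt_comm₀ hB0 h2]
    linarith [le_abs_self B]
  obtain ⟨δ, hδ, hδU⟩ := hSc.exists_thickening_subset_open hUo hSU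
  refine ⟨δ / 2, by positivity, |B| + 1, fun s him hre1 hre2 => ?_⟩
  have hsU : s ∈ U := by
    apply hδU
    rw [mem_thickening_iff]
    refine ⟨((max 1 s.re : ℝ) : ℂ) + s.im * Complex.I, ⟨⟨by simp, by simpa using hre2⟩, ?_⟩, ?_⟩
    · simpa [abs_le] using him
    · have e : s - (((max 1 s.re : ℝ) : ℂ) + s.im * Complex.I) = ((s.re - max 1 s.re : ℝ) : ℂ) := by
        apply Complex.ext <;> simp
      rw [dist_eq_norm, e, Complex.norm_real, Real.norm_eq_abs, abs_lt]
      rcases max_cases 1 s.re with h | h <;> constructor <;> linarith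
  have h1 : (|B| + 1)⁻¹ < ‖riemannZeta₁ s‖ := hsU
  have h2 : 0 < ‖riemannZeta₁ s‖ := lt_trans (by positivity) h1
  refine ⟨norm_pos_iff.1 h2, ?_⟩
  rw [inv_le_comm₀ h2 hB0]
  exact h1.le

theorem exists_inv_zeta_bound : ∃ c > (0 : ℝ), ∃ L₀ : ℝ, ∀ T : ℝ, L₀ ≤ Real.log T → ∀ s : ℂ, |s.im| ≤ T / 4 →
    1 - c / (Real.log T ^ (2 / 3 : ℝ) * Real.log (Real.log T) ^ (1 / 3 : ℝ)) ≤ s.re → s.re ≤ 2 →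
    riemannZeta₁ s ≠ 0 ∧ ‖riemannZeta₁ s‖⁻¹ ≤ Real.log T ^ 8026 := by
  obtain ⟨C, hC1, hC⟩ := exists_bound_near_one
  obtain ⟨ε, hε, B, hB⟩ := exists_low_bound
  have hll : Tendsto (fun L : ℝ => Real.log L) atTop atTop := Real.tendsto_log_atTop
  have hθ : Tendsto (fun L : ℝ => (Real.log L / L) ^ (2 / 3 : ℝ)) atTop (nhds 0) := by
    have := tendsto_log_div_self.rpow_const (p := 2 / 3) (Or.inr (by norm_num))
    rwa [Real.zero_rpow (by norm_num)] at this
  have hθ' : Tendsto (fun L : ℝ => (Real.log L / L) ^ (1 / 3 : ℝ)) atTop (nhds 0) := by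
    have := tendsto_log_div_self.rpow_const (p := 1 / 3) (Or.inr (by norm_num))
    rwa [Real.zero_rpow (by norm_num)] at this
  have hev : ∀ᶠ L : ℝ in atTop, 3 ≤ L ∧ 2 * C ≤ L ∧ B ≤ L ∧ 3 * C + 5 ≤ Real.log L ∧ 1 / ε ≤ L ^ (2 / 3 : ℝ) ∧
      (Real.log L / L) ^ (2 / 3 : ℝ) < 1 / 4 ∧ (Real.log L / L) ^ (1 / 3 : ℝ) < 1 / (56 * 61 * 4012) := by
    filter_upwards [eventually_ge_atTop 3, eventually_ge_atTop (2 * C), eventually_ge_atTop B,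
      hll.eventually_ge_atTop (3 * C + 5), (tendsto_rpow_atTop (y := 2 / 3) (by norm_num)).eventually_ge_atTop (1 / ε),
      hθ.eventually (gt_mem_nhds (show (0 : ℝ) < 1 / 4 by norm_num)),
      hθ'.eventually (gt_mem_nhds (show (0 : ℝ) < 1 / (56 * 61 * 4012) by norm_num))] with L h1 h2 h3 h4 h5 h6 h7
    exact ⟨h1, h2, h3, h4, h5, h6, h7⟩
  obtain ⟨L₀, hL₀⟩ := eventually_atTop.1 hev
  refine ⟨1 / (112 * 61 * 4012), by norm_num, L₀, fun T hT s him hre1 hre2 => ?_⟩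
  obtain ⟨h1, h2, h3, h4, h5, h6, h7⟩ := hL₀ _ hT
  set L := Real.log T with hL
  have hL0 : 0 < L := by linarith
  set l := Real.log L with hl
  have hl1 : 1 ≤ l := by linarith
  have hl0 : 0 < l := by linarith
  set D := L ^ (2 / 3 : ℝ) * l ^ (1 / 3 : ℝ) with hD
  have hD0 : 0 < D := by positivity
  have hT0 : 0 < T := by
    by_contra! h
    have hT' : T = 0 := by linarith [(abs_nonneg _).trans him]
    rw [hL, hT', Real.log_zero] at h1
    linarith
  have hT6 : 6 ≤ T := by
    have h8 : Real.exp 3 ≤ T := by rwa [← Real.le_log_iff_exp_le hT0]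
    have h9 : (2 : ℝ) ^ 3 ≤ Real.exp 3 := by
      rw [show (3 : ℝ) = ((3 : ℕ) : ℝ) * 1 by norm_num, Real.exp_nat_mul]
      gcongr
      linarith [Real.exp_one_gt_d9]
    linarith
  have hid : l / (l / L) ^ (2 / 3 : ℝ) = D := log_div_rpow_identity hL0 hl0
  have hDL : D = L * (l / L) ^ (1 / 3 : ℝ) := by
    rw [Real.div_rpow hl0.le hL0.le, hD]
    have : L = L ^ (2 / 3 : ℝ) * L ^ (1 / 3 : ℝ) := by rw [← Real.rpow_add hL0]; norm_num
    nth_rewrite 2 [this]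
    field_simp
  rcases le_or_gt 4 |s.im| with hs | hs
  · refine inv_zeta_aux (T := T) (C := C) (K := 61 * 4012 * D) (θ := (l / L) ^ (2 / 3 : ℝ)) h1 rfl h6.le ?_ ?_
      (fun δ a b => (hC δ a b).1) (fun δ a b => (hC δ a b).2) ?_ h2 hs (by linarith) ?_ hre2
    · rw [← hL, ← hl, mul_div_assoc, hid]; ring
    · rw [← hL, hDL]
      have := mul_le_mul_of_nonneg_left h7.le hL0.le
      linarith
    · rw [← hL, ← hl, mul_div_assoc, hid]
      have h5' : 1 ≤ L ^ (2 / 3 : ℝ) := Real.one_le_rpow (by linarith) (by norm_num)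
      have : 1 ≤ D := by
        have : 1 ≤ l ^ (1 / 3 : ℝ) := Real.one_le_rpow (by linarith) (by norm_num)
        rw [hD]; nlinarith
      have hDl : l ≤ D := by
        rw [← hid, le_div_iff₀ (by positivity)]
        nlinarith
      linarith
    · have e : 1 / (112 * (61 * 4012 * D)) = 1 / (112 * 61 * 4012) / D := by field_simp
      rw [e]; exact hre1
  · have hDε : 1 / (112 * 61 * 4012) / D ≤ ε := by
      rw [div_le_iff₀ hD0]
      have h8 : 1 ≤ ε * L ^ (2 / 3 : ℝ) := by rwa [div_le_iff₀' hε] at h5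
      have h9 : 1 ≤ l ^ (1 / 3 : ℝ) := Real.one_le_rpow (by linarith) (by norm_num)
      have : 1 ≤ ε * D := by
        rw [hD, ← mul_assoc]; nlinarith
      linarith
    obtain ⟨a, b⟩ := hB s hs.le (by linarith) hre2
    refine ⟨a, b.trans (h3.trans ?_)⟩
    exact le_self_pow₀ (by linarith) (by norm_num)

theorem norm_perron_kernel_le {σ : ℝ} (h0 : 0 < σ) (h1 : σ ≤ 1) (y : ℝ) :
    ‖1 / (((σ : ℂ) + y * Complex.I) * ((σ : ℂ) + y * Complex.I + 1))‖ ≤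
      (σ ^ 2)⁻¹ * (1 + y ^ 2)⁻¹ := by
  have e1 : ‖(σ : ℂ) + y * Complex.I‖ = √(σ ^ 2 + y ^ 2) := Complex.norm_add_mul_I σ y
  have e2 : ‖(σ : ℂ) + y * Complex.I + 1‖ = √((σ + 1) ^ 2 + y ^ 2) := by
    rw [← Complex.norm_add_mul_I]; congr 1; push_cast; ring
  rw [norm_div, norm_one, norm_mul, e1, e2, one_div, ← mul_inv]
  apply inv_anti₀ (by positivity)
  calc σ ^ 2 * (1 + y ^ 2) ≤ σ ^ 2 + y ^ 2 := by
        have : σ ^ 2 ≤ 1 := by nlinarith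
        nlinarith [sq_nonneg y]
    _ = √(σ ^ 2 + y ^ 2) * √(σ ^ 2 + y ^ 2) := (Real.mul_self_sqrt (by positivity)).symm
    _ ≤ _ := by
        gcongr
        linarith

theorem continuous_perron_kernel {σ : ℝ} (h0 : 0 < σ) :
    Continuous fun y : ℝ => 1 / (((σ : ℂ) + y * Complex.I) * ((σ : ℂ) + y * Complex.I + 1)) := by
  refine continuous_const.div (by fun_prop) fun y => mul_ne_zero (fun h => ?_) fun h => ?_
  · have := congrArg Complex.re h
    simp at this
    linarith
  · have := congrArg Complex.re h
    simp at this
    linarith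

theorem integrable_perron_kernel {σ : ℝ} (h0 : 0 < σ) (h1 : σ ≤ 1) :
    Integrable fun y : ℝ => 1 / (((σ : ℂ) + y * Complex.I) * ((σ : ℂ) + y * Complex.I + 1)) :=
  (integrable_inv_one_add_sq.const_mul ((σ ^ 2)⁻¹)).mono'
    (continuous_perron_kernel h0).aestronglyMeasurable
    (Eventually.of_forall (norm_perron_kernel_le h0 h1))

theorem integral_cpow_perron_kernel {σ : ℝ} (h0 : 0 < σ) (h1 : σ ≤ 1) {u : ℝ} (hu : 0 < u) :
    ∫ y : ℝ, (u : ℂ) ^ ((σ : ℂ) + y * Complex.I) *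
      (1 / (((σ : ℂ) + y * Complex.I) * ((σ : ℂ) + y * Complex.I + 1))) =
      2 * Real.pi * ((max (1 - 1 / u) 0 : ℝ) : ℂ) := by
  set f : ℝ → ℂ := fun t => Set.indicator (Set.Ioc 0 1) (fun _ => 1 : ℝ → ℂ) t -
    Set.indicator (Set.Ioc 0 1) (fun t => (t : ℂ) ^ (1 : ℂ) : ℝ → ℂ) t with hf
  have hm : ∀ s : ℂ, 0 < s.re → HasMellin f s (1 / (s * (s + 1))) := by
    intro s hs
    have a1 := hasMellin_one_Ioc hs
    have a2 := hasMellin_cpow_Ioc 1 (s := s) (by simp; linarith)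
    have := hasMellin_sub a1.1 a2.1
    rw [a1.2, a2.2] at this
    convert! this using 1
    have n1 : s ≠ 0 := fun h => by simp [h] at hs
    have n2 : s + 1 ≠ 0 := fun h => by
      have := congrArg Complex.re h
      simp at this
      linarith
    field_simp
    ring
  have hfv : ∀ t : ℝ, 0 < t → f t = ((max (1 - t) 0 : ℝ) : ℂ) := by
    intro t ht
    by_cases h : t ≤ 1
    · simp [hf, Set.indicator, ht, h]
    · simp [hf, Set.indicator, h, max_eq_right (by linarith : 1 - t ≤ 0)]
  have hre : ∀ y : ℝ, 0 < ((σ : ℂ) + y * Complex.I).re := by intro y; simpa using h0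
  have key := mellinInv_mellin_eq σ f (x := 1 / u) (by positivity) (hm σ (by simpa using h0)).1 (by
    refine (integrable_perron_kernel h0 h1).congr (Eventually.of_forall fun y => ?_)
    exact ((hm _ (hre y)).2).symm) (by
    have : ContinuousAt (fun t : ℝ => ((max (1 - t) 0 : ℝ) : ℂ)) (1 / u) := by fun_prop
    refine this.congr ?_
    filter_upwards [lt_mem_nhds (show 0 < 1 / u by positivity)] with t ht
    exact (hfv t ht).symm)
  rw [mellinInv, hfv _ (by positivity)] at key
  have h2 : ∀ y : ℝ, (((1 / u : ℝ) : ℂ)) ^ (-((σ : ℂ) + y * Complex.I)) • mellin f (σ + y * Complex.I)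
      = (u : ℂ) ^ ((σ : ℂ) + y * Complex.I) *
      (1 / (((σ : ℂ) + y * Complex.I) * ((σ : ℂ) + y * Complex.I + 1))) := by
    intro y
    rw [(hm _ (hre y)).2, smul_eq_mul]
    congr 1
    rw [one_div, Complex.ofReal_inv, Complex.inv_cpow, Complex.cpow_neg, inv_inv]
    rw [Complex.arg_ofReal_of_nonneg hu.le]
    exact Real.pi_pos.ne
  simp_rw [h2] at key
  rw [← key]
  have : (Real.pi : ℂ) ≠ 0 := by exact_mod_cast Real.pi_ne_zero
  rw [Complex.real_smul, ← mul_assoc]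
  push_cast
  rw [mul_one_div_cancel (mul_ne_zero two_ne_zero this), one_mul]

/-- The smoothed sum `∑_{n ≤ x} μ(n)/n (1 - n/x)`. -/
noncomputable def smoothMoebius (x : ℝ) : ℝ :=
  ∑ n ∈ Icc 1 ⌊x⌋₊, (ArithmeticFunction.moebius n : ℝ) / n * (1 - n / x)

/-- The Perron integrand `x^s / (s (s+1) ζ(1+s))`. -/
noncomputable def perronInt (x : ℝ) (s : ℂ) : ℂ :=
  (x : ℂ) ^ s / ((s + 1) * riemannZeta₁ (1 + s))

theorem perron_term_eq {σ : ℝ} {x : ℝ} (hx : 0 < x) {n : ℕ} (hn : 1 ≤ n) (y : ℝ) :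
    LSeries.term (fun k => (ArithmeticFunction.moebius k : ℂ)) (1 + ((σ : ℂ) + y * Complex.I)) n *
      (x : ℂ) ^ ((σ : ℂ) + y * Complex.I) *
      (1 / (((σ : ℂ) + y * Complex.I) * ((σ : ℂ) + y * Complex.I + 1))) =
    (ArithmeticFunction.moebius n : ℂ) / n * (((x / n : ℝ) : ℂ) ^ ((σ : ℂ) + y * Complex.I) *
      (1 / (((σ : ℂ) + y * Complex.I) * ((σ : ℂ) + y * Complex.I + 1)))) := by
  have hn0 : (n : ℂ) ≠ 0 := by exact_mod_cast (by omega : n ≠ 0)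
  rw [LSeries.term_of_ne_zero (by omega), Complex.cpow_add _ _ hn0, Complex.cpow_one,
    div_eq_mul_inv x, Complex.ofReal_mul, Complex.mul_cpow_ofReal_nonneg hx.le (by positivity),
    Complex.ofReal_inv, Complex.inv_cpow, Complex.ofReal_natCast]
  · field_simp
  · rw [Complex.ofReal_natCast, Complex.natCast_arg]
    exact Real.pi_pos.ne

theorem integral_perronInt {σ : ℝ} (h0 : 0 < σ) (h1 : σ ≤ 1) {x : ℝ} (hx : 1 ≤ x) :
    ∫ y : ℝ, perronInt x ((σ : ℂ) + y * Complex.I) = 2 * Real.pi * (smoothMoebius x : ℂ) := by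
  have hx0 : 0 < x := by linarith
  set F : ℕ → ℝ → ℂ := fun n y =>
    LSeries.term (fun k => (ArithmeticFunction.moebius k : ℂ)) (1 + ((σ : ℂ) + y * Complex.I)) n *
      (x : ℂ) ^ ((σ : ℂ) + y * Complex.I) *
      (1 / (((σ : ℂ) + y * Complex.I) * ((σ : ℂ) + y * Complex.I + 1))) with hF
  have hF0 : F 0 = 0 := by funext y; simp [hF]
  have hk := integrable_perron_kernel h0 h1
  have hcont : ∀ n : ℕ, 1 ≤ n → Continuous fun y : ℝ => ((x / n : ℝ) : ℂ) ^ ((σ : ℂ) + y * Complex.I) := by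
    intro n hn
    have : ((x / n : ℝ) : ℂ) ≠ 0 := by
      have : (0 : ℝ) < n := by exact_mod_cast hn
      exact_mod_cast (by positivity : x / n ≠ 0)
    exact (by fun_prop : Continuous fun y : ℝ => (σ : ℂ) + y * Complex.I).const_cpow (Or.inl this)
  have hnorm : ∀ n y, ‖F n y‖ ≤ ‖LSeries.term (fun k => (ArithmeticFunction.moebius k : ℂ)) (1 + σ : ℂ) n‖ *
      (x ^ σ * ((σ ^ 2)⁻¹ * (1 + y ^ 2)⁻¹)) := by
    intro n y
    rw [hF]
    simp only
    rw [norm_mul, norm_mul, mul_assoc, Complex.norm_cpow_eq_rpow_re_of_pos hx0]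
    have e : ‖LSeries.term (fun k => (ArithmeticFunction.moebius k : ℂ)) (1 + ((σ : ℂ) + y * Complex.I)) n‖
        = ‖LSeries.term (fun k => (ArithmeticFunction.moebius k : ℂ)) (1 + σ : ℂ) n‖ := by
      rw [LSeries.norm_term_eq, LSeries.norm_term_eq]
      simp
    rw [e]
    have e2 : ((σ : ℂ) + y * Complex.I).re = σ := by simp
    rw [e2]
    gcongr
    exact norm_perron_kernel_le h0 h1 y
  have hInt : ∀ n, Integrable (F n) := by
    intro n
    rcases Nat.eq_zero_or_pos n with rfl | hn
    · rw [hF0]; exact integrable_zero _ _ _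
    · refine ((integrable_inv_one_add_sq.const_mul ((σ ^ 2)⁻¹)).const_mul (x ^ σ)).const_mul
        ‖LSeries.term (fun k => (ArithmeticFunction.moebius k : ℂ)) (1 + σ : ℂ) n‖ |>.mono' ?_
        (Eventually.of_forall (hnorm n))
      refine Continuous.aestronglyMeasurable ?_
      have : F n = fun y : ℝ => (ArithmeticFunction.moebius n : ℂ) / n *
          (((x / n : ℝ) : ℂ) ^ ((σ : ℂ) + y * Complex.I) *
          (1 / (((σ : ℂ) + y * Complex.I) * ((σ : ℂ) + y * Complex.I + 1)))) := by
        funext y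
        exact perron_term_eq hx0 hn y
      rw [this]
      exact continuous_const.mul ((hcont n hn).mul (continuous_perron_kernel h0))
  have hsumL : Summable fun n => ‖LSeries.term (fun k => (ArithmeticFunction.moebius k : ℂ)) (1 + σ : ℂ) n‖ :=
    (ArithmeticFunction.LSeriesSummable_moebius_iff.2 (by simp; exact h0)).norm
  have hsum : Summable fun n => ∫ y, ‖F n y‖ := by
    refine Summable.of_nonneg_of_le (fun n => integral_nonneg fun y => norm_nonneg _) (fun n => ?_)
      (hsumL.mul_right (∫ y : ℝ, x ^ σ * ((σ ^ 2)⁻¹ * (1 + y ^ 2)⁻¹)))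
    rw [← integral_const_mul]
    exact integral_mono (hInt n).norm
      (((integrable_inv_one_add_sq.const_mul ((σ ^ 2)⁻¹)).const_mul (x ^ σ)).const_mul _) (hnorm n)
  have key := hasSum_integral_of_summable_integral_norm hInt hsum
  have hval : ∀ n : ℕ, ∫ y, F n y = 2 * Real.pi *
      (((ArithmeticFunction.moebius n : ℝ) / n * max (1 - n / x) 0 : ℝ) : ℂ) := by
    intro n
    rcases Nat.eq_zero_or_pos n with rfl | hn
    · simp [hF0]
    · have hn' : (0 : ℝ) < n := by exact_mod_cast hn
      have : ∀ y, F n y = (ArithmeticFunction.moebius n : ℂ) / n *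
          (((x / n : ℝ) : ℂ) ^ ((σ : ℂ) + y * Complex.I) *
          (1 / (((σ : ℂ) + y * Complex.I) * ((σ : ℂ) + y * Complex.I + 1)))) :=
        fun y => perron_term_eq hx0 hn y
      simp_rw [this]
      rw [integral_const_mul, integral_cpow_perron_kernel h0 h1 (by positivity), one_div_div]
      push_cast
      ring
  have hts : ∀ y : ℝ, ∑' n, F n y = perronInt x ((σ : ℂ) + y * Complex.I) := by
    intro y
    set s : ℂ := (σ : ℂ) + y * Complex.I with hs
    have hsre : s.re = σ := by simp [hs]
    have h1s : 1 < (1 + s).re := by simp [hsre, h0]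
    have hs0 : s ≠ 0 := fun h => by rw [h] at hsre; simp at hsre; linarith
    have hs1 : s + 1 ≠ 0 := fun h => by
      have := congrArg Complex.re h
      simp [hsre] at this
      linarith
    have e1 := ArithmeticFunction.LSeries_zeta_mul_Lseries_moebius h1s
    rw [ArithmeticFunction.LSeries_zeta_eq_riemannZeta h1s] at e1
    have hz : riemannZeta (1 + s) ≠ 0 := left_ne_zero_of_mul_eq_one e1
    simp only [hF]
    rw [tsum_mul_right, tsum_mul_right]
    change LSeries _ (1 + s) * _ * _ = _
    rw [eq_inv_of_mul_eq_one_right e1, perronInt, riemannZeta₁_eq (by simpa using hs0)]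
    rw [show (1 + s - 1) = s by ring, ← hs]
    field_simp
  simp_rw [hts] at key
  refine key.unique ?_
  simp_rw [hval]
  refine HasSum.mul_left _ ?_
  rw [Complex.hasSum_ofReal]
  have : smoothMoebius x = ∑ n ∈ Icc 1 ⌊x⌋₊, (ArithmeticFunction.moebius n : ℝ) / n * max (1 - n / x) 0 := by
    refine sum_congr rfl fun n hn => ?_
    rw [max_eq_left]
    have : (n : ℝ) ≤ x := (Nat.le_floor_iff hx0.le).1 (mem_Icc.1 hn).2
    rw [sub_nonneg, div_le_one hx0]
    exact this
  rw [this]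
  refine hasSum_sum_of_ne_finset_zero fun n hn => ?_
  rcases Nat.eq_zero_or_pos n with rfl | hn0
  · simp
  · have : x < n := by
      by_contra h
      exact hn (mem_Icc.2 ⟨hn0, Nat.le_floor (not_lt.1 h)⟩)
    rw [max_eq_right, mul_zero]
    rw [sub_nonpos, one_le_div hx0]
    exact this.le

theorem norm_integral_Ioi_le_of_sq {g : ℝ → ℂ} {M T : ℝ} (hT : 0 < T)
    (h : ∀ y, T < y → ‖g y‖ ≤ M * y ^ (-2 : ℝ)) : ‖∫ y in Set.Ioi T, g y‖ ≤ M / T := by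
  have hi := integrableOn_Ioi_rpow_of_lt (show (-2 : ℝ) < -1 by norm_num) hT
  have := norm_integral_le_of_norm_le (μ := volume.restrict (Set.Ioi T)) (f := g)
    (hi.const_mul M) ((ae_restrict_iff' measurableSet_Ioi).2 (Eventually.of_forall h))
  refine this.trans (le_of_eq ?_)
  rw [integral_const_mul, integral_Ioi_rpow_of_lt (by norm_num) hT]
  norm_num
  rw [Real.rpow_neg_one]
  rfl

theorem norm_integral_sub_interval_le_of_sq {g : ℝ → ℂ} (hg : Integrable g) {M T : ℝ} (hT : 0 < T)
    (h : ∀ y, T < |y| → ‖g y‖ ≤ M * |y| ^ (-2 : ℝ)) :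
    ‖(∫ y, g y) - ∫ y in (-T)..T, g y‖ ≤ 2 * M / T := by
  have e1 := intervalIntegral.integral_Iic_add_Ioi (b := -T) hg.integrableOn hg.integrableOn
  have e2 := intervalIntegral.integral_interval_add_Ioi (a := -T) (b := T) (μ := volume)
    hg.integrableOn hg.integrableOn
  have e3 : ∫ y in Set.Iic (-T), g y = ∫ y in Set.Ioi T, g (-y) := (integral_comp_neg_Ioi T g).symm
  rw [← e1, ← e2, e3]
  rw [show ∀ a b c : ℂ, a + (b + c) - b = a + c by intros; ring]
  have h1 := norm_integral_Ioi_le_of_sq (g := fun y => g (-y)) (M := M) hT (fun y hy => by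
    have := h (-y) (by rw [abs_neg, abs_of_pos (by linarith)]; exact hy)
    rwa [abs_neg, abs_of_pos (by linarith)] at this)
  have h2 := norm_integral_Ioi_le_of_sq (g := g) (M := M) hT (fun y hy => by
    have := h y (by rw [abs_of_pos (by linarith)]; exact hy)
    rwa [abs_of_pos (by linarith)] at this)
  refine (norm_add_le _ _).trans ((add_le_add h1 h2).trans (le_of_eq (by ring)))

theorem norm_integral_vertical_shift_le {H : ℂ → ℂ} {a b T M₁ M₂ : ℝ} (hab : a ≤ b) (hT : 0 ≤ T)
    (hH : DifferentiableOn ℂ H {s | s.re ∈ Set.Icc a b ∧ |s.im| ≤ T})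
    (h₁ : ∀ s : ℂ, s.re = a → |s.im| ≤ T → ‖H s‖ ≤ M₁)
    (h₂ : ∀ s : ℂ, s.re ∈ Set.Icc a b → |s.im| = T → ‖H s‖ ≤ M₂) :
    ‖∫ y in (-T)..T, H ((b : ℂ) + y * Complex.I)‖ ≤ M₁ * (2 * T) + 2 * (M₂ * (b - a)) := by
  have key := Complex.integral_boundary_rect_eq_zero_of_differentiableOn H
    ((a : ℂ) + (-T : ℝ) * Complex.I) ((b : ℂ) + (T : ℝ) * Complex.I) (by
      refine hH.mono fun s hs => ?_
      rw [Complex.mem_reProdIm] at hs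
      simp only [Complex.add_re, Complex.ofReal_re, Complex.mul_re, Complex.I_re, mul_zero,
        Complex.ofReal_im, Complex.I_im, mul_one, sub_self, add_zero, Complex.add_im,
        Complex.mul_im, zero_add, Set.uIcc_of_le hab, Set.uIcc_of_le (by linarith : -T ≤ T)] at hs
      exact ⟨hs.1, abs_le.2 hs.2⟩)
  simp only [Complex.add_re, Complex.ofReal_re, Complex.mul_re, Complex.I_re, mul_zero,
        Complex.ofReal_im, Complex.I_im, mul_one, sub_self, add_zero, Complex.add_im,
        Complex.mul_im, zero_add] at key
  set A := ∫ x in a..b, H (x + (-T : ℝ) * Complex.I)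
  set B := ∫ x in a..b, H (x + (T : ℝ) * Complex.I)
  set C := ∫ y in (-T)..T, H ((b : ℂ) + y * Complex.I)
  set D := ∫ y in (-T)..T, H ((a : ℂ) + y * Complex.I)
  have hA : ‖A‖ ≤ M₂ * (b - a) := by
    have := intervalIntegral.norm_integral_le_of_norm_le_const (a := a) (b := b) (C := M₂)
      (f := fun x : ℝ => H (x + (-T : ℝ) * Complex.I)) (fun x hx => by
        rw [Set.uIoc_of_le hab] at hx
        exact h₂ _ (by simpa using ⟨hx.1.le, hx.2⟩) (by simp [abs_of_nonneg hT]))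
    rwa [abs_of_nonneg (by linarith)] at this
  have hB : ‖B‖ ≤ M₂ * (b - a) := by
    have := intervalIntegral.norm_integral_le_of_norm_le_const (a := a) (b := b) (C := M₂)
      (f := fun x : ℝ => H (x + (T : ℝ) * Complex.I)) (fun x hx => by
        rw [Set.uIoc_of_le hab] at hx
        exact h₂ _ (by simpa using ⟨hx.1.le, hx.2⟩) (by simp [abs_of_nonneg hT]))
    rwa [abs_of_nonneg (by linarith)] at this
  have hD : ‖D‖ ≤ M₁ * (2 * T) := by
    have := intervalIntegral.norm_integral_le_of_norm_le_const (a := -T) (b := T) (C := M₁)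
      (f := fun y : ℝ => H ((a : ℂ) + y * Complex.I)) (fun x hx => by
        rw [Set.uIoc_of_le (by linarith)] at hx
        exact h₁ _ (by simp) (by simpa using abs_le.2 ⟨hx.1.le, hx.2⟩))
    rwa [show T - -T = 2 * T by ring, abs_of_nonneg (by linarith)] at this
  have hC : C = D + Complex.I * (A - B) := by
    have h2 : Complex.I * (A - B + Complex.I * C - Complex.I * D) = 0 := by
      simp only [smul_eq_mul] at key
      rw [key, mul_zero]
    have : Complex.I * Complex.I = -1 := Complex.I_mul_I
    linear_combination (-1 : ℂ) * h2 + (C - D) * this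
  rw [hC]
  refine (norm_add_le _ _).trans ?_
  rw [norm_mul, Complex.norm_I, one_mul]
  have := norm_sub_le A B
  linarith

theorem perronInt_eq {x : ℝ} {s : ℂ} (hs : s ≠ 0) :
    perronInt x s = (x : ℂ) ^ s * (1 / (s * (s + 1))) * (riemannZeta (1 + s))⁻¹ := by
  rw [perronInt, riemannZeta₁_eq (by simpa using hs), show (1 + s - 1) = s by ring]
  simp only [div_eq_mul_inv, mul_inv, one_mul]
  ring

theorem differentiableAt_perronInt {x : ℝ} (hx : 0 < x) {s : ℂ} (h1 : s + 1 ≠ 0)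
    (h2 : riemannZeta₁ (1 + s) ≠ 0) : DifferentiableAt ℂ (perronInt x) s := by
  unfold perronInt
  refine DifferentiableAt.div ?_ ?_ (mul_ne_zero h1 h2)
  · exact differentiableAt_id.const_cpow (Or.inl (by exact_mod_cast hx.ne'))
  · exact (differentiableAt_id.add_const 1).mul
      ((differentiable_riemannZeta₁ _).comp s (differentiableAt_id.const_add 1))

theorem abs_smoothMoebius_le {η a T B Z x : ℝ} (hη0 : 0 ≤ η) (hη : η ≤ 1 / 2) (ha0 : 0 < a) (ha : a ≤ 1)
    (hT : 1 ≤ T) (hx : 1 ≤ x)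
    (hB : ∀ s : ℂ, |s.im| ≤ T → 1 - η ≤ s.re → s.re ≤ 2 → riemannZeta₁ s ≠ 0 ∧ ‖riemannZeta₁ s‖⁻¹ ≤ B)
    (hZ : ∀ s : ℂ, s.re = 1 + a → ‖riemannZeta s‖⁻¹ ≤ Z) :
    |smoothMoebius x| ≤ 2 * (x ^ a * Z) / T + (2 * B * x ^ (-η)) * (2 * T) + 2 * (x ^ a * B / T * (a + η)) := by
  have hx0 : 0 < x := by linarith
  have hB0 : 0 ≤ B := (inv_nonneg.2 (norm_nonneg _)).trans (hB 2 (by simp; linarith) (by simp; linarith) (by simp)).2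
  have hZ0 : 0 ≤ Z := (inv_nonneg.2 (norm_nonneg _)).trans (hZ (1 + a : ℝ) (by simp))
  have hs0 : ∀ y : ℝ, (a : ℂ) + y * Complex.I ≠ 0 := fun y h => by
    have := congrArg Complex.re h
    simp at this
    linarith
  have hnorm : ∀ y : ℝ, ‖perronInt x ((a : ℂ) + y * Complex.I)‖ ≤
      x ^ a * Z * ‖1 / (((a : ℂ) + y * Complex.I) * ((a : ℂ) + y * Complex.I + 1))‖ := by
    intro y
    rw [perronInt_eq (hs0 y), norm_mul, norm_mul, norm_inv, Complex.norm_cpow_eq_rpow_re_of_pos hx0]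
    have := hZ (1 + ((a : ℂ) + y * Complex.I)) (by simp)
    have e : ((a : ℂ) + y * Complex.I).re = a := by simp
    rw [e, mul_right_comm]
    gcongr
  have hcont : Continuous fun y : ℝ => perronInt x ((a : ℂ) + y * Complex.I) := by
    rw [continuous_iff_continuousAt]
    intro y
    have := (differentiableAt_perronInt hx0 (s := (a : ℂ) + y * Complex.I) (fun h => by
      have := congrArg Complex.re h
      simp at this
      linarith) (riemannZeta₁_ne_zero_of_one_le_re (by simp; linarith))).continuousAt
    exact ContinuousAt.comp (f := fun y : ℝ => (a : ℂ) + y * Complex.I) this (by fun_prop)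
  have hInt : Integrable fun y : ℝ => perronInt x ((a : ℂ) + y * Complex.I) :=
    ((integrable_perron_kernel ha0 ha).norm.const_mul (x ^ a * Z)).mono' hcont.aestronglyMeasurable
      (Eventually.of_forall hnorm)
  have htail := norm_integral_sub_interval_le_of_sq hInt (M := x ^ a * Z) (T := T) (by linarith) (fun y hy => by
    have hy0 : 0 < |y| := by linarith
    refine (hnorm y).trans ?_
    refine mul_le_mul_of_nonneg_left ?_ (by positivity)
    have b1 : |y| ≤ ‖(a : ℂ) + y * Complex.I‖ := by
      simpa using Complex.abs_im_le_norm ((a : ℂ) + y * Complex.I)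
    have b2 : |y| ≤ ‖(a : ℂ) + y * Complex.I + 1‖ := by
      simpa using Complex.abs_im_le_norm ((a : ℂ) + y * Complex.I + 1)
    rw [Real.rpow_neg hy0.le, norm_div, norm_one, norm_mul, one_div]
    refine inv_anti₀ (by positivity) ?_
    rw [Real.rpow_two, sq]
    gcongr)
  have hn1 : ∀ s : ℂ, -η ≤ s.re → 1 / 2 ≤ ‖s + 1‖ := by
    intro s hs
    have := Complex.re_le_norm (s + 1)
    simp at this
    linarith
  have hmid := norm_integral_vertical_shift_le (H := perronInt x) (a := -η) (b := a) (T := T)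
    (M₁ := 2 * B * x ^ (-η)) (M₂ := x ^ a * B / T) (by linarith) (by linarith)
    (fun s hs => by
      refine (differentiableAt_perronInt hx0 ?_ ?_).differentiableWithinAt
      · have := hn1 s hs.1.1
        intro h
        rw [h, norm_zero] at this
        linarith
      · exact (hB (1 + s) (by simpa using hs.2) (by simp; linarith [hs.1.1]) (by simp; linarith [hs.1.2])).1)
    (fun s hs hs2 => by
      have h1 := (hB (1 + s) (by simpa using hs2) (by simp [hs]) (by simp [hs]; linarith)).2
      have h2 := hn1 s hs.ge
      rw [perronInt, norm_div, norm_mul, Complex.norm_cpow_eq_rpow_re_of_pos hx0, hs, div_eq_mul_inv, mul_inv]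
      have h3 : ‖s + 1‖⁻¹ ≤ 2 := by
        rw [show (2 : ℝ) = (1 / 2)⁻¹ by norm_num]
        exact inv_anti₀ (by norm_num) h2
      calc x ^ (-η) * (‖s + 1‖⁻¹ * ‖riemannZeta₁ (1 + s)‖⁻¹) ≤ x ^ (-η) * (2 * B) := by gcongr
        _ = _ := by ring)
    (fun s hs hs2 => by
      have h1 := (hB (1 + s) (by simpa using hs2.le) (by simp; linarith [hs.1]) (by simp; linarith [hs.2])).2
      rw [perronInt, norm_div, norm_mul, Complex.norm_cpow_eq_rpow_re_of_pos hx0, div_eq_mul_inv, mul_inv]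
      have h3 : ‖s + 1‖⁻¹ ≤ T⁻¹ := by
        refine inv_anti₀ (by linarith) ?_
        rw [← hs2]
        simpa using Complex.abs_im_le_norm (s + 1)
      calc x ^ s.re * (‖s + 1‖⁻¹ * ‖riemannZeta₁ (1 + s)‖⁻¹) ≤ x ^ a * (T⁻¹ * B) := by
            gcongr
            exact hs.2
        _ = _ := by ring)
  rw [integral_perronInt ha0 ha hx] at htail
  have hfin : ‖(2 * Real.pi * (smoothMoebius x : ℂ))‖ = 2 * Real.pi * |smoothMoebius x| := by
    rw [norm_mul, norm_mul, Complex.norm_real, Complex.norm_real, Real.norm_of_nonneg Real.pi_pos.le,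
      Real.norm_eq_abs]
    norm_num
  have htri := norm_sub_norm_le (2 * Real.pi * (smoothMoebius x : ℂ))
    (∫ y in (-T)..T, perronInt x ((a : ℂ) + y * Complex.I))
  rw [hfin] at htri
  have hpi : |smoothMoebius x| ≤ 2 * Real.pi * |smoothMoebius x| := by
    have := Real.pi_gt_three
    nlinarith [abs_nonneg (smoothMoebius x)]
  have : a - -η = a + η := by ring
  rw [this] at hmid
  linarith

/-- The exponent in `curlyL`, as a function of `log y`. -/
noncomputable def vkExp (X : ℝ) : ℝ := X ^ ((3 : ℝ) / 5) / (Real.log X) ^ ((1 : ℝ) / 5)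

theorem curlyL_eq_exp (y : ℝ) : curlyL y = Real.exp (vkExp (Real.log y)) := rfl

theorem rpow_le_vkExp {X : ℝ} (hX : 1 < X) : X ^ ((2 : ℝ) / 5) ≤ vkExp X := by
  have hl : 0 < Real.log X := Real.log_pos hX
  rw [vkExp, le_div_iff₀ (by positivity)]
  calc X ^ ((2 : ℝ) / 5) * Real.log X ^ ((1 : ℝ) / 5) ≤ X ^ ((2 : ℝ) / 5) * X ^ ((1 : ℝ) / 5) := by
        have := Real.log_le_self (by linarith : 0 ≤ X)
        gcongr
    _ = X ^ ((3 : ℝ) / 5) := by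
        rw [← Real.rpow_add (by linarith)]
        norm_num

theorem vkExp_le_self {X : ℝ} (hX : 1 ≤ X) (hl : 1 ≤ Real.log X) : vkExp X ≤ X := by
  rw [vkExp, div_le_iff₀ (by positivity)]
  calc X ^ ((3 : ℝ) / 5) ≤ X ^ (1 : ℝ) := Real.rpow_le_rpow_of_exponent_le hX (by norm_num)
    _ = X * 1 := by rw [Real.rpow_one, mul_one]
    _ ≤ _ := by
        gcongr
        exact Real.one_le_rpow hl (by norm_num)

theorem eventually_log_le_vkExp (K : ℝ) {ε : ℝ} (hε : 0 < ε) :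
    ∀ᶠ X : ℝ in atTop, K * Real.log X + K ≤ ε * vkExp X := by
  have h := (isLittleO_log_rpow_atTop (show (0 : ℝ) < 2 / 5 by norm_num)).bound
    (show 0 < ε / (2 * |K| + 1) by positivity)
  filter_upwards [h, Real.tendsto_log_atTop.eventually_ge_atTop 1, eventually_gt_atTop 1] with X h1 h2 h3
  rw [Real.norm_of_nonneg (by linarith), Real.norm_of_nonneg (by positivity), div_mul_eq_mul_div,
    le_div_iff₀ (by positivity)] at h1
  have h4 := rpow_le_vkExp h3
  have h5 : K * Real.log X + K ≤ Real.log X * (2 * |K| + 1) := by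
    have a1 : K * Real.log X ≤ |K| * Real.log X := by gcongr; exact le_abs_self K
    have a2 : K ≤ |K| * Real.log X := (le_abs_self K).trans (le_mul_of_one_le_right (abs_nonneg _) h2)
    nlinarith
  have h6 : ε * X ^ ((2 : ℝ) / 5) ≤ ε * vkExp X := by gcongr
  linarith

theorem tendsto_vkExp_atTop : Tendsto vkExp atTop atTop := by
  refine tendsto_atTop_mono' atTop ?_ (tendsto_rpow_atTop (show (0 : ℝ) < 2 / 5 by norm_num))
  filter_upwards [eventually_gt_atTop 1] with X hX using rpow_le_vkExp hX

theorem vk_zero_free_width_mul {c b X l : ℝ} (hb : 0 < b) (hX : 0 < X) (hl : 0 < l) :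
    c / ((b * (X ^ ((3 : ℝ) / 5) / l ^ ((1 : ℝ) / 5))) ^ ((2 : ℝ) / 3) * l ^ ((1 : ℝ) / 3)) * X =
      c * (b ^ ((2 : ℝ) / 3))⁻¹ * (X ^ ((3 : ℝ) / 5) / l ^ ((1 : ℝ) / 5)) := by
  rw [Real.mul_rpow hb.le (by positivity), Real.div_rpow (by positivity) (by positivity),
    ← Real.rpow_mul hX.le, ← Real.rpow_mul hl.le]
  have e1 : X = X ^ ((3 : ℝ) / 5 * (2 / 3)) * X ^ ((3 : ℝ) / 5) := by
    rw [← Real.rpow_add hX]; norm_num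
  have e2 : l ^ ((1 : ℝ) / 3) = l ^ ((1 : ℝ) / 5 * (2 / 3)) * l ^ ((1 : ℝ) / 5) := by
    rw [← Real.rpow_add hl]; norm_num
  rw [e2]
  nth_rewrite 2 [e1]
  have := (Real.rpow_pos_of_pos hX (3 / 5 * (2 / 3))).ne'
  have := (Real.rpow_pos_of_pos hl (1 / 5 * (2 / 3))).ne'
  have := (Real.rpow_pos_of_pos hl (1 / 5)).ne'
  field_simp

set_option maxHeartbeats 1000000 in
theorem exists_smoothMoebius_bound : ∃ b > (0 : ℝ), ∃ X₀ : ℝ, ∀ x : ℝ, X₀ ≤ Real.log x → 1 ≤ x →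
    |smoothMoebius x| ≤ Real.exp (-(b * vkExp (Real.log x))) := by
  obtain ⟨c0, hc0, L₀, hL₀⟩ := exists_inv_zeta_bound
  obtain ⟨C, hC1, hC⟩ := exists_bound_near_one
  obtain ⟨c, hc, hcc0, hc2⟩ : ∃ c > 0, c ≤ c0 ∧ c ≤ 1 / 2 :=
    ⟨min c0 (1 / 2), by positivity, min_le_left _ _, min_le_right _ _⟩
  set b := c / 2 with hb
  have hb0 : 0 < b := by positivity
  have hb1 : b ≤ 1 := by linarith
  set A : ℝ := 8 * Real.exp 1 * C + 1 + 16 * Real.exp 1 with hA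
  have hA0 : 0 < A := by positivity
  have hev : ∀ᶠ X : ℝ in atTop, max (max L₀ 2) (Real.log 4) ≤ b * vkExp X ∧ 1 ≤ X ∧ 1 ≤ Real.log X ∧
      Real.log A + 8026 * Real.log X ≤ b / 2 * vkExp X := by
    filter_upwards [(tendsto_vkExp_atTop.const_mul_atTop hb0).eventually_ge_atTop (max (max L₀ 2) (Real.log 4)),
      eventually_ge_atTop 1, Real.tendsto_log_atTop.eventually_ge_atTop 1,
      eventually_log_le_vkExp (|Real.log A| + 8026) (show 0 < b / 2 by positivity)] with X h1 h2 h3 h4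
    refine ⟨h1, h2, h3, ?_⟩
    have := le_abs_self (Real.log A)
    have : 0 ≤ |Real.log A| * Real.log X := by positivity
    linarith
  obtain ⟨X₀, hX₀⟩ := eventually_atTop.1 hev
  refine ⟨b / 2, by positivity, X₀, fun x hx hx1 => ?_⟩
  obtain ⟨h1, h2, h3, h4⟩ := hX₀ _ hx
  clear hev hX₀
  have hx0 : 0 < x := by linarith
  set X := Real.log x with hX
  set l := Real.log X with hl
  set L := b * vkExp X with hLd
  have hX0 : 0 < X := by linarith
  have hl0 : 0 < l := by linarith
  have hLL₀ : L₀ ≤ L := (le_max_left _ _).trans ((le_max_left _ _).trans h1)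
  have hL2 : 2 ≤ L := (le_max_right _ _).trans ((le_max_left _ _).trans h1)
  have hL1 : 1 ≤ L := by linarith
  have hL4 : Real.log 4 ≤ L := (le_max_right _ _).trans h1
  have hvX : vkExp X ≤ X := vkExp_le_self h2 h3
  have hv0 : 0 ≤ vkExp X := by
    by_contra h
    have : L ≤ 0 := mul_nonpos_of_nonneg_of_nonpos hb0.le (not_le.1 h).le
    linarith
  have hLX : L ≤ X := by
    have : b * vkExp X ≤ 1 * vkExp X := by gcongr
    linarith
  have hlogL : Real.log L ≤ l := Real.log_le_log (by linarith) hLX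
  have hlogL0 : 0 < Real.log L := Real.log_pos (by linarith)
  set η := c / (L ^ ((2 : ℝ) / 3) * l ^ ((1 : ℝ) / 3)) with hη
  have hη0 : 0 ≤ η := by positivity
  have hden : 1 ≤ L ^ ((2 : ℝ) / 3) * l ^ ((1 : ℝ) / 3) :=
    one_le_mul_of_one_le_of_one_le (Real.one_le_rpow hL1 (by norm_num)) (Real.one_le_rpow h3 (by norm_num))
  have hη2 : η ≤ 1 / 2 := by
    rw [hη, div_le_iff₀ (by linarith)]
    nlinarith
  have hηX : 2 * L ≤ η * X := by
    have e : η * X = c * (b ^ ((2 : ℝ) / 3))⁻¹ * vkExp X := vk_zero_free_width_mul hb0 hX0 hl0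
    have : 1 ≤ (b ^ ((2 : ℝ) / 3))⁻¹ :=
      (one_le_inv₀ (by positivity)).2 (Real.rpow_le_one hb0.le hb1 (by norm_num))
    rw [e, hLd, hb]
    calc 2 * (c / 2 * vkExp X) = c * 1 * vkExp X := by ring
      _ ≤ _ := by gcongr
  have hxa : x ^ (1 / X) = Real.exp 1 := by
    rw [Real.rpow_def_of_pos hx0, ← hX, mul_one_div_cancel hX0.ne']
  have hxη : x ^ (-η) ≤ Real.exp (-L) * Real.exp (-L) := by
    rw [Real.rpow_def_of_pos hx0, ← hX, ← Real.exp_add, Real.exp_le_exp]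
    linarith
  set P : ℝ := X ^ 8026 with hP
  have hP1 : 1 ≤ P := one_le_pow₀ h2
  have hPX : X ≤ P := le_self_pow₀ h2 (by norm_num)
  have hLP : L ^ 8026 ≤ P := pow_le_pow_left₀ (by linarith) hLX _
  have hPe : A * P ≤ Real.exp (b / 2 * vkExp X) := by
    have e : P = Real.exp (8026 * Real.log X) := by
      rw [show (8026 : ℝ) = ((8026 : ℕ) : ℝ) by norm_num, Real.exp_nat_mul, Real.exp_log hX0]
    calc A * P = Real.exp (Real.log A + 8026 * Real.log X) := by rw [Real.exp_add, Real.exp_log hA0, e]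
      _ ≤ _ := Real.exp_le_exp.2 h4
  have hT4 : 4 ≤ Real.exp L := by
    rw [← Real.exp_log (show (0 : ℝ) < 4 by norm_num)]
    exact Real.exp_le_exp.2 hL4
  have hmain := abs_smoothMoebius_le (η := η) (a := 1 / X) (T := Real.exp L / 4) (B := P) (Z := C * X) (x := x)
    hη0 hη2 (by positivity) (by rw [div_le_one hX0]; exact h2) (by linarith) hx1
    (fun s hs1 hs2 hs3 => by
      have hc1 : η ≤ c0 / (L ^ ((2 : ℝ) / 3) * Real.log L ^ ((1 : ℝ) / 3)) := by
        rw [hη]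
        gcongr
      have := hL₀ (Real.exp L) (by rwa [Real.log_exp]) s hs1 (by rw [Real.log_exp]; linarith) hs3
      rw [Real.log_exp] at this
      exact ⟨this.1, this.2.trans hLP⟩)
    (fun s hs => by
      refine (norm_inv_zeta_le (by rw [hs]; simpa using hX0)).trans ?_
      rw [hs]
      have := (hC (1 / X) (by positivity) (by rw [div_le_one hX0]; exact h2)).2
      rwa [div_div_eq_mul_div, div_one] at this)
  rw [hxa] at hmain
  clear_value P
  have hE0 : 0 < Real.exp (-L) := Real.exp_pos _
  have hE : (Real.exp L)⁻¹ = Real.exp (-L) := (Real.exp_neg L).symm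
  have hEE : Real.exp (-L) * Real.exp L = 1 := by rw [← Real.exp_add]; simp
  have t1 : 2 * (Real.exp 1 * (C * X)) / (Real.exp L / 4) ≤ 8 * Real.exp 1 * C * P * Real.exp (-L) := by
    rw [← hE, div_div_eq_mul_div, div_eq_mul_inv]
    gcongr ?_ * _
    have : 0 ≤ 8 * Real.exp 1 * C := by positivity
    nlinarith
  have t2 : (2 * P * x ^ (-η)) * (2 * (Real.exp L / 4)) ≤ P * Real.exp (-L) := by
    calc (2 * P * x ^ (-η)) * (2 * (Real.exp L / 4)) ≤
        (2 * P * (Real.exp (-L) * Real.exp (-L))) * (2 * (Real.exp L / 4)) := by gcongr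
      _ = P * Real.exp (-L) * (Real.exp (-L) * Real.exp L) := by ring
      _ = _ := by rw [hEE, mul_one]
  have t3 : 2 * (Real.exp 1 * P / (Real.exp L / 4) * (1 / X + η)) ≤ 16 * Real.exp 1 * P * Real.exp (-L) := by
    have : 1 / X + η ≤ 2 := by
      have : 1 / X ≤ 1 := by rw [div_le_one hX0]; exact h2
      linarith
    calc 2 * (Real.exp 1 * P / (Real.exp L / 4) * (1 / X + η)) ≤
        2 * (Real.exp 1 * P / (Real.exp L / 4) * 2) := by gcongr
      _ = _ := by rw [← hE, div_div_eq_mul_div, div_eq_mul_inv]; ring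
  calc |smoothMoebius x| ≤ A * P * Real.exp (-L) := by rw [hA]; linarith
    _ ≤ Real.exp (b / 2 * vkExp X) * Real.exp (-L) := by gcongr
    _ = _ := by rw [← Real.exp_add, hLd]; congr 1; ring

/-- The sum `∑_{n ≤ x} μ(n)/n`. -/
noncomputable def moebiusLogSum (x : ℝ) : ℝ :=
  ∑ n ∈ Icc 1 ⌊x⌋₊, (ArithmeticFunction.moebius n : ℝ) / n

theorem abs_moebius_div_le (n : ℕ) : |(ArithmeticFunction.moebius n : ℝ) / n| ≤ 1 / n := by
  rw [abs_div, Nat.abs_cast]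
  gcongr
  exact_mod_cast ArithmeticFunction.abs_moebius_le_one

theorem abs_moebiusLogSum_le_self {x : ℝ} (hx : 1 ≤ x) : |moebiusLogSum x| ≤ x := by
  calc |moebiusLogSum x| ≤ ∑ n ∈ Icc 1 ⌊x⌋₊, |(ArithmeticFunction.moebius n : ℝ) / n| := abs_sum_le_sum_abs _ _
    _ ≤ ∑ n ∈ Icc 1 ⌊x⌋₊, (1 : ℝ) := by
        refine sum_le_sum fun n hn => (abs_moebius_div_le n).trans ?_
        have : (1 : ℝ) ≤ n := by exact_mod_cast (mem_Icc.1 hn).1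
        rw [div_le_one (by linarith)]
        exact this
    _ = ⌊x⌋₊ := by simp
    _ ≤ x := Nat.floor_le (by linarith)

theorem mul_smoothMoebius {x : ℝ} (hx : 0 < x) :
    x * smoothMoebius x = ∑ n ∈ Icc 1 ⌊x⌋₊, (ArithmeticFunction.moebius n : ℝ) / n * (x - n) := by
  rw [smoothMoebius, mul_sum]
  refine sum_congr rfl fun n _ => ?_
  field_simp

theorem abs_moebiusLogSum_le {x h : ℝ} (hh : 0 < h) (hhx : h ≤ x / 2) :
    |moebiusLogSum x| ≤ x / h * (|smoothMoebius x| + |smoothMoebius (x - h)|) + 2 * (h + 1) / x := by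
  have hx : 0 < x := by linarith
  have hxh : 0 < x - h := by linarith
  have hfl : ⌊x - h⌋₊ ≤ ⌊x⌋₊ := Nat.floor_le_floor (by linarith)
  have split : ∀ f : ℕ → ℝ, ∑ n ∈ Icc 1 ⌊x⌋₊, f n = ∑ n ∈ Icc 1 ⌊x - h⌋₊, f n + ∑ n ∈ Ioc ⌊x - h⌋₊ ⌊x⌋₊, f n := by
    intro f
    rw [← sum_union]
    · congr 1
      ext n
      simp only [mem_union, mem_Icc, mem_Ioc]
      omega
    · rw [disjoint_left]
      intro n h1 h2
      rw [mem_Icc] at h1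
      rw [mem_Ioc] at h2
      omega
  have e : h * moebiusLogSum x = x * smoothMoebius x - (x - h) * smoothMoebius (x - h) +
      ∑ n ∈ Ioc ⌊x - h⌋₊ ⌊x⌋₊, (ArithmeticFunction.moebius n : ℝ) / n * (h - (x - n)) := by
    rw [mul_smoothMoebius hx, mul_smoothMoebius hxh, split, moebiusLogSum, split, mul_add, mul_sum, mul_sum]
    have e1 : ∑ n ∈ Icc 1 ⌊x - h⌋₊, h * ((ArithmeticFunction.moebius n : ℝ) / n) =
        ∑ n ∈ Icc 1 ⌊x - h⌋₊, (ArithmeticFunction.moebius n : ℝ) / n * (x - n) -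
        ∑ n ∈ Icc 1 ⌊x - h⌋₊, (ArithmeticFunction.moebius n : ℝ) / n * (x - h - n) := by
      rw [← sum_sub_distrib]
      exact sum_congr rfl fun n _ => by ring
    have e2 : ∑ n ∈ Ioc ⌊x - h⌋₊ ⌊x⌋₊, h * ((ArithmeticFunction.moebius n : ℝ) / n) =
        ∑ n ∈ Ioc ⌊x - h⌋₊ ⌊x⌋₊, (ArithmeticFunction.moebius n : ℝ) / n * (x - n) +
        ∑ n ∈ Ioc ⌊x - h⌋₊ ⌊x⌋₊, (ArithmeticFunction.moebius n : ℝ) / n * (h - (x - n)) := by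
      rw [← sum_add_distrib]
      exact sum_congr rfl fun n _ => by ring
    rw [e1, e2]
    ring
  have hrem : |∑ n ∈ Ioc ⌊x - h⌋₊ ⌊x⌋₊, (ArithmeticFunction.moebius n : ℝ) / n * (h - (x - n))| ≤
      (h + 1) * (2 / x * h) := by
    calc |∑ n ∈ Ioc ⌊x - h⌋₊ ⌊x⌋₊, (ArithmeticFunction.moebius n : ℝ) / n * (h - (x - n))|
        ≤ ∑ n ∈ Ioc ⌊x - h⌋₊ ⌊x⌋₊, |(ArithmeticFunction.moebius n : ℝ) / n * (h - (x - n))| :=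
          abs_sum_le_sum_abs _ _
      _ ≤ ∑ n ∈ Ioc ⌊x - h⌋₊ ⌊x⌋₊, 2 / x * h := by
          refine sum_le_sum fun n hn => ?_
          have h1 : x - h < n := (Nat.floor_lt hxh.le).1 (mem_Ioc.1 hn).1
          have h2 : (n : ℝ) ≤ x := (Nat.le_floor_iff hx.le).1 (mem_Ioc.1 hn).2
          rw [abs_mul]
          refine mul_le_mul ((abs_moebius_div_le n).trans ?_) ?_ (abs_nonneg _) (by positivity)
          · rw [div_le_div_iff₀ (by linarith) hx]
            linarith
          · rw [abs_le]
            constructor <;> linarith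
      _ = ((⌊x⌋₊ - ⌊x - h⌋₊ : ℕ) : ℝ) * (2 / x * h) := by
          rw [sum_const, Nat.card_Ioc, nsmul_eq_mul]
      _ ≤ (h + 1) * (2 / x * h) := by
          gcongr
          rw [Nat.cast_sub hfl]
          have a1 := Nat.floor_le hx.le
          have a2 := Nat.lt_floor_add_one (x - h)
          linarith
  have h3 : h * |moebiusLogSum x| ≤ x * |smoothMoebius x| + x * |smoothMoebius (x - h)| + (h + 1) * (2 / x * h) := by
    rw [← abs_of_pos hh, ← abs_mul, e, abs_of_pos hh]
    have a1 : |x * smoothMoebius x| = x * |smoothMoebius x| := by rw [abs_mul, abs_of_pos hx]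
    have a2 : |(x - h) * smoothMoebius (x - h)| ≤ x * |smoothMoebius (x - h)| := by
      rw [abs_mul, abs_of_pos hxh]
      gcongr
      linarith
    refine (abs_add_le _ _).trans (add_le_add ((abs_sub _ _).trans ?_) hrem)
    linarith
  have h4 : |moebiusLogSum x| ≤ (x * |smoothMoebius x| + x * |smoothMoebius (x - h)| + (h + 1) * (2 / x * h)) / h := by
    rw [le_div_iff₀ hh]
    linarith
  refine h4.trans (le_of_eq ?_)
  field_simp

theorem half_vkExp_le {X Y : ℝ} (hY : 1 < Y) (h1 : X / 2 ≤ Y) (h2 : Y ≤ X) : vkExp X / 2 ≤ vkExp Y := by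
  have hlY : 0 < Real.log Y := Real.log_pos hY
  have hX : 0 < X := by linarith
  have hl : Real.log Y ≤ Real.log X := Real.log_le_log (by linarith) h2
  unfold vkExp
  calc X ^ ((3 : ℝ) / 5) / Real.log X ^ ((1 : ℝ) / 5) / 2 =
      (X ^ ((3 : ℝ) / 5) / 2) / Real.log X ^ ((1 : ℝ) / 5) := by ring
    _ ≤ (X / 2) ^ ((3 : ℝ) / 5) / Real.log X ^ ((1 : ℝ) / 5) := by
        gcongr
        · exact Real.rpow_nonneg (by linarith) _
        rw [Real.div_rpow hX.le (by norm_num)]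
        gcongr
        calc (2 : ℝ) ^ ((3 : ℝ) / 5) ≤ 2 ^ (1 : ℝ) := Real.rpow_le_rpow_of_exponent_le (by norm_num) (by norm_num)
          _ = 2 := Real.rpow_one 2
    _ ≤ _ := by gcongr

theorem exists_moebiusLogSum_bound : ∃ b > (0 : ℝ), ∃ X₀ : ℝ, ∀ x : ℝ, X₀ ≤ Real.log x → 1 ≤ x →
    |moebiusLogSum x| ≤ 8 * Real.exp (-(b * vkExp (Real.log x))) := by
  obtain ⟨b0, hb0, X₀, hX₀⟩ := exists_smoothMoebius_bound
  obtain ⟨b, hb, hbb0, hb1⟩ : ∃ b > 0, b ≤ b0 ∧ b ≤ 1 := ⟨min b0 1, by positivity, min_le_left _ _, min_le_right _ _⟩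
  have hev : ∀ᶠ X : ℝ in atTop, 2 * Real.log 2 + 2 ≤ X ∧ X₀ + Real.log 2 ≤ X ∧ 1 ≤ Real.log X ∧
      Real.log 2 ≤ b / 4 * vkExp X := by
    filter_upwards [eventually_ge_atTop (2 * Real.log 2 + 2), eventually_ge_atTop (X₀ + Real.log 2),
      Real.tendsto_log_atTop.eventually_ge_atTop 1,
      (tendsto_vkExp_atTop.const_mul_atTop (show 0 < b / 4 by positivity)).eventually_ge_atTop (Real.log 2)]
      with X h1 h2 h3 h4 using ⟨h1, h2, h3, h4⟩
  obtain ⟨X₁, hX₁⟩ := eventually_atTop.1 hev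
  refine ⟨b / 4, by positivity, X₁, fun x hx hx1 => ?_⟩
  obtain ⟨h1, h2, h3, h4⟩ := hX₁ _ hx
  have hx0 : 0 < x := by linarith
  set X := Real.log x with hX
  have hl2 : 0 < Real.log 2 := Real.log_pos (by norm_num)
  set E := Real.exp (-(b / 4 * vkExp X)) with hE
  have hE0 : 0 < E := Real.exp_pos _
  have hE2 : E ≤ 1 / 2 := by
    have : (1 : ℝ) / 2 = Real.exp (-Real.log 2) := by rw [Real.exp_neg, Real.exp_log (by norm_num)]; norm_num
    rw [this, hE, Real.exp_le_exp]
    linarith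
  have hv0 : 0 < vkExp X := by
    by_contra h
    have : b / 4 * vkExp X ≤ 0 := mul_nonpos_of_nonneg_of_nonpos (by positivity) (not_lt.1 h)
    linarith
  have hvX : vkExp X ≤ X := vkExp_le_self (by linarith) h3
  have key := abs_moebiusLogSum_le (x := x) (h := x * E) (by positivity) (by nlinarith)
  have hxh : x / 2 ≤ x - x * E := by nlinarith
  have hY1 : X - Real.log 2 ≤ Real.log (x - x * E) := by
    rw [hX, ← Real.log_div hx0.ne' (by norm_num)]
    exact Real.log_le_log (by positivity) hxh
  have hY2 : Real.log (x - x * E) ≤ X := Real.log_le_log (by linarith) (by nlinarith)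
  have hx2 : 1 ≤ x - x * E := by
    by_contra h
    have : Real.log (x - x * E) ≤ 0 := Real.log_nonpos (by linarith) (by linarith)
    linarith
  have hEE : Real.exp (-(b / 2 * vkExp X)) = E * E := by
    rw [hE, ← Real.exp_add]; congr 1; ring
  have k1 : |smoothMoebius x| ≤ E * E := by
    refine (hX₀ x (by linarith) hx1).trans ?_
    rw [← hEE, Real.exp_le_exp, neg_le_neg_iff, ← hX]
    have : b / 2 ≤ b0 := by linarith
    gcongr
  have k2 : |smoothMoebius (x - x * E)| ≤ E * E := by
    refine (hX₀ _ (by linarith) hx2).trans ?_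
    rw [← hEE, Real.exp_le_exp, neg_le_neg_iff]
    have := half_vkExp_le (X := X) (Y := Real.log (x - x * E)) (by linarith) (by linarith) hY2
    calc b / 2 * vkExp X = b * (vkExp X / 2) := by ring
      _ ≤ b0 * vkExp (Real.log (x - x * E)) := by gcongr
  have k3 : 1 / x ≤ E := by
    rw [hE, one_div, ← Real.exp_log hx0, ← Real.exp_neg, Real.exp_le_exp, neg_le_neg_iff, ← hX]
    calc b / 4 * vkExp X ≤ 1 * vkExp X := by gcongr; linarith
      _ ≤ X := by linarith
  have e1 : x / (x * E) * (E * E + E * E) = 2 * E := by field_simp; ring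
  have e2 : 2 * (x * E + 1) / x = 2 * E + 2 * (1 / x) := by field_simp
  calc |moebiusLogSum x| ≤ x / (x * E) * (|smoothMoebius x| + |smoothMoebius (x - x * E)|) + 2 * (x * E + 1) / x := key
    _ ≤ x / (x * E) * (E * E + E * E) + 2 * (x * E + 1) / x := by gcongr
    _ ≤ 8 * E := by rw [e1, e2]; linarith

theorem one_lt_log_three : 1 < Real.log 3 := by
  rw [Real.lt_log_iff_exp_lt (by norm_num)]
  have := Real.exp_one_lt_d9
  linarith

theorem vkExp_le_add {X₁ X₂ u : ℝ} (h1 : Real.log 3 ≤ X₁) (h2 : X₁ ≤ X₂) (h3 : X₂ ≤ X₁ + u) :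
    vkExp X₂ ≤ vkExp X₁ + (Real.log (Real.log 3) ^ ((1 : ℝ) / 5))⁻¹ * (1 + u) := by
  have h0 := one_lt_log_three
  have hu : 0 ≤ u := by linarith
  have hl0 : 0 < Real.log (Real.log 3) := Real.log_pos h0
  have hl1 : Real.log (Real.log 3) ≤ Real.log X₁ := Real.log_le_log (by linarith) h1
  have hl2 : Real.log X₁ ≤ Real.log X₂ := Real.log_le_log (by linarith) h2
  have hu1 : u ^ ((3 : ℝ) / 5) ≤ 1 + u := by
    rcases le_total u 1 with h | h
    · exact (Real.rpow_le_one hu h (by norm_num)).trans (by linarith)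
    · calc u ^ ((3 : ℝ) / 5) ≤ u ^ (1 : ℝ) := Real.rpow_le_rpow_of_exponent_le h (by norm_num)
        _ ≤ 1 + u := by rw [Real.rpow_one]; linarith
  unfold vkExp
  calc X₂ ^ ((3 : ℝ) / 5) / Real.log X₂ ^ ((1 : ℝ) / 5) ≤ (X₁ + u) ^ ((3 : ℝ) / 5) / Real.log X₁ ^ ((1 : ℝ) / 5) := by
        have : 0 < Real.log X₁ := by linarith
        have : 0 ≤ X₂ := by linarith
        have : 0 ≤ X₁ + u := by linarith
        gcongr
    _ ≤ (X₁ ^ ((3 : ℝ) / 5) + u ^ ((3 : ℝ) / 5)) / Real.log X₁ ^ ((1 : ℝ) / 5) := by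
        have : 0 < Real.log X₁ := by linarith
        gcongr
        exact Real.rpow_add_le_add_rpow (by linarith) hu (by norm_num) (by norm_num)
    _ = X₁ ^ ((3 : ℝ) / 5) / Real.log X₁ ^ ((1 : ℝ) / 5) + (Real.log X₁ ^ ((1 : ℝ) / 5))⁻¹ * u ^ ((3 : ℝ) / 5) := by
        ring
    _ ≤ _ := by gcongr

theorem curlyL_rpow_neg_le {c y₁ y₂ u : ℝ} (hc : 0 ≤ c) (hu : 1 ≤ u) (h1 : 3 ≤ y₁) (h2 : y₁ ≤ y₂) (h3 : y₂ ≤ u * y₁) :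
    curlyL y₁ ^ (-c) ≤ Real.exp (c * (Real.log (Real.log 3) ^ ((1 : ℝ) / 5))⁻¹) *
      u ^ (c * (Real.log (Real.log 3) ^ ((1 : ℝ) / 5))⁻¹) * curlyL y₂ ^ (-c) := by
  have hy1 : 0 < y₁ := by linarith
  have hy2 : 0 < y₂ := by linarith
  set D := (Real.log (Real.log 3) ^ ((1 : ℝ) / 5))⁻¹
  have := vkExp_le_add (u := Real.log u) (Real.log_le_log (by norm_num) h1) (Real.log_le_log hy1 h2)
    (by rw [← Real.log_mul hy1.ne' (by linarith), mul_comm]; exact Real.log_le_log hy2 h3)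
  rw [curlyL_eq_exp, curlyL_eq_exp, ← Real.exp_mul, ← Real.exp_mul, Real.rpow_def_of_pos (by linarith : 0 < u),
    ← Real.exp_add, ← Real.exp_add, Real.exp_le_exp]
  have h4 := mul_le_mul_of_nonneg_left this hc
  linarith

theorem exists_moebiusLogSum_div_bound : ∃ c > (0 : ℝ), ∃ C > (0 : ℝ), ∀ z : ℝ, ∀ e : ℕ, 1 ≤ e → (e : ℝ) ≤ z →
    |moebiusLogSum (z / e)| ≤ C * (e : ℝ) ^ ((1 : ℝ) / 8) * curlyL (max 3 (2 * z)) ^ (-c) := by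
  obtain ⟨b, hb, X₀, hX₀⟩ := exists_moebiusLogSum_bound
  set D := (Real.log (Real.log 3) ^ ((1 : ℝ) / 5))⁻¹ with hD
  have hl0 : 0 < Real.log (Real.log 3) := Real.log_pos one_lt_log_three
  have hD0 : 0 < D := by positivity
  obtain ⟨c, hc, hcb, hcD⟩ : ∃ c > 0, c ≤ b ∧ c ≤ 1 / (8 * D) :=
    ⟨min b (1 / (8 * D)), by positivity, min_le_left _ _, min_le_right _ _⟩
  have hcD' : c * D ≤ 1 / 8 := by
    rw [le_div_iff₀ (by positivity)] at hcD
    linarith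
  set Y := max X₀ (Real.log 3) with hY
  have base : ∃ C > (0 : ℝ), ∀ x : ℝ, 1 ≤ x → |moebiusLogSum x| ≤ C * curlyL (max 3 x) ^ (-c) := by
    have h3 : vkExp (Real.log 3) + D * (1 + Y) = vkExp (Real.log 3) + D * (1 + Y) := rfl
    refine ⟨max 8 (Real.exp Y * Real.exp (c * (vkExp (Real.log 3) + D * (1 + Y)))), by positivity, fun x hx => ?_⟩
    have hpos : 0 < curlyL (max 3 x) ^ (-c) := by rw [curlyL_eq_exp]; positivity
    rcases le_total Y (Real.log x) with h | h
    · have hx3 : 3 ≤ x := (Real.log_le_log_iff (by norm_num) (by linarith)).1 ((le_max_right _ _).trans h)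
      have h1 := hX₀ x ((le_max_left _ _).trans h) hx
      rw [max_eq_right hx3, curlyL_eq_exp, ← Real.exp_mul]
      have hv : 0 ≤ vkExp (Real.log x) := by
        have : 0 < Real.log x := by
          have := one_lt_log_three
          have := Real.log_le_log (by norm_num) hx3
          linarith
        have : 0 ≤ Real.log (Real.log x) := by
          refine Real.log_nonneg ?_
          have := one_lt_log_three
          have := Real.log_le_log (by norm_num) hx3
          linarith
        unfold vkExp
        positivity
      refine h1.trans ?_
      refine mul_le_mul (le_max_left _ _) ?_ (Real.exp_pos _).le (by positivity)
      rw [Real.exp_le_exp]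
      nlinarith
    · have h1 := abs_moebiusLogSum_le_self hx
      have hxY : x ≤ Real.exp Y := by
        rw [← Real.log_le_iff_le_exp (by linarith)]
        exact h
      refine h1.trans ?_
      calc x ≤ Real.exp Y * 1 := by rw [mul_one]; exact hxY
        _ ≤ Real.exp Y * (Real.exp (c * (vkExp (Real.log 3) + D * (1 + Y))) * curlyL (max 3 x) ^ (-c)) := by
            gcongr
            rw [curlyL_eq_exp, ← Real.exp_mul, ← Real.exp_add]
            refine Real.one_le_exp ?_
            have hm : Real.log (max 3 x) ≤ Y := by
              rcases max_choice 3 x with h' | h'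
              · rw [h']; exact le_max_right _ _
              · rw [h']; exact h
            have := vkExp_le_add (X₁ := Real.log 3) (X₂ := Real.log (max 3 x)) (u := Y) le_rfl
              (Real.log_le_log (by norm_num) (le_max_left _ _)) (by have := one_lt_log_three; linarith)
            have := mul_le_mul_of_nonneg_left this hc.le
            linarith
        _ ≤ _ := by
            rw [← mul_assoc]
            gcongr
            exact le_max_right _ _
  obtain ⟨C, hC, hbase⟩ := base
  refine ⟨c, hc, C * (Real.exp (c * D) * 2), by positivity, fun z e he hez => ?_⟩
  have he1 : (1 : ℝ) ≤ e := by exact_mod_cast he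
  have hz : 0 < z := by linarith
  refine (hbase (z / e) (by rw [one_le_div (by linarith)]; exact hez)).trans ?_
  rw [mul_assoc C, mul_assoc C]
  gcongr
  have hze : z / e ≤ z := div_le_self hz.le he1
  refine (curlyL_rpow_neg_le (u := 2 * e) hc.le (by linarith) (le_max_left 3 (z / e))
    (max_le_max le_rfl (by linarith : z / e ≤ 2 * z)) ?_).trans ?_
  · refine max_le ?_ ?_
    · nlinarith [le_max_left 3 (z / e)]
    · have : z / e ≤ max 3 (z / e) := le_max_right _ _
      have h2 : 2 * z = 2 * e * (z / e) := by field_simp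
      rw [h2]
      gcongr
  · have hpos : 0 < curlyL (max 3 (2 * z)) ^ (-c) := by rw [curlyL_eq_exp]; positivity
    rw [← hD]
    refine mul_le_mul_of_nonneg_right ?_ hpos.le
    rw [mul_assoc (Real.exp _)]
    gcongr
    rw [Real.mul_rpow (by norm_num) (by linarith)]
    have a1 : (2 : ℝ) ^ (c * D) ≤ 2 := by
      calc (2 : ℝ) ^ (c * D) ≤ 2 ^ (1 : ℝ) := Real.rpow_le_rpow_of_exponent_le (by norm_num) (by linarith)
        _ = 2 := Real.rpow_one 2
    have a2 : (e : ℝ) ^ (c * D) ≤ (e : ℝ) ^ ((1 : ℝ) / 8) := Real.rpow_le_rpow_of_exponent_le he1 hcD'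
    gcongr

theorem psiM_mul {m a b : ℕ} (hab : a.Coprime b) : psiM m (a * b) = psiM m a * psiM m b := by
  rw [psiM, hab.primeFactors_mul, filter_union, prod_union]
  · rfl
  · exact disjoint_filter_filter hab.disjoint_primeFactors

theorem psiM_prime {m p : ℕ} (hp : p.Prime) : psiM m p = if p ∣ m then 1 else p + 1 := by
  rw [psiM, hp.primeFactors, filter_singleton]
  split_ifs <;> simp_all

/-- The function `d ↦ μ(d)/ψ_m(d)` restricted to `d` coprime to `δ`. -/
noncomputable def moebiusPsi (m δ : ℕ) : ArithmeticFunction ℝ :=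
  ⟨fun d => if d.Coprime δ then (ArithmeticFunction.moebius d : ℝ) / (psiM m d : ℝ) else 0, by simp⟩

theorem moebiusPsi_apply (m δ d : ℕ) : moebiusPsi m δ d =
    if d.Coprime δ then (ArithmeticFunction.moebius d : ℝ) / (psiM m d : ℝ) else 0 := rfl

theorem isMultiplicative_moebiusPsi (m δ : ℕ) : (moebiusPsi m δ).IsMultiplicative := by
  refine ⟨by simp [moebiusPsi_apply, psiM], fun {a b} hab => ?_⟩
  rw [moebiusPsi_apply, moebiusPsi_apply, moebiusPsi_apply]
  by_cases ha : a.Coprime δ <;> by_cases hb : b.Coprime δ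
  · rw [if_pos (Nat.Coprime.mul_left ha hb), if_pos ha, if_pos hb,
      ArithmeticFunction.isMultiplicative_moebius.map_mul_of_coprime hab, psiM_mul hab]
    push_cast
    rw [mul_div_mul_comm]
  · rw [if_neg hb, if_neg fun h => hb h.coprime_mul_left, mul_zero]
  · rw [if_neg ha, if_neg fun h => ha h.coprime_mul_right, zero_mul]
  · rw [if_neg ha, if_neg fun h => ha h.coprime_mul_right, zero_mul]

/-- The arithmetic function `n ↦ 1/n`. -/
noncomputable def recip : ArithmeticFunction ℝ := ⟨fun n => (n : ℝ)⁻¹, by simp⟩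

theorem recip_apply (n : ℕ) : recip n = (n : ℝ)⁻¹ := rfl

theorem isMultiplicative_recip : recip.IsMultiplicative := by
  refine ⟨by simp [recip_apply], fun {a b} _ => ?_⟩
  rw [recip_apply, recip_apply, recip_apply]
  push_cast
  rw [mul_inv]

/-- The arithmetic function `n ↦ μ(n)/n`. -/
noncomputable def moebiusRecip : ArithmeticFunction ℝ :=
  ⟨fun n => (ArithmeticFunction.moebius n : ℝ) / n, by simp⟩

theorem moebiusRecip_apply (n : ℕ) : moebiusRecip n = (ArithmeticFunction.moebius n : ℝ) / n := rfl

theorem moebiusRecip_mul_recip : moebiusRecip * recip = 1 := by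
  ext n
  rw [ArithmeticFunction.mul_apply]
  have h1 : ∑ x ∈ n.divisorsAntidiagonal, moebiusRecip x.1 * recip x.2 =
      (∑ x ∈ n.divisorsAntidiagonal, (ArithmeticFunction.moebius x.1 : ℝ)) * (n : ℝ)⁻¹ := by
    rw [sum_mul]
    refine sum_congr rfl fun x hx => ?_
    rw [moebiusRecip_apply, recip_apply, ← (Nat.mem_divisorsAntidiagonal.1 hx).1]
    push_cast
    rw [mul_inv, div_eq_mul_inv, mul_assoc]
  rw [h1]
  have h2 : ∑ x ∈ n.divisorsAntidiagonal, (ArithmeticFunction.moebius x.1 : ℝ) = if n = 1 then 1 else 0 := by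
    have := congrArg (fun f : ArithmeticFunction ℤ => f n) ArithmeticFunction.moebius_mul_coe_zeta
    simp only [ArithmeticFunction.mul_apply, ArithmeticFunction.one_apply] at this
    have h3 : ∑ x ∈ n.divisorsAntidiagonal, ArithmeticFunction.moebius x.1 = if n = 1 then 1 else 0 := by
      rw [← this]
      refine sum_congr rfl fun x hx => ?_
      have := (Nat.mem_divisorsAntidiagonal.1 hx)
      have h0 : x.2 ≠ 0 := fun h => this.2 (by rw [← this.1, h, mul_zero])
      simp [ArithmeticFunction.zeta_apply, h0]
    have h4 := congrArg (fun k : ℤ => (k : ℝ)) h3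
    simpa using h4
  rw [h2, ArithmeticFunction.one_apply]
  split_ifs with h <;> simp [h]

/-- The Dirichlet quotient of `moebiusPsi` by `moebiusRecip`. -/
noncomputable def psiQuot (m δ : ℕ) : ArithmeticFunction ℝ := moebiusPsi m δ * recip

theorem isMultiplicative_psiQuot (m δ : ℕ) : (psiQuot m δ).IsMultiplicative :=
  (isMultiplicative_moebiusPsi m δ).mul isMultiplicative_recip

theorem moebiusPsi_eq (m δ : ℕ) : moebiusPsi m δ = psiQuot m δ * moebiusRecip := by
  rw [psiQuot, mul_assoc, mul_comm recip, moebiusRecip_mul_recip, mul_one]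

theorem psiQuot_prime_pow (m δ : ℕ) {p : ℕ} (hp : p.Prime) (k : ℕ) :
    psiQuot m δ (p ^ (k + 1)) = (1 + p * moebiusPsi m δ p) * ((p : ℝ) ^ (k + 1))⁻¹ := by
  rw [psiQuot, ArithmeticFunction.mul_apply, Nat.sum_divisorsAntidiagonal (f := fun a b => moebiusPsi m δ a * recip b),
    Nat.sum_divisors_prime_pow hp, sum_range_succ', sum_range_succ']
  have hp0 : (p : ℝ) ≠ 0 := by exact_mod_cast hp.ne_zero
  have hz : ∑ i ∈ Finset.range k, moebiusPsi m δ (p ^ (i + 1 + 1)) * recip (p ^ (k + 1) / p ^ (i + 1 + 1)) = 0 := by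
    refine sum_eq_zero fun i _ => ?_
    have : ArithmeticFunction.moebius (p ^ (i + 1 + 1)) = 0 := by
      rw [ArithmeticFunction.moebius_apply_prime_pow hp (by omega), if_neg (by omega)]
    rw [moebiusPsi_apply, this]
    simp
  rw [hz, zero_add, zero_add, pow_one, pow_zero, (isMultiplicative_moebiusPsi m δ).1, pow_succ,
    Nat.mul_div_cancel _ hp.pos, Nat.div_one, recip_apply, recip_apply]
  push_cast
  field_simp
  ring

theorem one_add_mul_moebiusPsi_prime (m δ : ℕ) {p : ℕ} (hp : p.Prime) :
    1 + p * moebiusPsi m δ p = if p ∣ δ then 1 else if p ∣ m then 1 - (p : ℝ) else ((p : ℝ) + 1)⁻¹ := by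
  have hp0 : (0 : ℝ) < p := by exact_mod_cast hp.pos
  rw [moebiusPsi_apply, ArithmeticFunction.moebius_apply_prime hp, psiM_prime hp]
  by_cases h1 : p ∣ δ
  · rw [if_neg fun h => (hp.coprime_iff_not_dvd.1 h) h1, if_pos h1, mul_zero, add_zero]
  · rw [if_pos (hp.coprime_iff_not_dvd.2 h1), if_neg h1]
    split_ifs
    · push_cast; ring
    · push_cast; field_simp; ring

theorem sum_moebiusPsi (m δ : ℕ) (z : ℝ) : ∑ d ∈ Icc 1 ⌊z⌋₊, moebiusPsi m δ d =
    ∑ e ∈ Icc 1 ⌊z⌋₊, psiQuot m δ e * moebiusLogSum (z / e) := by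
  rw [moebiusPsi_eq]
  have h := ArithmeticFunction.sum_Ioc_mul_eq_sum_sum (psiQuot m δ) moebiusRecip ⌊z⌋₊
  change ∑ n ∈ Ioc 0 ⌊z⌋₊, (psiQuot m δ * moebiusRecip) n = _ at h
  have e : ∀ N : ℕ, Icc 1 N = Ioc 0 N := fun N => by ext; simp [Nat.succ_le_iff]
  rw [e, h]
  refine sum_congr rfl fun n _ => ?_
  rw [moebiusLogSum, e, Nat.floor_div_natCast]
  rfl

/-- The weight `|g(n)| n^{1/8}` with `g` the Dirichlet quotient `psiQuot`. -/
noncomputable def psiWeight (m δ n : ℕ) : ℝ := |psiQuot m δ n| * (n : ℝ) ^ ((1 : ℝ) / 8)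

theorem psiWeight_nonneg (m δ n : ℕ) : 0 ≤ psiWeight m δ n := by unfold psiWeight; positivity

theorem psiWeight_one (m δ : ℕ) : psiWeight m δ 1 = 1 := by
  simp [psiWeight, (isMultiplicative_psiQuot m δ).1]

theorem psiWeight_mul (m δ : ℕ) {a b : ℕ} (hab : a.Coprime b) :
    psiWeight m δ (a * b) = psiWeight m δ a * psiWeight m δ b := by
  rw [psiWeight, (isMultiplicative_psiQuot m δ).2 hab, abs_mul, Nat.cast_mul,
    Real.mul_rpow (by positivity) (by positivity), psiWeight, psiWeight]
  ring

theorem psiWeight_prime_pow (m δ : ℕ) {p : ℕ} (hp : p.Prime) (k : ℕ) : psiWeight m δ (p ^ (k + 1)) =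
    |1 + p * moebiusPsi m δ p| * ((((p : ℝ) ^ ((1 : ℝ) / 8)) ^ 7)⁻¹) ^ (k + 1) := by
  have hp0 : (0 : ℝ) < p := by exact_mod_cast hp.pos
  have h8 : (p : ℝ) = ((p : ℝ) ^ ((1 : ℝ) / 8)) ^ 8 := by
    rw [← Real.rpow_natCast, ← Real.rpow_mul hp0.le]; norm_num
  have h1 : (((p ^ (k + 1) : ℕ) : ℝ)) ^ ((1 : ℝ) / 8) = ((p : ℝ) ^ ((1 : ℝ) / 8)) ^ (k + 1) := by
    push_cast
    rw [← Real.rpow_natCast, ← Real.rpow_natCast, ← Real.rpow_mul hp0.le, ← Real.rpow_mul hp0.le, mul_comm]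
  rw [psiWeight, psiQuot_prime_pow m δ hp, h1, abs_mul, mul_assoc]
  congr 1
  set t := (p : ℝ) ^ ((1 : ℝ) / 8) with ht
  have ht0 : 0 < t := by positivity
  rw [abs_of_pos (by positivity), h8, ← inv_pow, ← mul_pow]
  congr 1
  field_simp

theorem three_halves_le_rpow_pow {p : ℕ} (hp : p.Prime) : 3 / 2 ≤ ((p : ℝ) ^ ((1 : ℝ) / 8)) ^ 7 := by
  have hp2 : (2 : ℝ) ≤ p := by exact_mod_cast hp.two_le
  have h8 : (p : ℝ) = ((p : ℝ) ^ ((1 : ℝ) / 8)) ^ 8 := by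
    rw [← Real.rpow_natCast, ← Real.rpow_mul (by linarith)]; norm_num
  have h : ((3 : ℝ) / 2) ^ 8 ≤ (((p : ℝ) ^ ((1 : ℝ) / 8)) ^ 7) ^ 8 := by
    rw [← pow_mul, mul_comm, pow_mul, ← h8]
    calc ((3 : ℝ) / 2) ^ 8 ≤ 2 ^ 7 := by norm_num
      _ ≤ _ := pow_le_pow_left₀ (by norm_num) hp2 7
  exact le_of_pow_le_pow_left₀ (by norm_num) (by positivity) h

theorem hasSum_psiWeight_prime_pow (m δ : ℕ) {p : ℕ} (hp : p.Prime) :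
    Summable (fun k => psiWeight m δ (p ^ k)) ∧
      ∑' k, psiWeight m δ (p ^ k) ≤
        1 + 3 * (|1 + p * moebiusPsi m δ p| * (((p : ℝ) ^ ((1 : ℝ) / 8)) ^ 7)⁻¹) := by
  have ht := three_halves_le_rpow_pow hp
  set A := |1 + p * moebiusPsi m δ p| with hA
  set q := (((p : ℝ) ^ ((1 : ℝ) / 8)) ^ 7)⁻¹ with hq
  have hq0 : 0 < q := by positivity
  have hq1 : q ≤ 2 / 3 := by
    rw [hq, show (2 : ℝ) / 3 = (3 / 2)⁻¹ by norm_num]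
    exact inv_anti₀ (by norm_num) ht
  have hg : HasSum (fun k => psiWeight m δ (p ^ (k + 1))) (A * q * (1 - q)⁻¹) := by
    have := (hasSum_geometric_of_lt_one hq0.le (by linarith)).mul_left (A * q)
    convert! this using 1
    funext k
    rw [psiWeight_prime_pow m δ hp, pow_succ]
    ring
  have hs : Summable (fun k => psiWeight m δ (p ^ k)) := (summable_nat_add_iff 1).1 hg.summable
  refine ⟨hs, ?_⟩
  rw [hs.tsum_eq_zero_add, hg.tsum_eq, pow_zero, psiWeight_one]
  have hA0 : 0 ≤ A := abs_nonneg _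
  have : (1 - q)⁻¹ ≤ 3 := by
    rw [show (3 : ℝ) = (1 / 3)⁻¹ by norm_num]
    exact inv_anti₀ (by norm_num) (by linarith)
  have : A * q * (1 - q)⁻¹ ≤ A * q * 3 := by gcongr
  linarith

theorem local_factor_le (m δ : ℕ) {p : ℕ} (hp : p.Prime) :
    1 + 3 * (|1 + p * moebiusPsi m δ p| * (((p : ℝ) ^ ((1 : ℝ) / 8)) ^ 7)⁻¹) ≤
      (1 + 2 ^ 28 / (p : ℝ) ^ ((3 : ℝ) / 2)) * (if p ∣ m then ((p : ℝ) + 1) ^ ((1 : ℝ) / 4) else 1) *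
        (if p ∣ δ then 1 + 2 / √p else 1) := by
  have hp2 : (2 : ℝ) ≤ p := by exact_mod_cast hp.two_le
  have hp0 : (0 : ℝ) < p := by linarith
  set t := (p : ℝ) ^ ((1 : ℝ) / 8) with ht
  have h8 : (p : ℝ) = t ^ 8 := by
    rw [ht, ← Real.rpow_natCast, ← Real.rpow_mul hp0.le]; norm_num
  have h12 : (p : ℝ) ^ ((3 : ℝ) / 2) = t ^ 12 := by
    rw [ht, ← Real.rpow_natCast, ← Real.rpow_mul hp0.le]; norm_num
  have h4 : √(p : ℝ) = t ^ 4 := by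
    rw [ht, ← Real.rpow_natCast, ← Real.rpow_mul hp0.le, Real.sqrt_eq_rpow]; norm_num
  have h2 : t ^ 2 ≤ ((p : ℝ) + 1) ^ ((1 : ℝ) / 4) := by
    have : t ^ 2 = (p : ℝ) ^ ((1 : ℝ) / 4) := by
      rw [ht, ← Real.rpow_natCast, ← Real.rpow_mul hp0.le]; norm_num
    rw [this]
    gcongr
    linarith
  have ht1 : 1 ≤ t := Real.one_le_rpow (by linarith) (by norm_num)
  have ht0 : 0 < t := by linarith
  set M : ℝ := if p ∣ m then ((p : ℝ) + 1) ^ ((1 : ℝ) / 4) else 1 with hM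
  set R : ℝ := if p ∣ δ then 1 + 2 / √(p : ℝ) else 1 with hR
  have hM1 : 1 ≤ M := by
    rw [hM]; split_ifs
    · exact Real.one_le_rpow (by linarith) (by norm_num)
    · exact le_rfl
  have hR1 : 1 ≤ R := by
    rw [hR]; split_ifs
    · have : 0 ≤ 2 / √(p : ℝ) := by positivity
      linarith
    · exact le_rfl
  rw [h12]
  have hG1 : 1 ≤ 1 + 2 ^ 28 / t ^ 12 := by
    have : 0 ≤ 2 ^ 28 / t ^ 12 := by positivity
    linarith
  have hA := one_add_mul_moebiusPsi_prime m δ hp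
  set A := 1 + p * moebiusPsi m δ p with hAd
  have hAp : |A| ≤ p := by
    rw [hA, abs_le]
    split_ifs
    · constructor <;> linarith
    · constructor <;> linarith
    · have a1 : 0 < ((p : ℝ) + 1)⁻¹ := by positivity
      have a2 : ((p : ℝ) + 1)⁻¹ ≤ 1 := inv_le_one_of_one_le₀ (by linarith)
      constructor <;> linarith
  rcases le_total t 4 with h | h
  · have e1 : |A| * (t ^ 7)⁻¹ ≤ 4 := by
      calc |A| * (t ^ 7)⁻¹ ≤ p * (t ^ 7)⁻¹ := by gcongr
        _ = t := by rw [h8]; field_simp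
        _ ≤ 4 := h
    have e2 : (12 : ℝ) ≤ 2 ^ 28 / t ^ 12 := by
      rw [le_div_iff₀ (by positivity)]
      calc 12 * t ^ 12 ≤ 12 * 4 ^ 12 := by gcongr
        _ ≤ _ := by norm_num
    calc 1 + 3 * (|A| * (t ^ 7)⁻¹) ≤ (1 + 2 ^ 28 / t ^ 12) * 1 * 1 := by linarith
      _ ≤ _ := by gcongr
  · by_cases hδ : p ∣ δ
    · rw [hA, if_pos hδ, abs_one, one_mul]
      calc 1 + 3 * (t ^ 7)⁻¹ ≤ 1 * 1 * R := by
            rw [hR, if_pos hδ, h4, one_mul, one_mul, div_eq_mul_inv]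
            have : (t ^ 7)⁻¹ = (t ^ 3)⁻¹ * (t ^ 4)⁻¹ := by rw [← mul_inv, ← pow_add]
            rw [this]
            have h3 : (t ^ 3)⁻¹ ≤ 2 / 3 := by
              rw [show (2 : ℝ) / 3 = (3 / 2)⁻¹ by norm_num]
              refine inv_anti₀ (by norm_num) ?_
              calc (3 : ℝ) / 2 ≤ 4 ^ 3 := by norm_num
                _ ≤ t ^ 3 := by gcongr
            have : 0 < (t ^ 4)⁻¹ := by positivity
            nlinarith
        _ ≤ _ := by gcongr
    · by_cases hm : p ∣ m
      · rw [hA, if_neg hδ, if_pos hm]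
        have e1 : |1 - (p : ℝ)| * (t ^ 7)⁻¹ ≤ t := by
          calc |1 - (p : ℝ)| * (t ^ 7)⁻¹ ≤ p * (t ^ 7)⁻¹ := by
                gcongr
                rw [abs_le]
                constructor <;> linarith
            _ = t := by rw [h8]; field_simp
        calc 1 + 3 * (|1 - (p : ℝ)| * (t ^ 7)⁻¹) ≤ 1 + 3 * t := by linarith
          _ ≤ t ^ 2 := by nlinarith
          _ ≤ 1 * M * 1 := by rw [hM, if_pos hm, one_mul, mul_one]; exact h2
          _ ≤ _ := by gcongr
      · rw [hA, if_neg hδ, if_neg hm]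
        have e1 : |((p : ℝ) + 1)⁻¹| * (t ^ 7)⁻¹ ≤ (t ^ 12)⁻¹ := by
          rw [abs_of_pos (by positivity), ← mul_inv]
          refine inv_anti₀ (by positivity) ?_
          calc t ^ 12 ≤ t ^ 8 * t ^ 7 := by rw [← pow_add]; exact pow_le_pow_right₀ ht1 (by norm_num)
            _ ≤ (p + 1) * t ^ 7 := by rw [← h8]; gcongr; linarith
        have e2 : 3 * (t ^ 12)⁻¹ ≤ 2 ^ 28 / t ^ 12 := by
          rw [div_eq_mul_inv]
          gcongr
          norm_num
        calc 1 + 3 * (|((p : ℝ) + 1)⁻¹| * (t ^ 7)⁻¹) ≤ (1 + 2 ^ 28 / t ^ 12) * 1 * 1 := by linarith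
          _ ≤ _ := by gcongr

theorem prod_one_add_rpow_le : ∃ C > 0, ∀ N : ℕ,
    ∏ p ∈ N.primesBelow, (1 + 2 ^ 28 / (p : ℝ) ^ ((3 : ℝ) / 2)) ≤ C := by
  have hs : Summable fun n : ℕ => 2 ^ 28 * (1 / (n : ℝ) ^ ((3 : ℝ) / 2)) :=
    (Real.summable_one_div_nat_rpow.2 (by norm_num)).mul_left _
  refine ⟨Real.exp (∑' n : ℕ, 2 ^ 28 * (1 / (n : ℝ) ^ ((3 : ℝ) / 2))), Real.exp_pos _, fun N => ?_⟩
  calc ∏ p ∈ N.primesBelow, (1 + 2 ^ 28 / (p : ℝ) ^ ((3 : ℝ) / 2))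
      ≤ ∏ p ∈ N.primesBelow, Real.exp (2 ^ 28 * (1 / (p : ℝ) ^ ((3 : ℝ) / 2))) := by
        refine prod_le_prod (fun p _ => by positivity) fun p _ => ?_
        rw [mul_one_div, add_comm]
        exact Real.add_one_le_exp _
    _ = Real.exp (∑ p ∈ N.primesBelow, 2 ^ 28 * (1 / (p : ℝ) ^ ((3 : ℝ) / 2))) :=
        (Real.exp_sum _ _).symm
    _ ≤ _ := Real.exp_le_exp.2 (hs.sum_le_tsum _ fun n _ => by positivity)

theorem primesBelow_filter_dvd {m N : ℕ} (hm : 1 ≤ m) (hN : m < N) :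
    N.primesBelow.filter (· ∣ m) = m.primeFactors := by
  ext p
  simp only [mem_filter, Nat.mem_primesBelow, Nat.mem_primeFactors]
  refine ⟨fun h => ⟨h.1.2, h.2, by omega⟩, fun h => ⟨⟨?_, h.1⟩, h.2.1⟩⟩
  exact (Nat.le_of_dvd hm h.2.1).trans_lt hN

theorem exists_sum_psiWeight_le : ∃ C > 0, ∀ m δ : ℕ, 1 ≤ m → 1 ≤ δ → ∀ M : ℕ,
    ∑ e ∈ Icc 1 M, psiWeight m δ e ≤ C * (psi m : ℝ) ^ ((1 : ℝ) / 4) * rfun δ := by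
  obtain ⟨C, hC, h⟩ := prod_one_add_rpow_le
  refine ⟨C, hC, fun m δ hm hδ M => ?_⟩
  set N := max M (max m δ) + 1 with hN
  obtain ⟨hsum, hE⟩ := EulerProduct.summable_and_hasSum_smoothNumbers_prod_primesBelow_tsum
    (psiWeight_one m δ) (fun {a b} hab => psiWeight_mul m δ hab)
    (fun {p} hp => (hasSum_psiWeight_prime_pow m δ hp).1.norm) N
  have hmem : ∀ e ∈ Icc 1 M, e ∈ N.smoothNumbers := fun e he =>
    Nat.mem_smoothNumbers_of_lt (mem_Icc.1 he).1 (by have := (mem_Icc.1 he).2; omega)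
  have h1 : ∑ e ∈ Icc 1 M, psiWeight m δ e ≤
      ∏ p ∈ N.primesBelow, ∑' k, psiWeight m δ (p ^ k) := by
    classical
    rw [← sum_subtype_of_mem _ hmem]
    exact sum_le_hasSum _ (fun e _ => psiWeight_nonneg m δ e) hE
  refine h1.trans ?_
  calc ∏ p ∈ N.primesBelow, ∑' k, psiWeight m δ (p ^ k)
      ≤ ∏ p ∈ N.primesBelow, ((1 + 2 ^ 28 / (p : ℝ) ^ ((3 : ℝ) / 2)) *
          (if p ∣ m then ((p : ℝ) + 1) ^ ((1 : ℝ) / 4) else 1) *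
          (if p ∣ δ then 1 + 2 / √p else 1)) := by
        refine prod_le_prod (fun p _ => tsum_nonneg fun k => psiWeight_nonneg m δ _) fun p hp => ?_
        have hp' := (Nat.mem_primesBelow.1 hp).2
        exact (hasSum_psiWeight_prime_pow m δ hp').2.trans (local_factor_le m δ hp')
    _ = (∏ p ∈ N.primesBelow, (1 + 2 ^ 28 / (p : ℝ) ^ ((3 : ℝ) / 2))) *
          (psi m : ℝ) ^ ((1 : ℝ) / 4) * rfun δ := by
        rw [prod_mul_distrib, prod_mul_distrib, ← prod_filter, ← prod_filter,
          primesBelow_filter_dvd hm (by omega), primesBelow_filter_dvd hδ (by omega),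
          Real.finsetProd_rpow _ _ fun p _ => by positivity, psi, rfun]
        push_cast
        rfl
    _ ≤ _ := by
        have : 0 ≤ rfun δ := prod_nonneg fun p _ => by positivity
        gcongr
        exact h N

theorem abs_sum_moebius_mul_div_le (m δ M : ℕ) :
    |∑ d ∈ Icc 1 M, (ArithmeticFunction.moebius (d * δ) : ℝ) / (psiM m d : ℝ)| ≤
      |∑ d ∈ Icc 1 M, moebiusPsi m δ d| := by
  have h : ∑ d ∈ Icc 1 M, (ArithmeticFunction.moebius (d * δ) : ℝ) / (psiM m d : ℝ) =
      (ArithmeticFunction.moebius δ : ℝ) * ∑ d ∈ Icc 1 M, moebiusPsi m δ d := by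
    rw [mul_sum]
    refine sum_congr rfl fun d _ => ?_
    rw [moebiusPsi_apply]
    split_ifs with hd
    · rw [ArithmeticFunction.isMultiplicative_moebius.map_mul_of_coprime hd]
      push_cast
      ring
    · rw [ArithmeticFunction.moebius_eq_zero_of_not_squarefree
        fun hs => hd (Nat.squarefree_mul_iff.1 hs).1]
      simp
  rw [h, abs_mul]
  refine mul_le_of_le_one_left (abs_nonneg _) ?_
  exact_mod_cast ArithmeticFunction.abs_moebius_le_one

end MoebiusSum

theorem stmt9 :
    ∃ c > (0 : ℝ), ∃ C > (0 : ℝ), ∀ m δ : ℕ, 1 ≤ m → 1 ≤ δ → ∀ y : ℝ, (δ : ℝ) ≤ y →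
      |∑ d ∈ Finset.Icc 1 ⌊y / (δ : ℝ)⌋₊,
          (ArithmeticFunction.moebius (d * δ) : ℝ) / (psiM m d : ℝ)| ≤
        C * (psi m : ℝ) ^ ((1 : ℝ) / 4) * rfun δ *
          (curlyL (max 3 (2 * y / (δ : ℝ)))) ^ (-c) := by
  obtain ⟨c, hc, K, hK, hM⟩ := MoebiusSum.exists_moebiusLogSum_div_bound
  obtain ⟨C, hC, hW⟩ := MoebiusSum.exists_sum_psiWeight_le
  refine ⟨c, hc, K * C, by positivity, fun m δ hm hδ y _ => ?_⟩
  refine (MoebiusSum.abs_sum_moebius_mul_div_le m δ _).trans ?_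
  set z := y / (δ : ℝ) with hz
  rw [mul_div_assoc, ← hz, MoebiusSum.sum_moebiusPsi]
  have hL : 0 ≤ curlyL (max 3 (2 * z)) ^ (-c) := Real.rpow_nonneg (Real.exp_pos _).le _
  set L := curlyL (max 3 (2 * z)) ^ (-c) with hLd
  calc |∑ e ∈ Icc 1 ⌊z⌋₊, MoebiusSum.psiQuot m δ e * MoebiusSum.moebiusLogSum (z / e)|
      ≤ ∑ e ∈ Icc 1 ⌊z⌋₊, |MoebiusSum.psiQuot m δ e * MoebiusSum.moebiusLogSum (z / e)| := abs_sum_le_sum_abs _ _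
    _ ≤ ∑ e ∈ Icc 1 ⌊z⌋₊, K * L * MoebiusSum.psiWeight m δ e := by
        refine sum_le_sum fun e he => ?_
        obtain ⟨he1, he2⟩ := mem_Icc.1 he
        have hez : (e : ℝ) ≤ z := (Nat.le_floor_iff' (by omega)).1 he2
        rw [abs_mul, MoebiusSum.psiWeight]
        calc |MoebiusSum.psiQuot m δ e| * |MoebiusSum.moebiusLogSum (z / e)|
            ≤ |MoebiusSum.psiQuot m δ e| * (K * (e : ℝ) ^ ((1 : ℝ) / 8) * L) := by
              gcongr
              exact hM z e he1 hez
          _ = _ := by ring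
    _ = K * L * ∑ e ∈ Icc 1 ⌊z⌋₊, MoebiusSum.psiWeight m δ e := (mul_sum _ _ _).symm
    _ ≤ K * L * (C * (psi m : ℝ) ^ ((1 : ℝ) / 4) * rfun δ) := by
        gcongr
        exact hW m δ hm hδ _
    _ = _ := by ring
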